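/- For n ≥ 3, the fundamental group of a closed manifold whose universal cover is homeomorphic to ℝⁿ is not a systolic group. -/

import Mathlib

universe u

/-- An abstract simplicial complex on a vertex type `V`: a downward-closed
family of nonempty finite subsets of `V`. -/
structure SComplex (V : Type u) where
  faces : Set (Finset V)
  nonempty_of_mem : ∀ σ ∈ faces, σ.Nonempty
  down_closed : ∀ σ ∈ faces, ∀ τ : Finset V, τ ⊆ σ → τ.Nonempty → τ ∈ faces

namespace SComplex

variable {V : Type u} [DecidableEq V]

/-- The vertex set of a simplicial complex. -/
def vertexSet (X : SComplex V) : Set V := {v | ({v} : Finset V) ∈ X.faces}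

/-- The geometric realization of a simplicial complex: the set of barycentric
coordinate functions supported on a simplex, inside the product space `V → ℝ`. -/
def realization (X : SComplex V) : Set (V → ℝ) :=
  {f | (∀ v, 0 ≤ f v) ∧ ∃ σ ∈ X.faces, (∀ v, v ∉ σ → f v = 0) ∧ ∑ v ∈ σ, f v = 1}

/-- `Y` is a subcomplex of `X`. -/
def IsSubcomplexOf (Y X : SComplex V) : Prop := Y.faces ⊆ X.faces

/-- `Y` is a full subcomplex of `X`. -/
def IsFullSubcomplexOf (Y X : SComplex V) : Prop :=
  Y.faces ⊆ X.faces ∧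
    ∀ σ ∈ X.faces, (∀ v ∈ σ, ({v} : Finset V) ∈ Y.faces) → σ ∈ Y.faces

/-- The full subcomplex of `X` spanned by a set `W` of vertices. -/
def restrict (X : SComplex V) (W : Set V) : SComplex V where
  faces := {σ | σ ∈ X.faces ∧ ∀ v ∈ σ, v ∈ W}
  nonempty_of_mem := fun σ h => X.nonempty_of_mem σ h.1
  down_closed := fun σ h τ hτ hne =>
    ⟨X.down_closed σ h.1 τ hτ hne, fun v hv => h.2 v (hτ hv)⟩

/-- The link of a simplex `σ` in `X`. -/
def link (X : SComplex V) (σ : Finset V) : SComplex V where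
  faces := {τ | τ ∈ X.faces ∧ Disjoint τ σ ∧ τ ∪ σ ∈ X.faces}
  nonempty_of_mem := fun τ h => X.nonempty_of_mem τ h.1
  down_closed := by
    rintro τ ⟨hτ, hdisj, hunion⟩ ρ hρ hne
    refine ⟨X.down_closed τ hτ ρ hρ hne, ?_, ?_⟩
    · exact Finset.disjoint_left.mpr fun a ha hb => Finset.disjoint_left.mp hdisj (hρ ha) hb
    · exact X.down_closed _ hunion _ (Finset.union_subset_union hρ (subset_refl σ))
        (hne.mono Finset.subset_union_left)

/-- A combinatorial cycle of length `m` in `X` (a subcomplex homeomorphic to a circle):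
an injective enumeration of `m` vertices, consecutive ones joined by edges of `X`. -/
def IsCycle (X : SComplex V) (m : ℕ) (γ : ZMod m → V) : Prop :=
  3 ≤ m ∧ Function.Injective γ ∧ ∀ i : ZMod m, ({γ i, γ (i + 1)} : Finset V) ∈ X.faces

/-- The cycle `γ` has a diagonal: an edge of `X` joining two nonconsecutive vertices. -/
def HasDiagonal (X : SComplex V) (m : ℕ) (γ : ZMod m → V) : Prop :=
  ∃ i j : ZMod m, j ≠ i ∧ j ≠ i + 1 ∧ j ≠ i - 1 ∧ ({γ i, γ j} : Finset V) ∈ X.faces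

/-- A simplicial complex is flag if every finite set of vertices pairwise joined
by edges spans a simplex. -/
def Flag (X : SComplex V) : Prop :=
  ∀ A : Finset V, A.Nonempty → (∀ v ∈ A, ({v} : Finset V) ∈ X.faces) →
    (∀ v ∈ A, ∀ w ∈ A, v ≠ w → ({v, w} : Finset V) ∈ X.faces) → A ∈ X.faces

/-- A simplicial complex is `k`-large if it is flag and every cycle of length
`4 ≤ |γ| < k` has a diagonal. -/
def KLarge (k : ℕ) (X : SComplex V) : Prop :=
  X.Flag ∧ ∀ (m : ℕ) (γ : ZMod m → V), X.IsCycle m γ → 4 ≤ m → m < k → X.HasDiagonal m γ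

/-- A simplicial complex is locally `k`-large if all links of its (nonempty) simplices
are `k`-large. -/
def LocallyKLarge (k : ℕ) (X : SComplex V) : Prop :=
  ∀ σ ∈ X.faces, KLarge k (X.link σ)

/-- A systolic complex: connected, simply connected and locally `6`-large. -/
def Systolic (X : SComplex V) : Prop :=
  LocallyKLarge 6 X ∧ ConnectedSpace X.realization ∧ SimplyConnectedSpace X.realization

/-- A simplicial complex is locally finite if every vertex belongs to finitely
many simplices. -/
def LocallyFinite (X : SComplex V) : Prop :=
  ∀ v : V, {σ ∈ X.faces | v ∈ σ}.Finite

/-- The faces of the closed combinatorial ball of radius `i` around the simplex `σ`: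
`B_0 = σ` and `B_{i+1}` is the union of all closed simplices meeting `B_i`. -/
def ballFaces (X : SComplex V) (σ : Finset V) : ℕ → Set (Finset V)
  | 0 => {τ | τ ∈ X.faces ∧ τ ⊆ σ}
  | i + 1 => {ρ | ρ ∈ X.faces ∧ ∃ τ ∈ X.faces, ρ ⊆ τ ∧
      ∃ v ∈ τ, ({v} : Finset V) ∈ X.ballFaces σ i}

/-- The closed combinatorial ball of radius `i` around `σ`, as a subcomplex. -/
def ball (X : SComplex V) (σ : Finset V) (i : ℕ) : SComplex V where
  faces := X.ballFaces σ i
  nonempty_of_mem := by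
    cases i with
    | zero => exact fun τ h => X.nonempty_of_mem τ h.1
    | succ n => exact fun τ h => X.nonempty_of_mem τ h.1
  down_closed := by
    cases i with
    | zero => exact fun τ h ρ hsub hne =>
        ⟨X.down_closed τ h.1 ρ hsub hne, hsub.trans h.2⟩
    | succ n =>
        rintro τ ⟨hτ, μ, hμ, hsub2, v, hv, hball⟩ ρ hsub hne
        exact ⟨X.down_closed τ hτ ρ hsub hne, μ, hμ, hsub.trans hsub2, v, hv, hball⟩

/-- The faces of the combinatorial sphere of radius `i` around `σ`: the faces of the
ball `B_i` all of whose vertices are at combinatorial distance exactly `i` from `σ`. -/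
def sphereFaces (X : SComplex V) (σ : Finset V) : ℕ → Set (Finset V)
  | 0 => X.ballFaces σ 0
  | i + 1 => {τ | τ ∈ X.ballFaces σ (i + 1) ∧
      ∀ v ∈ τ, ({v} : Finset V) ∉ X.ballFaces σ i}

/-- The combinatorial sphere of radius `i` around `σ`, as a subcomplex: the subcomplex
of `B_i` spanned by the vertices at combinatorial distance `i` from `σ`. -/
def sphere (X : SComplex V) (σ : Finset V) (i : ℕ) : SComplex V where
  faces := X.sphereFaces σ i
  nonempty_of_mem := by
    cases i with
    | zero => exact fun τ h => (X.ball σ 0).nonempty_of_mem τ h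
    | succ n => exact fun τ h => (X.ball σ (n + 1)).nonempty_of_mem τ h.1
  down_closed := by
    cases i with
    | zero => exact fun τ h ρ hsub hne => (X.ball σ 0).down_closed τ h ρ hsub hne
    | succ n =>
        rintro τ ⟨hτ, hout⟩ ρ hsub hne
        exact ⟨(X.ball σ (n + 1)).down_closed τ hτ ρ hsub hne,
          fun v hv => hout v (hsub hv)⟩

/-- The condition `R(v,X)`: for every simplex `σ` of the link `X_v`, the complement
in `X_v` of the open combinatorial ball of radius `2` around `σ` (i.e. the full
subcomplex of `X_v` spanned by the vertices at combinatorial distance at least `2`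
from `σ`) is connected. -/
def CondR (X : SComplex V) (v : V) : Prop :=
  ∀ σ ∈ (X.link {v}).faces,
    ConnectedSpace
      ((X.link {v}).restrict
        {w | ({w} : Finset V) ∉ (X.link {v}).ballFaces σ 1}).realization

/-- A chamber complex of dimension `n`: every simplex is contained in a simplex with
`n+1` vertices (a chamber), there are no larger simplices, and every codimension-one
face lies in at least two chambers. -/
def IsChamberComplex (X : SComplex V) (n : ℕ) : Prop :=
  (∀ σ ∈ X.faces, σ.card ≤ n + 1) ∧
  (∀ σ ∈ X.faces, ∃ τ ∈ X.faces, σ ⊆ τ ∧ τ.card = n + 1) ∧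
  (∀ σ ∈ X.faces, σ.card = n →
    ∃ τ₁ ∈ X.faces, ∃ τ₂ ∈ X.faces, τ₁ ≠ τ₂ ∧ σ ⊆ τ₁ ∧ σ ⊆ τ₂ ∧
      τ₁.card = n + 1 ∧ τ₂.card = n + 1)

/-- Two chambers of an `n`-dimensional chamber complex are adjacent if they share a
codimension-one face. -/
def ChamberAdj (X : SComplex V) (n : ℕ) (σ τ : Finset V) : Prop :=
  σ ∈ X.faces ∧ τ ∈ X.faces ∧ σ.card = n + 1 ∧ τ.card = n + 1 ∧
    ∃ ρ ∈ X.faces, ρ.card = n ∧ ρ ⊆ σ ∧ ρ ⊆ τ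

/-- A chamber complex is gallery connected if any two chambers are joined by a gallery. -/
def GalleryConnected (X : SComplex V) (n : ℕ) : Prop :=
  ∀ σ ∈ X.faces, σ.card = n + 1 → ∀ τ ∈ X.faces, τ.card = n + 1 →
    Relation.ReflTransGen (X.ChamberAdj n) σ τ

/-- A normal chamber complex: gallery connected, with all links of dimension above `0`
gallery connected. -/
def IsNormalChamberComplex (X : SComplex V) (n : ℕ) : Prop :=
  IsChamberComplex X n ∧ GalleryConnected X n ∧
    ∀ σ ∈ X.faces, σ.card ≤ n - 1 → GalleryConnected (X.link σ) (n - σ.card)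

/-- A pseudomanifold of dimension `n`: a chamber complex in which every codimension-one
face belongs to exactly two chambers. -/
def IsPseudomanifold (X : SComplex V) (n : ℕ) : Prop :=
  IsChamberComplex X n ∧
    ∀ σ ∈ X.faces, σ.card = n →
      ({τ | τ ∈ X.faces ∧ σ ⊆ τ ∧ τ.card = n + 1} : Set (Finset V)).ncard = 2

/-- The dimension of a (finite-dimensional) simplicial complex. -/
noncomputable def dim (X : SComplex V) : ℕ := sSup {n : ℕ | ∃ σ ∈ X.faces, σ.card = n + 1}

/-- A simplicial complex is finite dimensional. -/
def IsFiniteDimensional (X : SComplex V) : Prop :=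
  ∃ N : ℕ, ∀ σ ∈ X.faces, σ.card ≤ N + 1

end SComplex
/-- The condition `Conn_n^∞(Y)`: for every compact `K ⊆ Y` there is a compact
`L ⊇ K` such that every map of the `n`-sphere into `Y ∖ L` extends to a map of the
`(n+1)`-ball into `Y ∖ K`. -/
def ConnInfty (Y : Type u) [TopologicalSpace Y] (n : ℤ) : Prop :=
  ∀ K : Set Y, IsCompact K → ∃ L : Set Y, IsCompact L ∧ K ⊆ L ∧
    ∀ f : EuclideanSpace ℝ (Fin (n + 1).toNat) → Y,
      ContinuousOn f (Metric.sphere 0 1) →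
      (∀ x ∈ Metric.sphere (0 : EuclideanSpace ℝ (Fin (n + 1).toNat)) 1, f x ∉ L) →
      ∃ g : EuclideanSpace ℝ (Fin (n + 1).toNat) → Y,
        ContinuousOn g (Metric.closedBall 0 1) ∧
        (∀ x ∈ Metric.closedBall (0 : EuclideanSpace ℝ (Fin (n + 1).toNat)) 1, g x ∉ K) ∧
        ∀ x ∈ Metric.sphere (0 : EuclideanSpace ℝ (Fin (n + 1).toNat)) 1, g x = f x

/-- A space is `n`-connected at infinity if `Conn_k^∞` holds for all `-1 ≤ k ≤ n`. -/
def ConnectedAtInftyUpTo (Y : Type u) [TopologicalSpace Y] (n : ℤ) : Prop :=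
  ∀ k : ℤ, -1 ≤ k → k ≤ n → ConnInfty Y k

/-- A CW structure on a topological space `X`: cells in each dimension with
characteristic maps defined on closed unit balls, such that the open cells partition
`X`, attaching spheres land in lower-dimensional cells, each closed cell meets only
finitely many open cells, and `X` carries the weak topology. -/
structure CWStructure (X : Type u) [TopologicalSpace X] where
  cell : ℕ → Type
  attach : (n : ℕ) → cell n → (EuclideanSpace ℝ (Fin n) → X)
  continuousOn_attach : ∀ n i, ContinuousOn (attach n i) (Metric.closedBall 0 1)
  injOn_attach : ∀ n i, Set.InjOn (attach n i) (Metric.ball 0 1)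
  pairwiseDisjoint :
    Set.univ.PairwiseDisjoint
      (fun p : Σ n, cell n => attach p.1 p.2 '' Metric.ball 0 1)
  cover : (⋃ p : Σ n, cell n, attach p.1 p.2 '' Metric.ball 0 1) = Set.univ
  attach_sphere : ∀ n i, attach n i '' Metric.sphere 0 1 ⊆
    ⋃ (p : Σ m, cell m) (_ : p.1 < n), attach p.1 p.2 '' Metric.ball 0 1
  closure_finiteness : ∀ n i,
    {p : Σ m, cell m | (attach p.1 p.2 '' Metric.ball 0 1) ∩
      (attach n i '' Metric.closedBall 0 1) ≠ ∅}.Finite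
  weak_topology : ∀ A : Set X,
    (∀ n i, IsClosed {x : EuclideanSpace ℝ (Fin n) |
      x ∈ Metric.closedBall 0 1 ∧ attach n i x ∈ A}) → IsClosed A

/-- The open cell of a CW structure. -/
def CWStructure.openCell {X : Type u} [TopologicalSpace X] (cw : CWStructure X)
    (n : ℕ) (i : cw.cell n) : Set X :=
  cw.attach n i '' Metric.ball 0 1

/-- A rigid cellular action of a group on a CW complex: the action is by
homeomorphisms permuting the open cells, and any element stabilizing a cell fixes it
pointwise. -/
def IsRigidCellularAction (G : Type) [Group G] {X : Type u} [TopologicalSpace X]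
    [MulAction G X] (cw : CWStructure X) : Prop :=
  (∀ g : G, Continuous fun x : X => g • x) ∧
  (∀ (g : G) (n : ℕ) (i : cw.cell n), ∃ j : cw.cell n,
    (fun x => g • x) '' cw.openCell n i = cw.openCell n j) ∧
  (∀ (g : G) (n : ℕ) (i : cw.cell n),
    (fun x => g • x) '' cw.openCell n i = cw.openCell n i →
      ∀ x ∈ cw.openCell n i, g • x = x)

/-- A group action on a topological space is cocompact. -/
def IsCocompactAction (G : Type) (X : Type u) [Group G] [TopologicalSpace X]
    [MulAction G X] : Prop :=
  ∃ K : Set X, IsCompact K ∧ (⋃ g : G, (fun x => g • x) '' K) = Set.univ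

/-- The condition `Conn_n^∞(G)` for a group `G`: `Conn_n^∞(X)` holds for every
contractible rigid `G`-CW complex `X` on which `G` acts properly discontinuously and
cocompactly. -/
def ConnInftyGroup (G : Type) [Group G] (n : ℤ) : Prop :=
  ∀ (X : Type) [TopologicalSpace X] [MulAction G X],
    ContractibleSpace X →
    (∃ cw : CWStructure X, IsRigidCellularAction G cw) →
    ProperlyDiscontinuousSMul G X →
    IsCocompactAction G X →
    ConnInfty X n

namespace SComplex

variable {V : Type u} [DecidableEq V]

/-- A group action on the vertices is simplicial if it maps faces to faces. -/
def IsSimplicialAction (G : Type) [Group G] [MulAction G V] (X : SComplex V) : Prop :=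
  ∀ (g : G), ∀ σ ∈ X.faces, σ.image (fun v => g • v) ∈ X.faces

/-- A simplicial action is properly discontinuous: all simplex stabilizers are finite. -/
def HasFiniteStabilizers (G : Type) [Group G] [MulAction G V] (X : SComplex V) : Prop :=
  ∀ σ ∈ X.faces, {g : G | σ.image (fun v => g • v) = σ}.Finite

/-- A simplicial action is cocompact: there are finitely many orbits of simplices. -/
def IsCocompactSAction (G : Type) [Group G] [MulAction G V] (X : SComplex V) : Prop :=
  ∃ S : Set (Finset V), S.Finite ∧
    ∀ τ ∈ X.faces, ∃ σ ∈ S, ∃ g : G, τ = σ.image (fun v => g • v)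

end SComplex

/-- A systolic group: a group admitting a properly discontinuous cocompact action by
simplicial automorphisms on a systolic complex. -/
def IsSystolicGroup (G : Type) [Group G] : Prop :=
  ∃ (V : Type) (_ : DecidableEq V) (X : SComplex V) (_ : MulAction G V),
    X.Systolic ∧ X.IsSimplicialAction G ∧ X.HasFiniteStabilizers G ∧
      X.IsCocompactSAction G

/-- The edges and triangles of a complex whose vertex links are `6`-large. -/
structure LocalSix (V : Type) where
  E : V → V → Prop
  T : V → V → V → Prop
  E_symm : ∀ {a b}, E a b → E b a
  E_irrefl : ∀ a, ¬ E a a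
  T_swap : ∀ {a b c}, T a b c → T b a c
  T_rot : ∀ {a b c}, T a b c → T b c a
  T_E : ∀ {a b c}, T a b c → E a b
  flag : ∀ {v a b c}, T v a b → T v b c → T v a c → T a b c
  square : ∀ {v a b c d}, T v a b → T v b c → T v c d → T v d a → a ≠ c → b ≠ d →
    T v a c ∨ T v b d
  pentagon : ∀ {v a b c d e}, T v a b → T v b c → T v c d → T v d e → T v e a →
    a ≠ c → a ≠ d → b ≠ d → b ≠ e → c ≠ e →
    T v a c ∨ T v a d ∨ T v b d ∨ T v b e ∨ T v c e

namespace LocalSix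

variable {V : Type} (K : LocalSix V)

/-- The endpoint of a path, coded as a list with its last vertex first. -/
def endpt (u : V) (p : List V) : V := p.headD u

/-- A partial development: the part of the universal cover of level at most `i`,
with vertices coded by paths of the base, the level being the length minus one. -/
structure IsStage (u : V) (i : ℕ) (P : Set (List V)) (A : List V → List V → Prop) : Prop where
  root_mem : [u] ∈ P
  len : ∀ {p}, p ∈ P → 1 ≤ p.length ∧ p.length ≤ i + 1
  root : ∀ {p}, p ∈ P → p.length = 1 → p = [u]
  mem : ∀ {p q}, A p q → p ∈ P
  symm : ∀ {p q}, A p q → A q p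
  edge_E : ∀ {p q}, A p q → K.E (endpt u p) (endpt u q)
  inj : ∀ {p q r}, A p q → A p r → endpt u q = endpt u r → q = r
  tri : ∀ {p q r}, A p q → A p r → (A q r ↔ K.T (endpt u p) (endpt u q) (endpt u r))
  surj : ∀ {p z}, p ∈ P → p.length ≤ i → K.E (endpt u p) z → ∃ q, A p q ∧ endpt u q = z
  lev : ∀ {p q}, A p q → p.length ≤ q.length + 1
  down : ∀ {p}, p ∈ P → 2 ≤ p.length → ∃ q, A p q ∧ q.length + 1 = p.length
  clique : ∀ {p q r}, A p q → A p r → q.length + 1 = p.length → r.length + 1 = p.length →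
    q ≠ r → A q r
  edge_down : ∀ {p q}, A p q → p.length = q.length →
    ∃ r, A p r ∧ A q r ∧ r.length + 1 = p.length

/-- The data produced by one extension step of a stage: `Low p q` says that the old
vertex `p` is adjacent to the new vertex `q`. -/
structure IsExt (u : V) (i : ℕ) (P : Set (List V)) (A Low : List V → List V → Prop) :
    Prop where
  mem : ∀ {p q}, Low p q → p ∈ P ∧ p.length = i + 1
  len : ∀ {p q}, Low p q → q.length = i + 2
  E : ∀ {p q}, Low p q → K.E (endpt u p) (endpt u q)
  fresh : ∀ {p q r}, Low p q → A p r → endpt u r ≠ endpt u q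
  pair : ∀ {p p' q}, Low p q → Low p' q →
    p = p' ∨ (A p p' ∧ K.T (endpt u p) (endpt u p') (endpt u q))
  closed : ∀ {p p' q}, Low p q → A p p' → K.T (endpt u p) (endpt u p') (endpt u q) → Low p' q
  exists_low : ∀ {p z}, p ∈ P → p.length = i + 1 → K.E (endpt u p) z →
    (∀ r, A p r → endpt u r ≠ z) → ∃ q, endpt u q = z ∧ Low p q
  inj : ∀ {p q q'}, Low p q → Low p q' → endpt u q = endpt u q' → q = q'

theorem T_ne {K : LocalSix V} {a b c : V} (h : K.T a b c) : a ≠ b := fun e =>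
  K.E_irrefl a (by have := K.T_E h; rwa [← e] at this)

theorem T_rot' {K : LocalSix V} {a b c : V} (h : K.T a b c) : K.T c a b := K.T_rot (K.T_rot h)

theorem T_swap' {K : LocalSix V} {a b c : V} (h : K.T a b c) : K.T a c b :=
  K.T_swap (T_rot' h)

theorem T_rev {K : LocalSix V} {a b c : V} (h : K.T a b c) : K.T c b a := T_swap' (T_rot' h)

section Candidates

variable {K} {u : V} {i : ℕ} {P : Set (List V)} {A : List V → List V → Prop}

/-- `p` is a top level vertex and the neighbour `z` of its image is not yet covered. -/
def Cand (K : LocalSix V) (u : V) (i : ℕ) (P : Set (List V)) (A : List V → List V → Prop)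
    (p : List V) (z : V) : Prop :=
  p ∈ P ∧ p.length = i + 1 ∧ K.E (endpt u p) z ∧ ∀ q, A p q → endpt u q ≠ z

/-- Two candidates define the same new vertex. -/
def Rel (K : LocalSix V) (u : V) (A : List V → List V → Prop) (z : V) (p p' : List V) : Prop :=
  p = p' ∨ (A p p' ∧ K.T (endpt u p) (endpt u p') z)

theorem Cand.adj (hS : K.IsStage u i P A) {p r : List V} {z : V} (hp : Cand K u i P A p z)
    (h : A p r) (hT : K.T (endpt u p) (endpt u r) z) : Cand K u i P A r z := by
  have key : ∀ s, A r s → endpt u s ≠ z := by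
    intro s hs e
    refine hp.2.2.2 s ?_ e
    refine (hS.tri (hS.symm h) hs).2 ?_
    rw [e]; exact K.T_swap hT
  have hE : K.E (endpt u r) z := K.T_E (K.T_rot hT)
  refine ⟨hS.mem (hS.symm h), ?_, hE, key⟩
  have h1 := (hS.len (hS.mem (hS.symm h))).2
  by_contra hne
  obtain ⟨s, hs, e⟩ := hS.surj (hS.mem (hS.symm h)) (by omega) hE
  exact key s hs e

theorem Cand.trans (hS : K.IsStage u i P A) {p p' p'' : List V} {z : V}
    (hc : Cand K u i P A p' z) (h : A p' p) (hT : K.T (endpt u p') (endpt u p) z)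
    (h' : A p' p'') (hT' : K.T (endpt u p') (endpt u p'') z) (hne : p ≠ p'') : A p p'' := by
  have hp := hc.adj hS h hT
  have hp'' := hc.adj hS h' hT'
  obtain ⟨a, ha', ha, hal⟩ := hS.edge_down h (by rw [hc.2.1, hp.2.1])
  obtain ⟨b, hb', hb, hbl⟩ := hS.edge_down h' (by rw [hc.2.1, hp''.2.1])
  have hlow : ∀ c, A p' c → c.length + 1 = p'.length → ¬ K.T (endpt u p') (endpt u c) z := by
    intro c hcc hl hT
    have := (hc.adj hS hcc hT).2.1
    have := hc.2.1
    omega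
  have hf : endpt u p ≠ endpt u p'' := fun e => hne (hS.inj h h' e)
  have lens := hc.2.1
  have lens' := hp.2.1
  have lens'' := hp''.2.1
  have common : ∀ c, A p' c → c.length + 1 = p'.length → A p c → A p'' c → A p p'' := by
    intro c hc' hl h1 h2
    have t1 : K.T (endpt u p') z (endpt u p) := K.T_rot (K.T_swap hT)
    have t2 : K.T (endpt u p') (endpt u p) (endpt u c) := (hS.tri h hc').1 h1
    have t3 : K.T (endpt u p') (endpt u c) (endpt u p'') := (hS.tri hc' h').1 (hS.symm h2)
    rcases K.square t1 t2 t3 hT' (fun e => hc.2.2.2 c hc' e.symm) hf with h3 | h3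
    · exact absurd (K.T_rot (K.T_swap h3)) (hlow c hc' hl)
    · exact (hS.tri h h').2 h3
  by_cases hab : a = b
  · subst hab
    exact common a ha' hal ha hb
  have hAab := hS.clique ha' hb' hal hbl hab
  have t1 : K.T (endpt u p') z (endpt u p) := K.T_rot (K.T_swap hT)
  have t2 : K.T (endpt u p') (endpt u p) (endpt u a) := (hS.tri h ha').1 ha
  have t3 : K.T (endpt u p') (endpt u a) (endpt u b) := (hS.tri ha' hb').1 hAab
  have t4 : K.T (endpt u p') (endpt u b) (endpt u p'') := (hS.tri hb' h').1 (hS.symm hb)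
  have n1 : endpt u p ≠ endpt u b := fun e => by
    have := hS.inj h hb' e; subst this; omega
  have n2 : endpt u a ≠ endpt u p'' := fun e => by
    have := hS.inj ha' h' e; subst this; omega
  rcases K.pentagon t1 t2 t3 t4 hT' (fun e => hc.2.2.2 a ha' e.symm)
    (fun e => hc.2.2.2 b hb' e.symm) n1 hf n2 with h3 | h3 | h3 | h3 | h3
  · exact absurd (K.T_rot (K.T_swap h3)) (hlow a ha' hal)
  · exact absurd (K.T_rot (K.T_swap h3)) (hlow b hb' hbl)
  · exact common b hb' hbl ((hS.tri h hb').2 h3) hb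
  · exact (hS.tri h h').2 h3
  · exact common a ha' hal ha (hS.symm ((hS.tri ha' h').2 h3))

theorem Rel.symm (hS : K.IsStage u i P A) {p p' : List V} {z : V} (h : Rel K u A z p p') :
    Rel K u A z p' p := by
  rcases h with rfl | ⟨h, hT⟩
  · exact Or.inl rfl
  · exact Or.inr ⟨hS.symm h, K.T_swap hT⟩

theorem Rel.trans (hS : K.IsStage u i P A) {p p' p'' : List V} {z : V}
    (hc : Cand K u i P A p' z) (h : Rel K u A z p p') (h' : Rel K u A z p' p'') :
    Rel K u A z p p'' := by
  rcases h with rfl | ⟨h, hT⟩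
  · exact h'
  rcases h' with rfl | ⟨h', hT'⟩
  · exact Or.inr ⟨h, hT⟩
  by_cases e : p = p''
  · exact Or.inl e
  have hA := hc.trans hS (hS.symm h) (K.T_swap hT) h' hT' e
  refine Or.inr ⟨hA, ?_⟩
  exact K.flag ((hS.tri (hS.symm h) h').1 hA) hT' (K.T_swap hT)

open Classical in
/-- A chosen element of a set of paths. -/
noncomputable def rep (D : Set (List V)) : List V := if h : D.Nonempty then h.some else []

theorem rep_mem {D : Set (List V)} (h : D.Nonempty) : rep D ∈ D := by
  rw [rep, dif_pos h]; exact h.some_mem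

/-- The class of a candidate. -/
def cls (K : LocalSix V) (u : V) (i : ℕ) (P : Set (List V)) (A : List V → List V → Prop)
    (z : V) (p : List V) : Set (List V) := {p' | Cand K u i P A p' z ∧ Rel K u A z p p'}

theorem cls_eq (hS : K.IsStage u i P A) {p p' : List V} {z : V} (hp : Cand K u i P A p z)
    (hp' : Cand K u i P A p' z) (h : Rel K u A z p p') :
    cls K u i P A z p = cls K u i P A z p' := by
  ext q
  constructor
  · rintro ⟨hq, hr⟩
    exact ⟨hq, (h.symm hS).trans hS hp hr⟩
  · rintro ⟨hq, hr⟩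
    exact ⟨hq, h.trans hS hp' hr⟩

theorem exists_isExt (hS : K.IsStage u i P A) : ∃ Low, K.IsExt u i P A Low := by
  refine ⟨fun p q => ∃ z, Cand K u i P A p z ∧ q = z :: rep (cls K u i P A z p), ?_⟩
  have self : ∀ {p z}, Cand K u i P A p z → rep (cls K u i P A z p) ∈ cls K u i P A z p :=
    fun {p z} hp => rep_mem ⟨p, hp, Or.inl rfl⟩
  have relOf : ∀ {p p' z}, Cand K u i P A p z → Cand K u i P A p' z →
      rep (cls K u i P A z p) = rep (cls K u i P A z p') → Rel K u A z p p' := by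
    intro p p' z hp hp' e
    have h1 := self hp
    have h2 := self hp'
    rw [← e] at h2
    exact h1.2.trans hS h1.1 (h2.2.symm hS)
  constructor
  · rintro p q ⟨z, hc, rfl⟩
    exact ⟨hc.1, hc.2.1⟩
  · rintro p q ⟨z, hc, rfl⟩
    simp [(self hc).1.2.1]
  · rintro p q ⟨z, hc, rfl⟩
    exact hc.2.2.1
  · rintro p q r ⟨z, hc, rfl⟩ h
    exact hc.2.2.2 r h
  · rintro p p' q ⟨z, hc, rfl⟩ ⟨z', hc', e⟩
    obtain ⟨rfl, e⟩ := List.cons.inj e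
    exact relOf hc hc' e
  · rintro p p' q ⟨z, hc, rfl⟩ h hT
    have hc' : Cand K u i P A p' z := hc.adj hS h hT
    exact ⟨z, hc', by rw [cls_eq hS hc hc' (Or.inr ⟨h, hT⟩)]⟩
  · intro p z hp hl hE h
    exact ⟨_, rfl, z, ⟨hp, hl, hE, h⟩, rfl⟩
  · rintro p q q' ⟨z, hc, rfl⟩ ⟨z', hc', rfl⟩ e
    have : z = z' := e
    subst this
    rfl

end Candidates
end LocalSix

namespace LocalSix

variable {V : Type} {K : LocalSix V}

section Extend

variable {u : V} {i : ℕ} {P : Set (List V)} {A Low : List V → List V → Prop}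

/-- Adjacency of two new vertices. -/
def Top (K : LocalSix V) (u : V) (Low : List V → List V → Prop) (p q : List V) : Prop :=
  ∃ d, Low d p ∧ Low d q ∧ K.T (endpt u d) (endpt u p) (endpt u q)

/-- Adjacency in the extended stage. -/
def extAdj (K : LocalSix V) (u : V) (A Low : List V → List V → Prop) (p q : List V) : Prop :=
  A p q ∨ Low p q ∨ Low q p ∨ Top K u Low p q

theorem Top.symm {p q : List V} (h : Top K u Low p q) : Top K u Low q p := by
  obtain ⟨d, h1, h2, h3⟩ := h
  exact ⟨d, h2, h1, T_swap' h3⟩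

theorem Top.tri (hL : K.IsExt u i P A Low) {d q r : List V}
    (h : Top K u Low q r) (hq : Low d q) (hr : Low d r) :
    K.T (endpt u d) (endpt u q) (endpt u r) := by
  obtain ⟨e, h1, h2, h3⟩ := h
  rcases hL.pair hq h1 with rfl | ⟨hA, hT⟩
  · exact h3
  rcases hL.pair hr h2 with rfl | ⟨-, hT'⟩
  · exact h3
  exact K.flag (K.T_swap hT) h3 (K.T_swap hT')

theorem Top.low_of_tri (hS : K.IsStage u i P A) (hL : K.IsExt u i P A Low) {p q r : List V}
    (hq : Low q p) (h : Top K u Low p r) (hT : K.T (endpt u p) (endpt u q) (endpt u r)) :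
    Low q r := by
  obtain ⟨d, h1, h2, h3⟩ := h
  rcases hL.pair hq h1 with rfl | ⟨hA, hT'⟩
  · exact h2
  exact hL.closed h2 (hS.symm hA) (K.flag (T_rev hT') hT (K.T_swap h3))

theorem Top.tri_of_low (hL : K.IsExt u i P A Low) {p q r : List V}
    (hq : Low q p) (h : Top K u Low p r) (hr : Low q r) :
    K.T (endpt u p) (endpt u q) (endpt u r) := K.T_swap (h.tri hL hq hr)

theorem Top.low_or_low (hS : K.IsStage u i P A) (hL : K.IsExt u i P A Low) {d e p q r : List V}
    (hd : Low d p) (hd' : Low d q) (hT : K.T (endpt u d) (endpt u p) (endpt u q))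
    (he : Low e p) (he' : Low e r) (hT' : K.T (endpt u e) (endpt u p) (endpt u r))
    (hpqr : K.T (endpt u p) (endpt u q) (endpt u r)) : Top K u Low q r := by
  rcases hL.pair hd he with rfl | ⟨hA, hde⟩
  · exact ⟨d, hd', he', K.flag (K.T_swap hT) hpqr (K.T_swap hT')⟩
  rcases K.square hpqr (T_swap' (K.T_swap hT')) (T_rev hde) (K.T_swap hT)
      (fun h => hL.fresh hd' hA h.symm) (fun h => hL.fresh he' (hS.symm hA) h.symm) with h | h
  · have := Top.low_of_tri hS hL he ⟨d, hd, hd', hT⟩ (T_swap' h)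
    exact ⟨e, this, he', K.flag (T_swap' h) hpqr (K.T_swap hT')⟩
  · have := Top.low_of_tri hS hL hd ⟨e, he, he', hT'⟩ (T_swap' h)
    exact ⟨d, hd', this, K.flag (K.T_swap hT) hpqr (T_swap' h)⟩


theorem extAdj.symm (hS : K.IsStage u i P A) {p q : List V} (h : extAdj K u A Low p q) :
    extAdj K u A Low q p := by
  rcases h with h | h | h | h
  · exact Or.inl (hS.symm h)
  · exact Or.inr (Or.inr (Or.inl h))
  · exact Or.inr (Or.inl h)
  · exact Or.inr (Or.inr (Or.inr h.symm))

theorem Top.tri_of_top (hS : K.IsStage u i P A) (hL : K.IsExt u i P A Low) {p q r : List V}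
    (hpq : Top K u Low p q) (hpr : Top K u Low p r) (hqr : Top K u Low q r) :
    K.T (endpt u p) (endpt u q) (endpt u r) := by
  have common : ∀ x, Low x p → Low x q → Low x r → K.T (endpt u p) (endpt u q) (endpt u r) :=
    fun x hp hq hr => K.flag (hpq.tri hL hp hq) (hqr.tri hL hq hr) (hpr.tri hL hp hr)
  obtain ⟨d, hdp, hdq, hTd⟩ := id hpq
  obtain ⟨e, hep, her, hTe⟩ := id hpr
  obtain ⟨c, hcq, hcr, hTc⟩ := id hqr
  rcases hL.pair hdp hep with rfl | ⟨hde, hde'⟩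
  · exact common d hdp hdq her
  rcases hL.pair hdq hcq with rfl | ⟨hdc, hdc'⟩
  · exact common d hdp hdq hcr
  rcases hL.pair hcr her with rfl | ⟨hce, hce'⟩
  · exact common c hep hcq hcr
  rcases K.square hTd (T_swap' hdc') ((hS.tri hdc hde).1 hce) hde'
    (fun h => hL.fresh hdp hdc h.symm) (fun h => hL.fresh hdq hde h.symm) with h | h
  · have : Low c p := hL.closed hdp hdc (T_swap' h)
    exact common c this hcq hcr
  · have : Low e q := hL.closed hdq hde (T_swap' h)
    exact common e hep this her

theorem Top.length (hL : K.IsExt u i P A Low) {p q : List V} (h : Top K u Low p q) :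
    p.length = i + 2 ∧ q.length = i + 2 := by
  obtain ⟨d, h1, h2, -⟩ := h
  exact ⟨hL.len h1, hL.len h2⟩

theorem extAdj.cases (hS : K.IsStage u i P A) (hL : K.IsExt u i P A Low) {p q : List V}
    (h : extAdj K u A Low p q) :
    (p.length ≤ i + 1 ∧ (A p q ∧ q.length ≤ i + 1 ∨ Low p q ∧ q.length = i + 2)) ∨
    (p.length = i + 2 ∧ (Low q p ∧ q.length = i + 1 ∨ Top K u Low p q ∧ q.length = i + 2)) := by
  rcases h with h | h | h | h
  · exact Or.inl ⟨(hS.len (hS.mem h)).2, Or.inl ⟨h, (hS.len (hS.mem (hS.symm h))).2⟩⟩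
  · exact Or.inl ⟨(hL.mem h).2.le, Or.inr ⟨h, hL.len h⟩⟩
  · exact Or.inr ⟨hL.len h, Or.inl ⟨h, (hL.mem h).2⟩⟩
  · exact Or.inr ⟨(h.length hL).1, Or.inr ⟨h, (h.length hL).2⟩⟩

theorem extAdj_old (hS : K.IsStage u i P A) (hL : K.IsExt u i P A Low) {p q : List V}
    (hp : p.length ≤ i + 1) (hq : q.length ≤ i + 1) : extAdj K u A Low p q ↔ A p q := by
  refine ⟨fun h => ?_, Or.inl⟩
  rcases h.cases hS hL with ⟨_, ⟨h, _⟩ | ⟨_, h⟩⟩ | ⟨h, _⟩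
  · exact h
  all_goals omega

theorem extAdj_low (hS : K.IsStage u i P A) (hL : K.IsExt u i P A Low) {p q : List V}
    (hp : p.length ≤ i + 1) (hq : q.length = i + 2) : extAdj K u A Low p q ↔ Low p q := by
  refine ⟨fun h => ?_, fun h => Or.inr (Or.inl h)⟩
  rcases h.cases hS hL with ⟨_, ⟨_, h⟩ | ⟨h, _⟩⟩ | ⟨h, _⟩
  · omega
  · exact h
  · omega

theorem extAdj_top (hS : K.IsStage u i P A) (hL : K.IsExt u i P A Low) {p q : List V}
    (hp : p.length = i + 2) (hq : q.length = i + 2) : extAdj K u A Low p q ↔ Top K u Low p q := by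
  refine ⟨fun h => ?_, fun h => Or.inr (Or.inr (Or.inr h))⟩
  rcases h.cases hS hL with ⟨h, _⟩ | ⟨_, ⟨_, h⟩ | ⟨h, _⟩⟩
  · omega
  · omega
  · exact h

theorem extAdj.inj (hS : K.IsStage u i P A) (hL : K.IsExt u i P A Low) {p q r : List V}
    (hq : extAdj K u A Low p q) (hr : extAdj K u A Low p r) (e : endpt u q = endpt u r) :
    q = r := by
  have mixed : ∀ {q r}, endpt u q = endpt u r → Low q p → Top K u Low p r → False := by
    rintro q r e hq ⟨d, hdp, hdr, hT⟩
    rcases hL.pair hq hdp with rfl | ⟨hA, -⟩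
    · exact T_ne (T_swap' hT) e
    · exact hL.fresh hdr (hS.symm hA) e
  rcases hq.cases hS hL with ⟨hp, ⟨hq, _⟩ | ⟨hq, _⟩⟩ | ⟨hp, ⟨hq, _⟩ | ⟨hq, _⟩⟩
  · rcases hr.cases hS hL with ⟨_, ⟨hr, _⟩ | ⟨hr, _⟩⟩ | ⟨_, _⟩
    · exact hS.inj hq hr e
    · exact absurd e (hL.fresh hr hq)
    · omega
  · rcases hr.cases hS hL with ⟨_, ⟨hr, _⟩ | ⟨hr, _⟩⟩ | ⟨_, _⟩
    · exact absurd e.symm (hL.fresh hq hr)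
    · exact hL.inj hq hr e
    · omega
  · rcases hr.cases hS hL with ⟨_, _⟩ | ⟨_, ⟨hr, _⟩ | ⟨hr, _⟩⟩
    · omega
    · rcases hL.pair hq hr with h | ⟨h, -⟩
      · exact h
      · exact absurd (e ▸ hS.edge_E h) (K.E_irrefl _)
    · exact (mixed e hq hr).elim
  · rcases hr.cases hS hL with ⟨_, _⟩ | ⟨_, ⟨hr, _⟩ | ⟨hr, _⟩⟩
    · omega
    · exact (mixed e.symm hr hq).elim
    · obtain ⟨d, hdp, hdq, hTd⟩ := hq
      obtain ⟨f, hfp, hfr, hTf⟩ := hr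
      rcases hL.pair hdp hfp with rfl | ⟨hA, hT⟩
      · exact hL.inj hdq hfr e
      · have : Low f q := hL.closed hdq hA
          (K.flag (T_rot' hT) (by rw [e]; exact K.T_swap hTf) (K.T_swap hTd))
        exact hL.inj this hfr e

theorem extAdj.tri (hS : K.IsStage u i P A) (hL : K.IsExt u i P A Low) {p q r : List V}
    (hq : extAdj K u A Low p q) (hr : extAdj K u A Low p r) :
    extAdj K u A Low q r ↔ K.T (endpt u p) (endpt u q) (endpt u r) := by
  have oldnew : ∀ {q r}, A p q → Low p r → (Low q r ↔ K.T (endpt u p) (endpt u q) (endpt u r)) := by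
    intro q r hq hr
    refine ⟨fun h => ?_, hL.closed hr hq⟩
    rcases hL.pair hr h with rfl | h
    · exact absurd (hS.edge_E hq) (K.E_irrefl _)
    · exact h.2
  have lowtop : ∀ {q r}, Low q p → Top K u Low p r →
      (Low q r ↔ K.T (endpt u p) (endpt u q) (endpt u r)) := fun hq hr =>
    ⟨Top.tri_of_low hL hq hr, Top.low_of_tri hS hL hq hr⟩
  have comm : ∀ {q r}, (extAdj K u A Low q r ↔ K.T (endpt u p) (endpt u q) (endpt u r)) →
      (extAdj K u A Low r q ↔ K.T (endpt u p) (endpt u r) (endpt u q)) := fun h =>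
    ⟨fun h' => T_swap' (h.1 (h'.symm hS)), fun h' => (h.2 (T_swap' h')).symm hS⟩
  rcases hq.cases hS hL with ⟨hp, ⟨hq, lq⟩ | ⟨hq, lq⟩⟩ | ⟨hp, ⟨hq, lq⟩ | ⟨hq, lq⟩⟩
  · rcases hr.cases hS hL with ⟨_, ⟨hr, lr⟩ | ⟨hr, lr⟩⟩ | ⟨_, _⟩
    · rw [extAdj_old hS hL lq lr]
      exact hS.tri hq hr
    · rw [extAdj_low hS hL lq lr]
      exact oldnew hq hr
    · omega
  · rcases hr.cases hS hL with ⟨_, ⟨hr, lr⟩ | ⟨hr, lr⟩⟩ | ⟨_, _⟩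
    · apply comm
      rw [extAdj_low hS hL lr lq]
      exact oldnew hr hq
    · rw [extAdj_top hS hL lq lr]
      exact ⟨fun h => h.tri hL hq hr, fun h => ⟨p, hq, hr, h⟩⟩
    · omega
  · rcases hr.cases hS hL with ⟨_, _⟩ | ⟨_, ⟨hr, lr⟩ | ⟨hr, lr⟩⟩
    · omega
    · rw [extAdj_old hS hL lq.le lr.le]
      rcases hL.pair hq hr with rfl | ⟨h, hT⟩
      · exact ⟨fun h => absurd (hS.edge_E h) (K.E_irrefl _), fun h => absurd rfl (T_ne (K.T_rot h))⟩
      · exact ⟨fun _ => T_rot' hT, fun _ => h⟩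
    · rw [extAdj_low hS hL lq.le lr]
      exact lowtop hq hr
  · rcases hr.cases hS hL with ⟨_, _⟩ | ⟨_, ⟨hr, lr⟩ | ⟨hr, lr⟩⟩
    · omega
    · apply comm
      rw [extAdj_low hS hL lr.le lq]
      exact lowtop hr hq
    · rw [extAdj_top hS hL lq lr]
      refine ⟨fun h => Top.tri_of_top hS hL hq hr h, fun h => ?_⟩
      obtain ⟨d, hdp, hdq, hTd⟩ := hq
      obtain ⟨e, hep, her, hTe⟩ := hr
      exact Top.low_or_low hS hL hdp hdq hTd hep her hTe h

theorem IsExt.isStage (hS : K.IsStage u i P A) (hL : K.IsExt u i P A Low) :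
    K.IsStage u (i + 1) (P ∪ {q | ∃ p, Low p q}) (extAdj K u A Low) where
  root_mem := Or.inl hS.root_mem
  len := by
    rintro p (h | ⟨q, h⟩)
    · have := hS.len h; omega
    · have := hL.len h; omega
  root := by
    rintro p (h | ⟨q, h⟩) e
    · exact hS.root h e
    · have := hL.len h; omega
  mem := by
    rintro p q (h | h | h | ⟨d, h, -⟩)
    · exact Or.inl (hS.mem h)
    · exact Or.inl (hL.mem h).1
    · exact Or.inr ⟨_, h⟩
    · exact Or.inr ⟨_, h⟩
  symm := fun h => h.symm hS
  edge_E := by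
    rintro p q (h | h | h | ⟨d, h, -, hT⟩)
    · exact hS.edge_E h
    · exact hL.E h
    · exact K.E_symm (hL.E h)
    · exact K.T_E (K.T_rot hT)
  inj := fun hq hr e => hq.inj hS hL hr e
  tri := fun hq hr => hq.tri hS hL hr
  surj := by
    rintro p z (h | ⟨q, h⟩) hl hE
    · by_cases hz : ∃ q, A p q ∧ endpt u q = z
      · obtain ⟨q, hq, e⟩ := hz
        exact ⟨q, Or.inl hq, e⟩
      by_cases hl' : p.length ≤ i
      · obtain ⟨q, hq, e⟩ := hS.surj h hl' hE
        exact ⟨q, Or.inl hq, e⟩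
      · obtain ⟨q, e, hq⟩ := hL.exists_low h (by omega) hE (fun r hr e => hz ⟨r, hr, e⟩)
        exact ⟨q, Or.inr (Or.inl hq), e⟩
    · have := hL.len h; omega
  lev := by
    intro p q h
    rcases id h with h' | _
    · exact hS.lev h'
    · rcases h.cases hS hL with ⟨_, ⟨h, _⟩ | ⟨_, h⟩⟩ | ⟨h, ⟨_, _⟩ | ⟨_, _⟩⟩
      · exact hS.lev h
      all_goals omega
  down := by
    rintro p (h | ⟨q, h⟩) hl
    · obtain ⟨q, hq, e⟩ := hS.down h hl
      exact ⟨q, Or.inl hq, e⟩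
    · exact ⟨q, Or.inr (Or.inr (Or.inl h)), by rw [(hL.mem h).2, hL.len h]⟩
  clique := by
    intro p q r hq hr lq lr hne
    rcases hq.cases hS hL with ⟨hp, ⟨hq, _⟩ | ⟨hq, _⟩⟩ | ⟨hp, ⟨hq, _⟩ | ⟨hq, _⟩⟩ <;>
    rcases hr.cases hS hL with ⟨_, ⟨hr, _⟩ | ⟨hr, _⟩⟩ | ⟨_, ⟨hr, _⟩ | ⟨hr, _⟩⟩ <;>
    first
    | omega
    | exact Or.inl (hS.clique hq hr lq lr hne)
    | exact Or.inl ((hL.pair hq hr).resolve_left hne).1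
  edge_down := by
    intro p q h e
    rcases h.cases hS hL with ⟨hp, ⟨hq, _⟩ | ⟨hq, _⟩⟩ | ⟨hp, ⟨hq, _⟩ | ⟨hq, _⟩⟩
    · obtain ⟨r, h1, h2, h3⟩ := hS.edge_down hq e
      exact ⟨r, Or.inl h1, Or.inl h2, h3⟩
    · omega
    · omega
    · obtain ⟨d, h1, h2, -⟩ := hq
      exact ⟨d, Or.inr (Or.inr (Or.inl h1)), Or.inr (Or.inr (Or.inl h2)),
        by rw [(hL.mem h1).2, hp]⟩

end Extend

theorem isStage_zero (K : LocalSix V) (u : V) :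
    K.IsStage u 0 {[u]} (fun _ _ => False) where
  root_mem := rfl
  len := by rintro p rfl; simp
  root := by rintro p rfl _; rfl
  mem := False.elim
  symm := id
  edge_E := False.elim
  inj := False.elim
  tri := False.elim
  surj := by rintro p z rfl h; simp at h
  lev := False.elim
  down := by rintro p rfl h; simp at h
  clique := False.elim
  edge_down := False.elim

open Classical in
/-- The stages of the development. -/
noncomputable def stage (K : LocalSix V) (u : V) :
    (i : ℕ) → {S : Set (List V) × (List V → List V → Prop) // K.IsStage u i S.1 S.2}
  | 0 => ⟨({[u]}, fun _ _ => False), isStage_zero K u⟩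
  | i + 1 => ⟨(_, _), IsExt.isStage (stage K u i).2 (exists_isExt (stage K u i).2).choose_spec⟩

theorem stage_mono (K : LocalSix V) (u : V) {i j : ℕ} (h : i ≤ j) :
    (stage K u i).1.1 ⊆ (stage K u j).1.1 ∧
      ∀ p q, (stage K u i).1.2 p q → (stage K u j).1.2 p q := by
  induction h with
  | refl => exact ⟨subset_rfl, fun _ _ => id⟩
  | step _ ih =>
    refine ⟨ih.1.trans ?_, fun p q h => ?_⟩
    · rw [stage]; exact Set.subset_union_left
    · rw [stage]; exact Or.inl (ih.2 p q h)

/-- A development of the universal cover of `K` around a vertex, with its level function. -/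
structure Development (K : LocalSix V) (u : V) where
  Y : Type
  A : Y → Y → Prop
  f : Y → V
  lev : Y → ℕ
  y : Y
  f_y : f y = u
  lev_y : lev y = 0
  eq_y : ∀ {p}, lev p = 0 → p = y
  symm : ∀ {p q}, A p q → A q p
  edge_E : ∀ {p q}, A p q → K.E (f p) (f q)
  inj : ∀ {p q r}, A p q → A p r → f q = f r → q = r
  tri : ∀ {p q r}, A p q → A p r → (A q r ↔ K.T (f p) (f q) (f r))
  surj : ∀ {p z}, K.E (f p) z → ∃ q, A p q ∧ f q = z
  lev_le : ∀ {p q}, A p q → lev p ≤ lev q + 1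
  down : ∀ {p}, lev p ≠ 0 → ∃ q, A p q ∧ lev q + 1 = lev p
  clique : ∀ {p q r}, A p q → A p r → lev q + 1 = lev p → lev r + 1 = lev p → q ≠ r → A q r
  edge_down : ∀ {p q}, A p q → lev p = lev q → ∃ r, A p r ∧ A q r ∧ lev r + 1 = lev p

theorem exists_development (K : LocalSix V) (u : V) : Nonempty (Development K u) := by
  let P : Set (List V) := {p | ∃ i, p ∈ (stage K u i).1.1}
  let A : List V → List V → Prop := fun p q => ∃ i, (stage K u i).1.2 p q
  have up : ∀ {p q i j}, i ≤ j → (stage K u i).1.2 p q → (stage K u j).1.2 p q :=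
    fun h h' => (stage_mono K u h).2 _ _ h'
  have memA : ∀ {p q}, A p q → p ∈ P := fun ⟨i, h⟩ => ⟨i, (stage K u i).2.mem h⟩
  have symm : ∀ {p q}, A p q → A q p := fun ⟨i, h⟩ => ⟨i, (stage K u i).2.symm h⟩
  have pos : ∀ {p}, p ∈ P → 1 ≤ p.length := fun ⟨i, h⟩ => ((stage K u i).2.len h).1
  refine ⟨⟨{p // p ∈ P}, fun p q => A p.1 q.1, fun p => endpt u p.1, fun p => p.1.length - 1,
    ⟨[u], 0, (stage K u 0).2.root_mem⟩, rfl, rfl, ?_, symm, ?_, ?_, ?_, ?_, ?_, ?_, ?_, ?_⟩⟩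
  · rintro ⟨p, i, h⟩ e
    have := ((stage K u i).2.len h).1
    have e' : p.length - 1 = 0 := e
    exact Subtype.ext ((stage K u i).2.root h (show p.length = 1 by omega))
  · rintro p q ⟨i, h⟩
    exact (stage K u i).2.edge_E h
  · rintro p q r ⟨i, h⟩ ⟨j, h'⟩ e
    exact Subtype.ext ((stage K u (max i j)).2.inj (up (le_max_left _ _) h)
      (up (le_max_right _ _) h') e)
  · rintro p q r ⟨i, h⟩ ⟨j, h'⟩
    constructor
    · rintro ⟨k, h''⟩
      exact ((stage K u (max (max i j) k)).2.tri (up (by simp) h) (up (by simp) h')).1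
        (up (by simp) h'')
    · intro hT
      exact ⟨max i j, ((stage K u (max i j)).2.tri (up (by simp) h) (up (by simp) h')).2 hT⟩
  · rintro ⟨p, i, h⟩ z hE
    obtain ⟨q, hq, e⟩ := (stage K u (max i p.length)).2.surj
      ((stage_mono K u (le_max_left _ _)).1 h) (le_max_right _ _) hE
    exact ⟨⟨q, memA (symm ⟨_, hq⟩)⟩, ⟨_, hq⟩, e⟩
  · rintro p q ⟨i, h⟩
    have h1 := (stage K u i).2.lev h
    have h2 := pos q.2
    omega
  · rintro ⟨p, i, h⟩ e
    have e' : p.length - 1 ≠ 0 := e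
    obtain ⟨q, hq, e''⟩ := (stage K u i).2.down h (by omega)
    have hm := memA (symm ⟨i, hq⟩)
    have h1 := pos hm
    refine ⟨⟨q, hm⟩, ⟨i, hq⟩, ?_⟩
    change q.length - 1 + 1 = p.length - 1
    omega
  · rintro p q r ⟨i, h⟩ ⟨j, h'⟩ e e' hne
    have h1 := pos p.2
    have h2 := pos q.2
    have h3 := pos r.2
    exact ⟨max i j, (stage K u (max i j)).2.clique (up (le_max_left _ _) h)
      (up (le_max_right _ _) h') (by omega) (by omega) (fun h => hne (Subtype.ext h))⟩
  · rintro p q ⟨i, h⟩ e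
    have h1 := pos p.2
    have h2 := pos q.2
    obtain ⟨r, k1, k2, k3⟩ := (stage K u i).2.edge_down h (by omega)
    have hm := memA (symm ⟨i, k1⟩)
    have h4 := pos hm
    refine ⟨⟨r, hm⟩, ⟨i, k1⟩, ⟨i, k2⟩, ?_⟩
    change r.length - 1 + 1 = p.1.length - 1
    omega

end LocalSix

/-- Augmented simplicial chains modulo `2`; the empty simplex is allowed. -/
abbrev Chain (W : Type) := Finset W →₀ ZMod 2

namespace Chain

open Finsupp

variable {W : Type}

theorem add_self (z : Chain W) : z + z = 0 := by
  ext σ; exact CharTwo.add_self_eq_zero _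

theorem ext_single {N : Type*} [AddCommMonoid N] [Module (ZMod 2) N]
    {f g : Chain W →ₗ[ZMod 2] N} (h : ∀ σ, f (single σ 1) = g (single σ 1)) : f = g :=
  Finsupp.lhom_ext' fun σ => LinearMap.ext_ring (h σ)

/-- Chains supported on a family of simplices. -/
noncomputable abbrev on (C : Set (Finset W)) : Submodule (ZMod 2) (Chain W) :=
  supported (ZMod 2) (ZMod 2) C

theorem single_mem_on {C : Set (Finset W)} {σ : Finset W} (h : σ ∈ C) :
    single σ (1 : ZMod 2) ∈ on C := single_mem_supported _ _ h

theorem map_mem_of_single {C : Set (Finset W)} {N : Type*} [AddCommMonoid N] [Module (ZMod 2) N]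
    (f : Chain W →ₗ[ZMod 2] N) {S : Submodule (ZMod 2) N}
    (h : ∀ σ ∈ C, f (single σ 1) ∈ S) {z : Chain W} (hz : z ∈ on C) : f z ∈ S := by
  rw [on, supported_eq_span_single] at hz
  induction hz using Submodule.span_induction with
  | mem x hx => obtain ⟨σ, hσ, rfl⟩ := hx; exact h σ hσ
  | zero => rw [map_zero]; exact S.zero_mem
  | add x y _ _ hx hy => rw [map_add]; exact S.add_mem hx hy
  | smul a x _ hx => rw [map_smul]; exact S.smul_mem a hx

variable [DecidableEq W]

/-- The simplicial boundary. -/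
noncomputable def bd : Chain W →ₗ[ZMod 2] Chain W :=
  linearCombination (ZMod 2) fun σ => ∑ v ∈ σ, single (σ.erase v) 1

/-- The cone with apex `t`. -/
noncomputable def cone (t : W) : Chain W →ₗ[ZMod 2] Chain W :=
  linearCombination (ZMod 2) fun σ => if t ∈ σ then 0 else single (insert t σ) 1

theorem bd_single (σ : Finset W) :
    bd (single σ (1 : ZMod 2)) = ∑ v ∈ σ, single (σ.erase v) 1 := by
  simp [bd, linearCombination_single]

theorem cone_single (t : W) (σ : Finset W) :
    cone t (single σ (1 : ZMod 2)) = if t ∈ σ then 0 else single (insert t σ) 1 := by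
  simp [cone, linearCombination_single]

theorem bd_cone (t : W) (z : Chain W) : bd (cone t z) = z + cone t (bd z) := by
  have : bd ∘ₗ cone t = LinearMap.id + cone t ∘ₗ bd (W := W) := by
    refine ext_single fun σ => ?_
    simp only [LinearMap.comp_apply, LinearMap.add_apply, LinearMap.id_apply, cone_single,
      bd_single, map_sum]
    by_cases h : t ∈ σ
    · rw [if_pos h, map_zero, Finset.sum_eq_single_of_mem t h]
      · rw [if_neg (Finset.notMem_erase _ _), Finset.insert_erase h, add_self]
      · intro v _ hv
        rw [if_pos (Finset.mem_erase.2 ⟨hv.symm, h⟩)]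
    · rw [if_neg h, bd_single, Finset.sum_insert h, Finset.erase_insert h]
      congr 1
      refine Finset.sum_congr rfl fun v hv => ?_
      have hne : v ≠ t := fun e => h (e ▸ hv)
      rw [if_neg (fun h' => h (Finset.mem_of_mem_erase h')), Finset.erase_insert_of_ne hne.symm]
  exact LinearMap.congr_fun this z

theorem bd_bd (z : Chain W) : bd (bd z) = 0 := by
  have : bd ∘ₗ bd (W := W) = 0 := by
    refine ext_single fun σ => ?_
    induction σ using Finset.induction_on with
    | empty => simp [bd_single]
    | insert t σ h ih =>
      have e : single (insert t σ) (1 : ZMod 2) = cone t (single σ 1) := by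
        rw [cone_single, if_neg h]
      simp only [LinearMap.comp_apply, LinearMap.zero_apply] at ih ⊢
      rw [e, bd_cone, map_add, bd_cone, ih, map_zero, add_zero, add_self]
  exact LinearMap.congr_fun this z

end Chain

namespace LocalSix.Development

variable {V : Type} {K : LocalSix V} {u : V} (D : Development K u)

theorem ne_of_A {D : Development K u} {p q : D.Y} (h : D.A p q) : p ≠ q := fun e =>
  K.E_irrefl _ (by have := D.edge_E h; rwa [e] at this)

/-- A set of pairwise adjacent vertices. -/
def IsClique (σ : Finset D.Y) : Prop := ∀ p ∈ σ, ∀ q ∈ σ, p ≠ q → D.A p q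

theorem exists_common_down {j : ℕ} (p : D.Y) (τ : Finset D.Y) (hp : p ∈ τ) (hc : D.IsClique τ)
    (hl : ∀ q ∈ τ, D.lev q = j + 1) : ∃ t, D.lev t = j ∧ ∀ q ∈ τ, D.A q t := by
  classical
  have key : ∀ τ' : Finset D.Y, τ' ⊆ τ → p ∈ τ' → ∃ t, D.lev t = j ∧ ∀ q ∈ τ', D.A q t := by
    suffices ∀ τ' : Finset D.Y, τ' ⊆ τ → ∃ t, D.lev t = j ∧ D.A p t ∧ ∀ q ∈ τ', D.A q t from
      fun τ' h _ => let ⟨t, h1, _, h3⟩ := this τ' h; ⟨t, h1, h3⟩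
    intro τ'
    induction τ' using Finset.induction_on with
    | empty =>
      intro _
      obtain ⟨t, ht, hlt⟩ := D.down (p := p) (by rw [hl p hp]; omega)
      exact ⟨t, by have := hl p hp; omega, ht, by simp⟩
    | insert q τ' hq ih =>
      intro hsub
      obtain ⟨c, hlc, hpc, hc'⟩ := ih ((Finset.subset_insert _ _).trans hsub)
      have hqτ := hsub (Finset.mem_insert_self _ _)
      by_cases hqc : D.A q c
      · exact ⟨c, hlc, hpc, by simpa [hqc] using hc'⟩
      have hqp : p ≠ q := fun e => hqc (e ▸ hpc)
      have hpq := hc p hp q hqτ hqp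
      obtain ⟨e, hpe, hqe, hle⟩ := D.edge_down hpq (by rw [hl p hp, hl q hqτ])
      rw [hl p hp] at hle
      refine ⟨e, by omega, hpe, ?_⟩
      intro r hr
      rcases Finset.mem_insert.1 hr with rfl | hr
      · exact hqe
      have hrτ := hsub (Finset.mem_insert_of_mem hr)
      by_cases hrp : p = r
      · exact hrp ▸ hpe
      have hpr := hc p hp r hrτ hrp
      have hrq : r ≠ q := fun e => hq (e ▸ hr)
      have hce : c ≠ e := fun h => hqc (h ▸ hqe)
      have hAce := D.clique hpc hpe (by rw [hlc, hl p hp]) (by rw [hle, hl p hp]) hce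
      have n1 : D.f c ≠ D.f q := fun h => by
        have := D.inj hpc hpq h
        have := hl q hqτ
        subst c; omega
      have n2 : D.f r ≠ D.f e := fun h => by
        have := D.inj hpr hpe h
        have := hl r hrτ
        subst e; omega
      rcases K.square ((D.tri hpc hpr).1 (D.symm (hc' r hr)))
        ((D.tri hpr hpq).1 (hc r hrτ q hqτ hrq)) ((D.tri hpq hpe).1 hqe)
        ((D.tri hpe hpc).1 (D.symm hAce)) n1 n2 with h | h
      · exact absurd (D.symm ((D.tri hpc hpq).2 h)) hqc
      · exact (D.tri hpr hpe).2 h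
  exact key τ subset_rfl hp

open Finsupp Chain

open Classical in
/-- The vertices of a simplex of level `j`. -/
noncomputable def topPart (j : ℕ) (σ : Finset D.Y) : Finset D.Y := σ.filter fun p => D.lev p = j

/-- Cliques of level at most `i + 1` with at most `s` vertices of level `i + 1`. -/
def levelCliques (i s : ℕ) : Set (Finset D.Y) :=
  {σ | D.IsClique σ ∧ (∀ p ∈ σ, D.lev p ≤ i + 1) ∧ (D.topPart (i + 1) σ).card ≤ s}

variable {D}

theorem IsClique.subset {σ τ : Finset D.Y} (h : D.IsClique σ) (hs : τ ⊆ σ) : D.IsClique τ :=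
  fun p hp q hq => h p (hs hp) q (hs hq)

open Classical in
theorem exists_push_down {i s : ℕ} {z : Chain D.Y} (hz : z ∈ on (D.levelCliques i (s + 1)))
    (hb : bd z = 0) : ∃ w ∈ on {σ | D.IsClique σ}, z + bd w ∈ on (D.levelCliques i s) := by
  have : ∀ τ : Finset D.Y, ∃ t, τ.Nonempty → D.IsClique τ → (∀ q ∈ τ, D.lev q = i + 1) →
      D.lev t = i ∧ ∀ q ∈ τ, D.A q t := by
    intro τ
    by_cases h : τ.Nonempty ∧ D.IsClique τ ∧ ∀ q ∈ τ, D.lev q = i + 1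
    · obtain ⟨⟨p, hp⟩, h2, h3⟩ := h
      obtain ⟨t, ht⟩ := D.exists_common_down p τ hp h2 h3
      exact ⟨t, fun _ _ _ => ht⟩
    · exact ⟨D.y, fun h1 h2 h3 => absurd ⟨h1, h2, h3⟩ h⟩
  choose t ht using this
  let Φ : Chain D.Y →ₗ[ZMod 2] Chain D.Y := linearCombination (ZMod 2) fun σ =>
    if (D.topPart (i + 1) σ).card = s + 1 then cone (t (D.topPart (i + 1) σ)) (single σ 1) else 0
  have hΦ : ∀ σ, Φ (single σ 1) = if (D.topPart (i + 1) σ).card = s + 1 then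
      cone (t (D.topPart (i + 1) σ)) (single σ 1) else 0 := by
    intro σ; simp only [Φ, linearCombination_single, one_smul]
  -- the apex is adjacent to everything
  have apex : ∀ σ ∈ D.levelCliques i (s + 1), (D.topPart (i + 1) σ).card = s + 1 →
      D.lev (t (D.topPart (i + 1) σ)) = i ∧ D.IsClique (insert (t (D.topPart (i + 1) σ)) σ) := by
    rintro σ ⟨h1, h2, -⟩ hcard
    have hsub : D.topPart (i + 1) σ ⊆ σ := Finset.filter_subset _ _
    have hne : (D.topPart (i + 1) σ).Nonempty := by
      rw [← Finset.card_pos]; omega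
    obtain ⟨hl, hA⟩ := ht _ hne (h1.subset hsub) (fun q hq => (Finset.mem_filter.1 hq).2)
    obtain ⟨p, hp⟩ := hne
    have hpl : D.lev p = i + 1 := (Finset.mem_filter.1 hp).2
    refine ⟨hl, ?_⟩
    have adj : ∀ q ∈ σ, q ≠ t (D.topPart (i + 1) σ) → D.A q (t (D.topPart (i + 1) σ)) := by
      intro q hq hqt
      by_cases hql : D.lev q = i + 1
      · exact hA q (Finset.mem_filter.2 ⟨hq, hql⟩)
      have hpq : D.A p q := h1 p (hsub hp) q hq (fun e => hql (e ▸ hpl))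
      have := D.lev_le hpq
      have := h2 q hq
      exact D.clique hpq (hA p hp) (by omega) (by omega) hqt
    intro a ha b hb hab
    rcases Finset.mem_insert.1 ha with rfl | ha <;> rcases Finset.mem_insert.1 hb with rfl | hb
    · exact absurd rfl hab
    · exact D.symm (adj b hb hab.symm)
    · exact adj a ha hab
    · exact h1 a ha b hb hab
  have hcl : Φ z ∈ on {σ | D.IsClique σ} := by
    refine map_mem_of_single Φ ?_ hz
    intro σ hσ
    rw [hΦ]
    split_ifs with h
    · rw [cone_single]
      split_ifs
      · exact Submodule.zero_mem _
      · exact single_mem_on (apex σ hσ h).2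
    · exact Submodule.zero_mem _
  refine ⟨Φ z, hcl, ?_⟩
  let H : Chain D.Y →ₗ[ZMod 2] Chain D.Y := LinearMap.id + bd ∘ₗ Φ + Φ ∘ₗ bd
  have hH : z + bd (Φ z) = H z := by
    simp [H, hb]
  rw [hH]
  refine map_mem_of_single H ?_ hz
  intro σ hσ
  have hHσ : H (single σ 1) = single σ 1 + bd (Φ (single σ 1)) +
      ∑ v ∈ σ, Φ (single (σ.erase v) 1) := by
    simp only [H, LinearMap.add_apply, LinearMap.id_apply, LinearMap.comp_apply, bd_single, map_sum]
  have herase : ∀ v, D.topPart (i + 1) (σ.erase v) = (D.topPart (i + 1) σ).erase v := fun v =>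
    Finset.filter_erase _ _ _
  by_cases h : (D.topPart (i + 1) σ).card = s + 1
  · obtain ⟨hl, hins⟩ := apex σ hσ h
    have h1 : H (single σ 1) = ∑ v ∈ σ, (cone (t (D.topPart (i + 1) σ)) (single (σ.erase v) 1) +
        Φ (single (σ.erase v) 1)) := by
      rw [hHσ, hΦ, if_pos h, bd_cone, ← add_assoc, add_self, zero_add, bd_single, map_sum,
        Finset.sum_add_distrib]
    rw [h1]
    refine Submodule.sum_mem _ fun v hv => ?_
    by_cases hvt : v ∈ D.topPart (i + 1) σ
    · have hc : ((D.topPart (i + 1) σ).erase v).card = s := by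
        rw [Finset.card_erase_of_mem hvt, h]; rfl
      rw [hΦ, herase, if_neg (by omega), add_zero, cone_single]
      split_ifs with hm
      · exact Submodule.zero_mem _
      · refine single_mem_on ⟨hins.subset (Finset.insert_subset_insert _ (Finset.erase_subset _ _)),
          ?_, ?_⟩
        · intro p hp
          rcases Finset.mem_insert.1 hp with rfl | hp
          · omega
          · exact hσ.2.1 p (Finset.mem_of_mem_erase hp)
        · rw [topPart, Finset.filter_insert, if_neg (by omega)]
          exact (herase v ▸ hc).le
    · rw [hΦ, herase, Finset.erase_eq_of_notMem hvt, if_pos h, add_self]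
      exact Submodule.zero_mem _
  · have hlt : (D.topPart (i + 1) σ).card ≤ s := by have := hσ.2.2; omega
    have h0 : ∀ v ∈ σ, Φ (single (σ.erase v) 1) = 0 := by
      intro v _
      rw [hΦ, herase, if_neg]
      have := Finset.card_erase_le (s := D.topPart (i + 1) σ) (a := v)
      omega
    rw [hHσ, Finset.sum_eq_zero h0, hΦ, if_neg h, map_zero, add_zero, add_zero]
    exact single_mem_on ⟨hσ.1, hσ.2.1, hlt⟩

open Classical in
theorem exists_bd_of_level_le (i : ℕ) {z : Chain D.Y}
    (hz : z ∈ on {σ : Finset D.Y | D.IsClique σ ∧ ∀ p ∈ σ, D.lev p ≤ i}) (hb : bd z = 0) :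
    ∃ w ∈ on {σ | D.IsClique σ}, bd w = z := by
  induction i generalizing z with
  | zero =>
    refine ⟨cone D.y z, map_mem_of_single _ ?_ hz, by rw [bd_cone, hb, map_zero, add_zero]⟩
    rintro σ ⟨-, h⟩
    rw [cone_single]
    split_ifs
    · exact Submodule.zero_mem _
    refine single_mem_on fun p hp q hq hne => (hne ?_).elim
    have : ∀ p ∈ insert D.y σ, p = D.y := fun p hp => by
      rcases Finset.mem_insert.1 hp with rfl | hp
      · rfl
      · exact D.eq_y (Nat.le_zero.1 (h p hp))
    rw [this p hp, this q hq]
  | succ i ih =>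
    have main : ∀ s, ∀ z ∈ on (D.levelCliques i s), bd z = 0 →
        ∃ w ∈ on {σ | D.IsClique σ}, bd w = z := by
      intro s
      induction s with
      | zero =>
        intro z hz hb
        refine ih (supported_mono ?_ hz) hb
        rintro σ ⟨h1, h2, h3⟩
        refine ⟨h1, fun p hp => ?_⟩
        have h4 := Finset.card_eq_zero.1 (Nat.le_zero.1 h3)
        have := h2 p hp
        by_contra h5
        have : p ∈ D.topPart (i + 1) σ := Finset.mem_filter.2 ⟨hp, by omega⟩
        rw [h4] at this
        simp at this
      | succ s ihs =>
        intro z hz hb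
        obtain ⟨w, hw, hzw⟩ := exists_push_down hz hb
        obtain ⟨w', hw', e⟩ := ihs _ hzw (by rw [map_add, hb, bd_bd, add_zero])
        refine ⟨w' + w, Submodule.add_mem _ hw' hw, ?_⟩
        rw [map_add, e, add_assoc, add_self, add_zero]
    refine main (z.support.sup Finset.card) z ?_ hb
    intro σ hσ
    obtain ⟨h1, h2⟩ := hz hσ
    exact ⟨h1, h2, (Finset.card_filter_le _ _).trans (Finset.le_sup (f := Finset.card) hσ)⟩

open Classical in
/-- The development is acyclic. -/
theorem exists_bd {z : Chain D.Y} (hz : z ∈ on {σ : Finset D.Y | D.IsClique σ}) (hb : bd z = 0) :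
    ∃ w ∈ on {σ | D.IsClique σ}, bd w = z := by
  refine exists_bd_of_level_le (z.support.sup fun σ => σ.sup D.lev) ?_ hb
  intro σ hσ
  refine ⟨hz hσ, fun p hp => ?_⟩
  exact (Finset.le_sup (f := D.lev) hp).trans (Finset.le_sup (f := fun σ => σ.sup D.lev) hσ)

/-- Cocycles on the part of level at most `i` are coboundaries. -/
theorem exists_potential {G : Type} [Group G] (i : ℕ) (c : D.Y → D.Y → G)
    (hc : ∀ a b d, D.lev a ≤ i → D.lev b ≤ i → D.lev d ≤ i → (a = b ∨ D.A a b) →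
      (b = d ∨ D.A b d) → (a = d ∨ D.A a d) → c a b * c b d = c a d) :
    ∃ h : D.Y → G, ∀ a b, D.lev a ≤ i → D.lev b ≤ i → D.A a b → c a b = (h a)⁻¹ * h b := by
  classical
  have self : ∀ a, D.lev a ≤ i → c a a = 1 := fun a ha => by
    simpa using hc a a a ha ha ha (Or.inl rfl) (Or.inl rfl) (Or.inl rfl)
  suffices ∀ j ≤ i, ∃ h : D.Y → G, ∀ a b, D.lev a ≤ j → D.lev b ≤ j → D.A a b →
      c a b = (h a)⁻¹ * h b from this i le_rfl
  intro j
  induction j with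
  | zero =>
    intro _
    refine ⟨fun _ => 1, fun a b ha hb hab => (ne_of_A hab ?_).elim⟩
    rw [D.eq_y (Nat.le_zero.1 ha), D.eq_y (Nat.le_zero.1 hb)]
  | succ j ih =>
    intro hj
    obtain ⟨h, hh⟩ := ih (by omega)
    have : ∀ q, ∃ p, D.lev q ≠ 0 → D.A q p ∧ D.lev p + 1 = D.lev q := fun q => by
      by_cases hq : D.lev q = 0
      · exact ⟨q, fun h => absurd hq h⟩
      · obtain ⟨p, hp⟩ := D.down hq
        exact ⟨p, fun _ => hp⟩
    choose d hd using this
    let h' : D.Y → G := fun q => if D.lev q = j + 1 then h (d q) * c (d q) q else h q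
    have low : ∀ p q, D.A q p → D.lev p = j → D.lev q = j + 1 → h' q = h p * c p q := by
      intro p q hqp hp hq
      obtain ⟨h1, h2⟩ := hd q (by omega)
      simp only [h', hq, if_true]
      by_cases e : d q = p
      · rw [e]
      have hA := D.clique h1 hqp h2 (by omega) e
      rw [← hc (d q) p q (by omega) (by omega) (by omega) (Or.inr hA) (Or.inr (D.symm hqp))
        (Or.inr (D.symm h1)), hh _ _ (by omega) (by omega) hA]
      group
    have same : ∀ q, D.lev q ≤ j → h' q = h q := fun q hq => by
      simp only [h']; rw [if_neg (by omega)]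
    have inv : ∀ a b, D.lev a ≤ i → D.lev b ≤ i → D.A a b → c b a = (c a b)⁻¹ := by
      intro a b ha hb hab
      have := hc a b a ha hb ha (Or.inr hab) (Or.inr (D.symm hab)) (Or.inl rfl)
      rw [self a ha] at this
      exact (inv_eq_of_mul_eq_one_right this).symm
    refine ⟨h', fun a b ha hb hab => ?_⟩
    by_cases ha' : D.lev a ≤ j
    · by_cases hb' : D.lev b ≤ j
      · rw [same a ha', same b hb', hh a b ha' hb' hab]
      · have := D.lev_le (D.symm hab)
        rw [same a ha', low a b (D.symm hab) (by omega) (by omega)]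
        group
    · by_cases hb' : D.lev b ≤ j
      · have := D.lev_le hab
        rw [same b hb', low b a hab (by omega) (by omega),
          inv b a (by omega) (by omega) (D.symm hab)]
        group
      · obtain ⟨r, h1, h2, h3⟩ := D.edge_down hab (by omega)
        rw [low r a h1 (by omega) (by omega), low r b h2 (by omega) (by omega),
          ← hc r a b (by omega) (by omega) (by omega) (Or.inr (D.symm h1)) (Or.inr hab)
            (Or.inr (D.symm h2))]
        group

end LocalSix.Development

namespace SComplex

variable {V : Type}

theorem singleton_mem {X : SComplex V} {σ : Finset V} (h : σ ∈ X.faces) {a : V} (ha : a ∈ σ) :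
    ({a} : Finset V) ∈ X.faces :=
  X.down_closed σ h _ (Finset.singleton_subset_iff.2 ha) (Finset.singleton_nonempty a)

variable [DecidableEq V]

/-- Two vertices span a simplex; this includes every vertex being adjacent to itself. -/
def Adj (X : SComplex V) (a b : V) : Prop := ({a, b} : Finset V) ∈ X.faces

theorem Adj.symm {X : SComplex V} {a b : V} (h : X.Adj a b) : X.Adj b a := by
  rwa [Adj, Finset.pair_comm]

theorem adj_self {X : SComplex V} {a : V} : X.Adj a a ↔ ({a} : Finset V) ∈ X.faces := by
  rw [Adj, Finset.pair_eq_singleton]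

theorem adj_of_mem {X : SComplex V} {σ : Finset V} (h : σ ∈ X.faces) {a b : V} (ha : a ∈ σ)
    (hb : b ∈ σ) : X.Adj a b :=
  X.down_closed σ h _ (by simp [Finset.insert_subset_iff, ha, hb]) (by simp)

theorem Adj.left {X : SComplex V} {a b : V} (h : X.Adj a b) : ({a} : Finset V) ∈ X.faces :=
  singleton_mem h (by simp)

/-- The links of the vertices are `6`-large. -/
def VertexLarge (X : SComplex V) : Prop := ∀ v, ({v} : Finset V) ∈ X.faces → KLarge 6 (X.link {v})

theorem mem_link_pair {X : SComplex V} {v a b : V} (ha : v ≠ a) (hb : v ≠ b) :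
    ({a, b} : Finset V) ∈ (X.link {v}).faces ↔ ({v, a, b} : Finset V) ∈ X.faces := by
  have e : ({a, b} : Finset V) ∪ {v} = {v, a, b} := by ext x; simp; tauto
  constructor
  · rintro ⟨_, _, h⟩
    rwa [e] at h
  · intro h
    refine ⟨X.down_closed _ h _ (by intro x; simp; tauto) (by simp), ?_, by rwa [e]⟩
    simp [ha, hb]

theorem VertexLarge.restrict {X : SComplex V} (h : X.VertexLarge) (W : Set V) :
    (X.restrict W).VertexLarge := by
  rintro v ⟨hv, hvW⟩
  have hvW' : v ∈ W := hvW v (by simp)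
  obtain ⟨hf, hc⟩ := h v hv
  have mem : ∀ σ, σ ∈ ((X.restrict W).link {v}).faces ↔
      σ ∈ (X.link {v}).faces ∧ ∀ a ∈ σ, a ∈ W := by
    intro σ
    constructor
    · rintro ⟨h1, h2, h3⟩
      exact ⟨⟨h1.1, h2, h3.1⟩, h1.2⟩
    · rintro ⟨⟨h1, h2, h3⟩, h4⟩
      refine ⟨⟨h1, h4⟩, h2, h3, fun a ha => ?_⟩
      rcases Finset.mem_union.1 ha with ha | ha
      · exact h4 a ha
      · rw [Finset.mem_singleton.1 ha]; exact hvW'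
  constructor
  · intro A hA h1 h2
    rw [mem]
    refine ⟨hf A hA (fun a ha => ((mem _).1 (h1 a ha)).1)
      (fun a ha b hb hab => ((mem _).1 (h2 a ha b hb hab)).1), fun a ha => ?_⟩
    exact ((mem _).1 (h1 a ha)).2 a (by simp)
  · rintro m γ ⟨h1, h2, h3⟩ h4 h5
    have hW : ∀ i, γ i ∈ W := fun i => ((mem _).1 (h3 i)).2 _ (by simp)
    obtain ⟨i, j, k1, k2, k3, k4⟩ := hc m γ ⟨h1, h2, fun i => ((mem _).1 (h3 i)).1⟩ h4 h5
    refine ⟨i, j, k1, k2, k3, (mem _).2 ⟨k4, ?_⟩⟩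
    simp [hW]

/-- The local structure of a complex with `6`-large vertex links. -/
def localSix (X : SComplex V) (h : X.VertexLarge) : LocalSix V where
  E a b := a ≠ b ∧ ({a, b} : Finset V) ∈ X.faces
  T a b c := a ≠ b ∧ a ≠ c ∧ b ≠ c ∧ ({a, b, c} : Finset V) ∈ X.faces
  E_symm := fun ⟨h1, h2⟩ => ⟨h1.symm, by rwa [Finset.pair_comm]⟩
  E_irrefl a h := h.1 rfl
  T_swap := fun ⟨h1, h2, h3, h4⟩ => ⟨h1.symm, h3, h2, by rwa [Finset.insert_comm]⟩
  T_rot := by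
    rintro a b c ⟨h1, h2, h3, h4⟩
    refine ⟨h3, h1.symm, h2.symm, ?_⟩
    have : ({b, c, a} : Finset V) = {a, b, c} := by ext x; simp; tauto
    rwa [this]
  T_E := fun ⟨h1, _, _, h4⟩ => ⟨h1, adj_of_mem h4 (by simp) (by simp)⟩
  flag := by
    rintro v a b c ⟨h1, h2, h3, h4⟩ ⟨_, h6, h7, h8⟩ ⟨_, _, h11, h12⟩
    refine ⟨h3, h11, h7, ?_⟩
    have hab := (mem_link_pair h1 h2).2 h4
    have hbc := (mem_link_pair h2 h6).2 h8
    have hac := (mem_link_pair h1 h6).2 h12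
    refine ((h v (singleton_mem h4 (by simp))).1 {a, b, c} (by simp) ?_ ?_).1
    · intro x hx
      simp only [Finset.mem_insert, Finset.mem_singleton] at hx
      rcases hx with rfl | rfl | rfl
      · exact singleton_mem hab (by simp)
      · exact singleton_mem hab (by simp)
      · exact singleton_mem hbc (by simp)
    · intro x hx y hy hxy
      simp only [Finset.mem_insert, Finset.mem_singleton] at hx hy
      rcases hx with rfl | rfl | rfl <;> rcases hy with rfl | rfl | rfl <;>
      first
      | exact absurd rfl hxy
      | assumption
      | (rw [Finset.pair_comm]; assumption)
  square := by
    rintro v a b c d ⟨a1, a2, a3, a4⟩ ⟨_, b2, b3, b4⟩ ⟨_, c2, c3, c4⟩ ⟨_, _, d3, d4⟩ hac hbd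
    have hab := (mem_link_pair a1 a2).2 a4
    have hbc := (mem_link_pair a2 b2).2 b4
    have hcd := (mem_link_pair b2 c2).2 c4
    have hda := (mem_link_pair c2 a1).2 d4
    let γ : ZMod 4 → V := (![a, b, c, d] : Fin 4 → V)
    have hγ : (X.link {v}).IsCycle 4 γ := by
      refine ⟨by norm_num, ?_, ?_⟩
      · intro i j hij
        change Fin 4 at i j
        fin_cases i <;> fin_cases j <;>
        first
        | rfl
        | exact absurd hij a3
        | exact absurd hij.symm a3
        | exact absurd hij b3
        | exact absurd hij.symm b3
        | exact absurd hij c3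
        | exact absurd hij.symm c3
        | exact absurd hij d3
        | exact absurd hij.symm d3
        | exact absurd hij hac
        | exact absurd hij.symm hac
        | exact absurd hij hbd
        | exact absurd hij.symm hbd
      · intro i
        change Fin 4 at i
        fin_cases i
        · exact hab
        · exact hbc
        · exact hcd
        · exact hda
    obtain ⟨i, j, k1, k2, k3, k4⟩ := (h v (singleton_mem a4 (by simp))).2 4 γ hγ le_rfl (by norm_num)
    change Fin 4 at i j
    have e1 := mem_link_pair (X := X) a1 b2
    have e2 := mem_link_pair (X := X) a2 c2
    fin_cases i <;> fin_cases j <;>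
    first
    | exact absurd rfl k1
    | exact absurd rfl k2
    | exact absurd rfl k3
    | exact Or.inl ⟨a1, b2, hac, e1.1 k4⟩
    | exact Or.inl ⟨a1, b2, hac, e1.1 (by rw [Finset.pair_comm]; exact k4)⟩
    | exact Or.inr ⟨a2, c2, hbd, e2.1 k4⟩
    | exact Or.inr ⟨a2, c2, hbd, e2.1 (by rw [Finset.pair_comm]; exact k4)⟩
  pentagon := by
    rintro v a b c d e ⟨a1, a2, a3, a4⟩ ⟨_, b2, b3, b4⟩ ⟨_, c2, c3, c4⟩ ⟨_, d2, d3, d4⟩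
      ⟨_, _, f3, f4⟩ hac had hbd hbe hce
    have hab := (mem_link_pair a1 a2).2 a4
    have hbc := (mem_link_pair a2 b2).2 b4
    have hcd := (mem_link_pair b2 c2).2 c4
    have hde := (mem_link_pair c2 d2).2 d4
    have hea := (mem_link_pair d2 a1).2 f4
    let γ : ZMod 5 → V := (![a, b, c, d, e] : Fin 5 → V)
    have hγ : (X.link {v}).IsCycle 5 γ := by
      refine ⟨by norm_num, ?_, ?_⟩
      · intro i j hij
        change Fin 5 at i j
        fin_cases i <;> fin_cases j <;>
        first
        | rfl
        | exact absurd hij a3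
        | exact absurd hij.symm a3
        | exact absurd hij b3
        | exact absurd hij.symm b3
        | exact absurd hij c3
        | exact absurd hij.symm c3
        | exact absurd hij d3
        | exact absurd hij.symm d3
        | exact absurd hij f3
        | exact absurd hij.symm f3
        | exact absurd hij hac
        | exact absurd hij.symm hac
        | exact absurd hij had
        | exact absurd hij.symm had
        | exact absurd hij hbd
        | exact absurd hij.symm hbd
        | exact absurd hij hbe
        | exact absurd hij.symm hbe
        | exact absurd hij hce
        | exact absurd hij.symm hce
      · intro i
        change Fin 5 at i
        fin_cases i
        · exact hab
        · exact hbc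
        · exact hcd
        · exact hde
        · exact hea
    obtain ⟨i, j, k1, k2, k3, k4⟩ := (h v (singleton_mem a4 (by simp))).2 5 γ hγ
      (by norm_num) (by norm_num)
    change Fin 5 at i j
    have e1 := mem_link_pair (X := X) a1 b2
    have e2 := mem_link_pair (X := X) a1 c2
    have e3 := mem_link_pair (X := X) a2 c2
    have e4 := mem_link_pair (X := X) a2 d2
    have e5 := mem_link_pair (X := X) b2 d2
    have k4' : ({γ j, γ i} : Finset V) ∈ (X.link {v}).faces := by rwa [Finset.pair_comm]
    fin_cases i <;> fin_cases j <;>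
    first
    | exact absurd rfl k1
    | exact absurd rfl k2
    | exact absurd rfl k3
    | exact Or.inl ⟨a1, b2, hac, e1.1 k4⟩
    | exact Or.inl ⟨a1, b2, hac, e1.1 k4'⟩
    | exact Or.inr (Or.inl ⟨a1, c2, had, e2.1 k4⟩)
    | exact Or.inr (Or.inl ⟨a1, c2, had, e2.1 k4'⟩)
    | exact Or.inr (Or.inr (Or.inl ⟨a2, c2, hbd, e3.1 k4⟩))
    | exact Or.inr (Or.inr (Or.inl ⟨a2, c2, hbd, e3.1 k4'⟩))
    | exact Or.inr (Or.inr (Or.inr (Or.inl ⟨a2, d2, hbe, e4.1 k4⟩)))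
    | exact Or.inr (Or.inr (Or.inr (Or.inl ⟨a2, d2, hbe, e4.1 k4'⟩)))
    | exact Or.inr (Or.inr (Or.inr (Or.inr ⟨b2, d2, hce, e5.1 k4⟩)))
    | exact Or.inr (Or.inr (Or.inr (Or.inr ⟨b2, d2, hce, e5.1 k4'⟩)))

theorem Systolic.vertexLarge {X : SComplex V} (h : X.Systolic) : X.VertexLarge :=
  fun _ hv => h.1 _ hv

end SComplex

namespace LocalSix.Development

variable {V : Type} {K : LocalSix V} {u : V} (D : Development K u)

/-- The fibre of the development over a vertex. -/
abbrev Fib (a : V) : Type := {p : D.Y // D.f p = a}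

theorem exists_lift {a b : V} (h : K.E a b) (p : D.Fib a) :
    ∃ q : D.Fib b, D.A p.1 q.1 := by
  obtain ⟨q, h1, h2⟩ := D.surj (p := p.1) (z := b) (by rw [p.2]; exact h)
  exact ⟨⟨q, h2⟩, h1⟩

variable {D} in
theorem lift_unique {b : V} {p : D.Y} {q q' : D.Fib b} (h : D.A p q.1) (h' : D.A p q'.1) :
    q = q' := Subtype.ext (D.inj h h' (q.2.trans q'.2.symm))

/-- Transport of fibres along an edge. -/
noncomputable def transport {a b : V} (h : K.E a b) : D.Fib a ≃ D.Fib b where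
  toFun p := (D.exists_lift h p).choose
  invFun q := (D.exists_lift (K.E_symm h) q).choose
  left_inv p := lift_unique (D.exists_lift (K.E_symm h) _).choose_spec
    (D.symm (D.exists_lift h p).choose_spec)
  right_inv q := lift_unique (D.exists_lift h _).choose_spec
    (D.symm (D.exists_lift (K.E_symm h) q).choose_spec)

theorem transport_adj {a b : V} (h : K.E a b) (p : D.Fib a) :
    D.A p.1 (D.transport h p).1 := (D.exists_lift h p).choose_spec

theorem transport_eq {a b : V} (h : K.E a b) {p : D.Fib a} {q : D.Fib b} (hA : D.A p.1 q.1) :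
    D.transport h p = q := lift_unique (D.transport_adj h p) hA

theorem transport_comp {a b d : V} (h : K.E a b) (h' : K.E b d) (h'' : K.E a d)
    (hT : K.T a b d) (p : D.Fib a) :
    D.transport h' (D.transport h p) = D.transport h'' p := by
  refine D.transport_eq h' ((D.tri (D.transport_adj h p) (D.transport_adj h'' p)).2 ?_)
  rw [p.2, (D.transport h p).2, (D.transport h'' p).2]
  exact hT

end LocalSix.Development

namespace SComplex

variable {V : Type} [DecidableEq V]

/-- A nonabelian `1`-cocycle. -/
def IsCocycle (K : SComplex V) {G : Type} [Group G] (c : V → V → G) : Prop :=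
  ∀ a b d, ({a, b, d} : Finset V) ∈ K.faces → c a b * c b d = c a d

/-- A nonabelian `1`-coboundary. -/
def IsCoboundary (K : SComplex V) {G : Type} [Group G] (c : V → V → G) : Prop :=
  ∃ h : V → G, ∀ a b, K.Adj a b → c a b = (h a)⁻¹ * h b

/-- All cocycles of `K` become coboundaries on `K'`. -/
def TrivOn (K K' : SComplex V) : Prop :=
  ∀ (G : Type) [Group G] (c : V → V → G), K.IsCocycle c → K'.IsCoboundary c

/-- The vertices reached by paths of length `n`. -/
def Ball (X : SComplex V) (a : V) : ℕ → Set V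
  | 0 => {a}
  | n + 1 => {b | ∃ c ∈ Ball X a n, X.Adj c b}

/-- There is an edge path between two vertices. -/
def Joined (X : SComplex V) : V → V → Prop := Relation.ReflTransGen X.Adj

theorem Joined.symm {X : SComplex V} {a b : V} (h : X.Joined a b) : X.Joined b a := by
  induction h with
  | refl => exact .refl
  | tail _ h ih => exact .head h.symm ih

theorem exists_section {K K' : SComplex V} (hK : K.VertexLarge) {u : V}
    (D : LocalSix.Development (K.localSix hK) u) (ht : TrivOn K K')
    {p₀ : D.Y} (h₀ : K.Joined u (D.f p₀))
    (hsub : K'.faces ⊆ K.faces) (hconn : ∀ a, ({a} : Finset V) ∈ K'.faces → K.Joined u a) :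
    ∃ s : V → D.Y, s (D.f p₀) = p₀ ∧ ∀ a, ({a} : Finset V) ∈ K'.faces → D.f (s a) = a ∧
      ∀ b, K'.Adj a b → a ≠ b → D.A (s a) (s b) := by
  classical
  have hequiv : ∀ a, K.Joined u a → Nonempty (D.Fib a ≃ D.Fib u) := by
    intro a h
    induction h with
    | refl => exact ⟨Equiv.refl _⟩
    | @tail b c _ h ih =>
      obtain ⟨e⟩ := ih
      by_cases hbc : b = c
      · exact ⟨hbc ▸ e⟩
      · exact ⟨(D.transport (a := b) (b := c) ⟨hbc, h⟩).symm.trans e⟩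
  let e : ∀ a, K.Joined u a → D.Fib a ≃ D.Fib u := fun a h => (hequiv a h).some
  let c : V → V → Equiv.Perm (D.Fib u) := fun a b =>
    if h : K.Joined u a ∧ K.Joined u b ∧ (K.localSix hK).E b a then
      ((e b h.2.1).symm.trans (D.transport h.2.2)).trans (e a h.1) else 1
  have hc : K.IsCocycle c := by
    intro a b d hf
    have hab : K.Adj a b := adj_of_mem hf (by simp) (by simp)
    have hbd : K.Adj b d := adj_of_mem hf (by simp) (by simp)
    have had : K.Adj a d := adj_of_mem hf (by simp) (by simp)
    by_cases ha : K.Joined u a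
    swap
    · have hb : ¬ K.Joined u b := fun h => ha (h.tail hab.symm)
      simp only [c]
      rw [dif_neg (fun h => ha h.1), dif_neg (fun h => hb h.1), dif_neg (fun h => ha h.1), one_mul]
    have hb : K.Joined u b := ha.tail hab
    have hd : K.Joined u d := ha.tail had
    have hself : ∀ x, c x x = 1 := fun x => by
      simp only [c]; rw [dif_neg (fun h => h.2.2.1 rfl)]
    by_cases e1 : a = b
    · subst e1; rw [hself, one_mul]
    by_cases e2 : b = d
    · subst e2; rw [hself, mul_one]
    have E1 : (K.localSix hK).E b a := ⟨fun h => e1 h.symm, hab.symm⟩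
    have E2 : (K.localSix hK).E d b := ⟨fun h => e2 h.symm, hbd.symm⟩
    have c1 : c a b = ((e b hb).symm.trans (D.transport E1)).trans (e a ha) := by
      simp only [c]; rw [dif_pos ⟨ha, hb, E1⟩]
    have c2 : c b d = ((e d hd).symm.trans (D.transport E2)).trans (e b hb) := by
      simp only [c]; rw [dif_pos ⟨hb, hd, E2⟩]
    by_cases e3 : a = d
    · subst e3
      rw [hself, c1, c2]
      ext1 p
      have : D.transport E1 (D.transport E2 ((e a ha).symm p)) = (e a ha).symm p :=
        D.transport_eq E1 (D.symm (D.transport_adj E2 _))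
      simp [this]
    have E3 : (K.localSix hK).E d a := ⟨fun h => e3 h.symm, had.symm⟩
    have c3 : c a d = ((e d hd).symm.trans (D.transport E3)).trans (e a ha) := by
      simp only [c]; rw [dif_pos ⟨ha, hd, E3⟩]
    rw [c1, c2, c3]
    ext1 p
    have : D.transport E1 (D.transport E2 ((e d hd).symm p)) = D.transport E3 ((e d hd).symm p) := by
      refine D.transport_comp E2 E1 E3 ⟨E2.1, E3.1, E1.1, ?_⟩ _
      have : ({d, b, a} : Finset V) = {a, b, d} := by ext x; simp; tauto
      rwa [this]
    simp [this]
  obtain ⟨h, hh⟩ := ht _ c hc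
  let t : D.Fib u := h (D.f p₀) (e _ h₀ ⟨p₀, rfl⟩)
  let s' : ∀ a, K.Joined u a → D.Fib a := fun a ha => (e a ha).symm ((h a).symm t)
  refine ⟨fun a => if ha : K.Joined u a then (s' a ha).1 else p₀, ?_, ?_⟩
  · simp only [dif_pos h₀, s', t, Equiv.symm_apply_apply]
  · intro a hav
    have ha := hconn a hav
    refine ⟨by simp only [dif_pos ha]; exact (s' a ha).2, fun b hab hne => ?_⟩
    have hb : K.Joined u b := ha.tail (hsub hab)
    beta_reduce
    rw [dif_pos ha, dif_pos hb]
    have E1 : (K.localSix hK).E b a := ⟨hne.symm, (show K.Adj a b from hsub hab).symm⟩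
    have c1 : c a b = ((e b hb).symm.trans (D.transport E1)).trans (e a ha) := by
      simp only [c]; rw [dif_pos ⟨ha, hb, E1⟩]
    have key : D.transport E1 (s' b hb) = s' a ha := by
      have h1 := hh a b hab
      rw [c1] at h1
      have h2 := Equiv.congr_fun h1 ((h b).symm t)
      simp only [Equiv.trans_apply, Equiv.Perm.mul_apply, Equiv.apply_symm_apply] at h2
      rw [← (e a ha).apply_eq_iff_eq]
      simp only [s', Equiv.apply_symm_apply]
      exact h2
    have := D.transport_adj E1 (s' b hb)
    rw [key] at this
    exact D.symm this

/-- The simplices of a complex together with the empty simplex. -/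
def aug (K : SComplex V) : Set (Finset V) := {σ | σ ∈ K.faces ∨ σ = ∅}

open Chain Finsupp

theorem joined_f {K : SComplex V} {hK : K.VertexLarge} {u : V}
    (D : LocalSix.Development (K.localSix hK) u) (p : D.Y) : K.Joined u (D.f p) := by
  induction hn : D.lev p generalizing p with
  | zero => rw [D.eq_y hn, D.f_y]; exact .refl
  | succ n ih =>
    obtain ⟨q, hq, hl⟩ := D.down (p := p) (by omega)
    exact (ih q (by omega)).tail (Adj.symm (D.edge_E hq).2)

theorem image_clique_mem {K : SComplex V} {hK : K.VertexLarge} {u : V}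
    (hu : ({u} : Finset V) ∈ K.faces)
    (D : LocalSix.Development (K.localSix hK) u) {σ : Finset D.Y} (hσ : D.IsClique σ) :
    σ.image D.f ∈ K.aug := by
  rcases σ.eq_empty_or_nonempty with rfl | ⟨p, hp⟩
  · exact Or.inr (by simp)
  left
  have hv : ({D.f p} : Finset V) ∈ K.faces := by
    rcases (joined_f D p).symm.cases_head with e | ⟨b, h, _⟩
    · rwa [e]
    · exact h.left
  by_cases hne : ∃ q ∈ σ, q ≠ p
  swap
  · have : σ = {p} := Finset.eq_singleton_iff_unique_mem.2
      ⟨hp, fun q hq => by by_contra h; exact hne ⟨q, hq, h⟩⟩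
    rw [this, Finset.image_singleton]; exact hv
  classical
  have h1 : ∀ q ∈ σ.erase p, D.A p q := fun q hq =>
    hσ p hp q (Finset.mem_of_mem_erase hq) (Finset.ne_of_mem_erase hq).symm
  have h2 : (σ.erase p).image D.f ∈ (K.link {D.f p}).faces := by
    refine (hK _ hv).1 _ ?_ ?_ ?_
    · obtain ⟨q, hq, hqp⟩ := hne
      exact ⟨D.f q, Finset.mem_image_of_mem _ (Finset.mem_erase.2 ⟨hqp, hq⟩)⟩
    · intro a ha
      obtain ⟨q, hq, rfl⟩ := Finset.mem_image.1 ha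
      have hE := D.edge_E (h1 q hq)
      have := (mem_link_pair (X := K) hE.1 hE.1).2 (by simpa using hE.2)
      simpa using this
    · intro a ha b hb hab
      obtain ⟨q, hq, rfl⟩ := Finset.mem_image.1 ha
      obtain ⟨r, hr, rfl⟩ := Finset.mem_image.1 hb
      have hT := (D.tri (h1 q hq) (h1 r hr)).1 (hσ q (Finset.mem_of_mem_erase hq) r
        (Finset.mem_of_mem_erase hr) (fun e => hab (by rw [e])))
      exact (mem_link_pair hT.1 hT.2.1).2 hT.2.2.2
  have h3 := h2.2.2
  rwa [Finset.union_comm, ← Finset.insert_eq, ← Finset.image_insert, Finset.insert_erase hp] at h3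

theorem exists_bd_of_trivOn {K K' : SComplex V} (hK : K.VertexLarge) {u : V}
    (hu : ({u} : Finset V) ∈ K.faces) (ht : TrivOn K K') (hsub : K'.faces ⊆ K.faces)
    (hconn : ∀ a, ({a} : Finset V) ∈ K'.faces → K.Joined u a) {z : Chain V} (hz : z ∈ on K'.aug)
    (hb : bd z = 0) : ∃ w ∈ on K.aug, bd w = z := by
  classical
  obtain ⟨D⟩ := LocalSix.exists_development (K.localSix hK) u
  obtain ⟨s, -, hs⟩ := exists_section hK D ht (p₀ := D.y) (joined_f D _) hsub hconn
  let S : Chain V →ₗ[ZMod 2] Chain D.Y :=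
    linearCombination (ZMod 2) fun σ => single (σ.image s) 1
  let F : Chain D.Y →ₗ[ZMod 2] Chain V :=
    linearCombination (ZMod 2) fun σ => single (σ.image D.f) 1
  have hS : ∀ σ, S (single σ 1) = single (σ.image s) 1 := fun σ => by
    simp only [S, linearCombination_single, one_smul]
  have hF : ∀ σ, F (single σ 1) = single (σ.image D.f) 1 := fun σ => by
    simp only [F, linearCombination_single, one_smul]
  have hmem : ∀ {σ}, σ ∈ K'.aug → ∀ a ∈ σ, ({a} : Finset V) ∈ K'.faces := by
    rintro σ (hσ | rfl) a ha
    · exact singleton_mem hσ ha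
    · simp at ha
  have himg : ∀ {σ}, σ ∈ K'.aug → (σ.image s).image D.f = σ := by
    intro σ hσ
    rw [Finset.image_image]
    conv_rhs => rw [← Finset.image_id (s := σ)]
    exact Finset.image_congr fun a ha => (hs a (hmem hσ a ha)).1
  have hinj : ∀ {σ}, σ ∈ K'.aug → Set.InjOn s (σ : Set V) := by
    intro σ hσ a ha b hb e
    rw [← (hs a (hmem hσ a ha)).1, ← (hs b (hmem hσ b hb)).1, e]
  have chain_map : ∀ {W W' : Type} [DecidableEq W] [DecidableEq W'] (g : W → W') (σ : Finset W),
      Set.InjOn g (σ : Set W) → (∑ v ∈ σ, single ((σ.erase v).image g) (1 : ZMod 2)) =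
        bd (single (σ.image g) 1) := by
    intro W W' _ _ g σ hg
    rw [bd_single, Finset.sum_image hg]
    refine Finset.sum_congr rfl fun v hv => ?_
    congr 1
    ext x
    simp only [Finset.mem_image, Finset.mem_erase]
    constructor
    · rintro ⟨y, ⟨h1, h2⟩, rfl⟩
      exact ⟨fun e => h1 (hg h2 hv e), y, h2, rfl⟩
    · rintro ⟨h1, y, h2, rfl⟩
      exact ⟨y, ⟨fun e => h1 (by rw [e]), h2⟩, rfl⟩
  have hSz : S z ∈ on {σ : Finset D.Y | D.IsClique σ} := by
    refine map_mem_of_single S ?_ hz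
    intro σ hσ
    rw [hS]
    refine single_mem_on ?_
    intro p hp q hq hpq
    obtain ⟨a, ha, rfl⟩ := Finset.mem_image.1 hp
    obtain ⟨b, hb, rfl⟩ := Finset.mem_image.1 hq
    refine (hs a (hmem hσ a ha)).2 b ?_ (fun e => hpq (by rw [e]))
    rcases hσ with hσ | rfl
    · exact adj_of_mem hσ ha hb
    · simp at ha
  have hbS : bd (S z) = S (bd z) := by
    have : (bd ∘ₗ S - S ∘ₗ bd) z ∈ (⊥ : Submodule (ZMod 2) (Chain D.Y)) := by
      refine map_mem_of_single _ ?_ hz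
      intro σ hσ
      simp only [LinearMap.sub_apply, LinearMap.comp_apply, Submodule.mem_bot]
      rw [hS, ← chain_map s σ (hinj hσ), bd_single, map_sum, sub_eq_zero]
      exact Finset.sum_congr rfl fun v _ => (hS _).symm
    simpa [sub_eq_zero] using this
  obtain ⟨w, hw, hwb⟩ := LocalSix.Development.exists_bd hSz (by rw [hbS, hb, map_zero])
  refine ⟨F w, map_mem_of_single F (fun σ hσ => ?_) hw, ?_⟩
  · rw [hF]; exact single_mem_on (image_clique_mem hu D hσ)
  · have h1 : bd (F w) = F (bd w) := by
      have : (bd ∘ₗ F - F ∘ₗ bd) w ∈ (⊥ : Submodule (ZMod 2) (Chain V)) := by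
        refine map_mem_of_single _ ?_ hw
        intro σ hσ
        simp only [LinearMap.sub_apply, LinearMap.comp_apply, Submodule.mem_bot]
        rw [hF, ← chain_map D.f σ, bd_single, map_sum, sub_eq_zero]
        · exact Finset.sum_congr rfl fun v _ => (hF _).symm
        · intro p hp q hq e
          by_contra hne
          exact (D.edge_E (hσ p hp q hq hne)).1 e
      simpa [sub_eq_zero] using this
    have h2 : F (S z) = z := by
      have : ((F ∘ₗ S - LinearMap.id : Chain V →ₗ[ZMod 2] Chain V)) z ∈ (⊥ : Submodule (ZMod 2) (Chain V)) := by
        refine map_mem_of_single _ ?_ hz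
        intro σ hσ
        simp only [LinearMap.sub_apply, LinearMap.comp_apply, Submodule.mem_bot, LinearMap.id_apply]
        rw [hS, hF, himg hσ, sub_self]
      simpa [sub_eq_zero] using this
    rw [h1, hwb, h2]

/-- In a connected complex with trivial cocycles and `6`-large links, cocycles on balls are
trivial. -/
theorem trivOn_ball {X : SComplex V} (hX : X.VertexLarge) (ht : TrivOn X X) {a : V}
    (hconn : ∀ b, ({b} : Finset V) ∈ X.faces → X.Joined a b) (n : ℕ) :
    TrivOn (X.restrict (X.Ball a n)) (X.restrict (X.Ball a n)) := by
  intro G _ c hc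
  obtain ⟨D⟩ := LocalSix.exists_development (X.localSix hX) a
  obtain ⟨s, hsa, hs⟩ := exists_section hX D ht (p₀ := D.y) (joined_f D _) subset_rfl hconn
  rw [D.f_y] at hsa
  have vert : ∀ b n, ({a} : Finset V) ∈ X.faces → b ∈ X.Ball a n → ({b} : Finset V) ∈ X.faces := by
    intro b n ha hb
    cases n with
    | zero => rw [Set.mem_singleton_iff.1 hb]; exact ha
    | succ n => obtain ⟨c, -, h⟩ := hb; exact h.symm.left
  by_cases ha : ({a} : Finset V) ∈ X.faces
  swap
  · refine ⟨fun _ => 1, fun x y hxy => absurd ?_ ha⟩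
    have := hconn x (Adj.left hxy.1)
    rcases this.cases_head with e | ⟨b, h, -⟩
    · rw [e]; exact Adj.left hxy.1
    · exact h.left
  have lev_s : ∀ n, ∀ b ∈ X.Ball a n, D.lev (s b) ≤ n := by
    intro n
    induction n with
    | zero => intro b hb; rw [Set.mem_singleton_iff.1 hb, hsa, D.lev_y]
    | succ n ih =>
      rintro b ⟨x, hx, hxb⟩
      by_cases e : x = b
      · exact (ih b (e ▸ hx)).trans (Nat.le_succ n)
      · have h1 := (hs x hxb.left).2 b hxb e
        have := D.lev_le (D.symm h1)
        have := ih x hx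
        omega
  have mono : ∀ n b, b ∈ X.Ball a n → b ∈ X.Ball a (n + 1) := fun n b hb =>
    ⟨b, hb, adj_self.2 (vert b n ha hb)⟩
  have f_mem : ∀ n, ∀ p : D.Y, D.lev p ≤ n → D.f p ∈ X.Ball a n := by
    intro n
    induction n with
    | zero => intro p hp; rw [D.eq_y (Nat.le_zero.1 hp), D.f_y]; rfl
    | succ n ih =>
      intro p hp
      by_cases h0 : D.lev p = 0
      · exact mono n _ (ih p (by omega))
      · obtain ⟨q, hq, hl⟩ := D.down h0
        exact ⟨D.f q, ih q (by omega), Adj.symm (D.edge_E hq).2⟩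
  obtain ⟨h, hh⟩ := LocalSix.Development.exists_potential (D := D) n
    (fun p q => c (D.f p) (D.f q)) (by
      intro p q r hp hq hr hpq hqr hpr
      refine hc _ _ _ ⟨?_, ?_⟩
      · classical
        have := image_clique_mem ha D (σ := {p, q, r}) (by
          intro x hx y hy hxy
          simp only [Finset.mem_insert, Finset.mem_singleton] at hx hy
          have s1 := fun h : p ≠ q => D.symm (hpq.resolve_left h)
          have s2 := fun h : q ≠ r => D.symm (hqr.resolve_left h)
          have s3 := fun h : p ≠ r => D.symm (hpr.resolve_left h)
          rcases hx with rfl | rfl | rfl <;> rcases hy with rfl | rfl | rfl <;>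
          first
          | exact absurd rfl hxy
          | exact hpq.resolve_left hxy
          | exact hqr.resolve_left hxy
          | exact hpr.resolve_left hxy
          | exact s1 hxy.symm
          | exact s2 hxy.symm
          | exact s3 hxy.symm)
        rcases this with h | h
        · simpa [Finset.image_insert] using h
        · simp at h
      · intro v hv
        simp only [Finset.mem_insert, Finset.mem_singleton] at hv
        rcases hv with rfl | rfl | rfl
        · exact f_mem n p hp
        · exact f_mem n q hq
        · exact f_mem n r hr)
  have hself : ∀ x, ({x} : Finset V) ∈ (X.restrict (X.Ball a n)).faces → c x x = 1 := fun x hx => by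
    simpa using hc x x x (by simpa using hx)
  refine ⟨fun v => h (s v), fun x y hxy => ?_⟩
  by_cases e : x = y
  · subst e
    rw [hself x (adj_self.1 hxy), inv_mul_cancel]
  have hx : x ∈ X.Ball a n := hxy.2 x (by simp)
  have hy : y ∈ X.Ball a n := hxy.2 y (by simp)
  have h1 := hs x (Adj.left hxy.1)
  have := hh (s x) (s y) (lev_s n x hx) (lev_s n y hy) (h1.2 y hxy.1 e)
  rwa [h1.1, (hs y (Adj.left (Adj.symm hxy.1))).1] at this

end SComplex

section CocycleTriv

open Topology Set

/-- The function is locally constant on the set. -/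
def LocConstOn {T Z : Type*} [TopologicalSpace T] (f : T → Z) (S : Set T) : Prop :=
  ∀ s ∈ S, ∀ᶠ t in 𝓝[S] s, f t = f s

theorem LocConstOn.mono {T Z : Type*} [TopologicalSpace T] {f : T → Z} {S S' : Set T}
    (h : LocConstOn f S) (hs : S' ⊆ S) : LocConstOn f S' :=
  fun s hs' => (h s (hs hs')).filter_mono (nhdsWithin_mono s hs)

theorem LocConstOn.eq_of_isPreconnected {T Z : Type*} [TopologicalSpace T] {f : T → Z}
    {S P : Set T} (h : LocConstOn f S) (hP : IsPreconnected P) (hs : P ⊆ S) {x y : T}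
    (hx : x ∈ P) (hy : y ∈ P) : f x = f y := by
  let _ : TopologicalSpace Z := ⊥
  have : DiscreteTopology Z := ⟨rfl⟩
  refine hP.constant (f := f) ?_ hx hy
  intro s hs'
  rw [ContinuousWithinAt, nhds_discrete, Filter.tendsto_pure]
  exact h.mono hs s hs'

/-- All locally constant nonabelian Čech `1`-cocycles on open covers of `S` are coboundaries. -/
def CocycleTriv {T : Type} [TopologicalSpace T] (S : Set T) : Prop :=
  ∀ (G : Type) [Group G] (Λ : Type) (U : Λ → Set T), (∀ a, IsOpen (U a)) → (S ⊆ ⋃ a, U a) →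
    ∀ c : Λ → Λ → G, (∀ a b d s, s ∈ S → s ∈ U a → s ∈ U b → s ∈ U d → c a b * c b d = c a d) →
    ∃ σ : Λ → T → G, (∀ a b s, s ∈ S → s ∈ U a → s ∈ U b → σ b s = σ a s * c a b) ∧
      ∀ a, LocConstOn (σ a) (S ∩ U a)

theorem cocycleTriv_univ {T : Type} [TopologicalSpace T] [SimplyConnectedSpace T]
    [LocallyPathConnectedSpace T] : CocycleTriv (univ : Set T) := by
  intro G _ Λ U hU hS c hc
  let _ : TopologicalSpace G := ⊥
  have : DiscreteTopology G := ⟨rfl⟩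
  have hcov : ∀ x, ∃ a, x ∈ U a := fun x => mem_iUnion.1 (hS (mem_univ x))
  choose ia hia using hcov
  let Z : FiberBundleCore Λ T G :=
    { baseSet := U
      isOpen_baseSet := hU
      indexAt := ia
      mem_baseSet_at := hia
      coordChange := fun a b _ v => v * c a b
      coordChange_self := by
        intro a x hx v
        have := hc a a a x (mem_univ x) hx hx hx
        rw [mul_eq_left.1 this, mul_one]
      continuousOn_coordChange := fun a b =>
        ((continuous_of_discreteTopology (f := fun v : G => v * c a b)).comp
          continuous_snd).continuousOn
      coordChange_comp := by
        rintro a b d x ⟨⟨h1, h2⟩, h3⟩ v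
        rw [mul_assoc, hc a b d x (mem_univ x) h1 h2 h3] }
  have hcm : IsCoveringMap Z.proj := FiberBundle.isCoveringMap
  obtain ⟨t₀⟩ : Nonempty T := inferInstance
  obtain ⟨s, ⟨-, hs⟩, -⟩ := hcm.existsUnique_continuousMap_lifts (ContinuousMap.id T) t₀
    (⟨t₀, (1 : G)⟩ : Z.TotalSpace) rfl
  have hs' : ∀ t, (s t).1 = t := fun t => congrFun hs t
  refine ⟨fun a t => (Z.localTriv a (s t)).2, ?_, ?_⟩
  · intro a b t _ ha hb
    beta_reduce
    rw [Z.localTriv_apply, Z.localTriv_apply]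
    refine (Z.coordChange_comp _ a b (s t).1 ⟨⟨hia _, ?_⟩, ?_⟩ _).symm
    · rw [hs']; exact ha
    · rw [hs']; exact hb
  · intro a t ht
    have h1 : ContinuousOn (fun t => (Z.localTriv a (s t)).2) (univ ∩ U a) := by
      refine continuous_snd.comp_continuousOn
        ((Z.localTriv a).continuousOn.comp s.continuous.continuousOn ?_)
      intro t ht
      refine (Z.mem_localTriv_source a _).2 ?_
      rw [hs', ← Z.baseSet_at]
      exact ht.2
    have := h1 t ht
    rwa [ContinuousWithinAt, nhds_discrete, Filter.tendsto_pure] at this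

theorem CocycleTriv.of_subtype {T : Type} [TopologicalSpace T] {S : Set T}
    (h : CocycleTriv (univ : Set S)) : CocycleTriv S := by
  classical
  intro G _ Λ U hU hS c hc
  obtain ⟨σ, h1, h2⟩ := h G Λ (fun a => ((↑) : S → T) ⁻¹' U a)
    (fun a => (hU a).preimage continuous_subtype_val)
    (fun x _ => by simpa using hS x.2) c (fun a b d s _ ha hb hd => hc a b d s s.2 ha hb hd)
  refine ⟨fun a t => if ht : t ∈ S then σ a ⟨t, ht⟩ else 1, ?_, ?_⟩
  · intro a b s hs ha hb
    simp only [dif_pos hs]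
    exact h1 a b ⟨s, hs⟩ (mem_univ _) ha hb
  · rintro a s ⟨hs, ha⟩
    have h3 := h2 a ⟨s, hs⟩ ⟨mem_univ _, ha⟩
    rw [eventually_nhdsWithin_iff, nhds_subtype, Filter.eventually_comap] at h3
    rw [eventually_nhdsWithin_iff]
    filter_upwards [h3] with t ht ⟨htS, hta⟩
    simp only [dif_pos hs, dif_pos htS]
    exact ht ⟨t, htS⟩ rfl ⟨mem_univ _, hta⟩

theorem CocycleTriv.of_simplyConnected {T : Type} [TopologicalSpace T] {S : Set T}
    [SimplyConnectedSpace S] [LocallyPathConnectedSpace S] : CocycleTriv S :=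
  .of_subtype cocycleTriv_univ

theorem CocycleTriv.union {T : Type} [TopologicalSpace T] {A B : Set T} (hA : IsOpen A)
    (hB : IsOpen B) (tA : CocycleTriv A) (tB : CocycleTriv B) (hAB : IsPreconnected (A ∩ B)) :
    CocycleTriv (A ∪ B) := by
  classical
  intro G _ Λ U hU hS c hc
  obtain ⟨α, α1, α2⟩ := tA G Λ U hU (subset_union_left.trans hS) c
    (fun a b d s hs => hc a b d s (Or.inl hs))
  obtain ⟨β, β1, β2⟩ := tB G Λ U hU (subset_union_right.trans hS) c
    (fun a b d s hs => hc a b d s (Or.inr hs))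
  obtain ⟨g, hg⟩ : ∃ g : G, ∀ a s, s ∈ A ∩ B → s ∈ U a → α a s = g * β a s := by
    have hcov : ∀ x, x ∈ A ∩ B → ∃ a, x ∈ U a := fun x hx => mem_iUnion.1 (hS (Or.inl hx.1))
    rcases (A ∩ B).eq_empty_or_nonempty with h | ⟨x₀, hx₀⟩
    · exact ⟨1, fun a s hs => by simp [h] at hs⟩
    let μ : T → G := fun s => if h : s ∈ A ∩ B then
      α (hcov s h).choose s * (β (hcov s h).choose s)⁻¹ else 1
    have hμ : ∀ s a, s ∈ A ∩ B → s ∈ U a → μ s = α a s * (β a s)⁻¹ := by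
      intro s a hs ha
      simp only [μ, dif_pos hs]
      have hb := (hcov s hs).choose_spec
      rw [α1 a _ s hs.1 ha hb, β1 a _ s hs.2 ha hb]
      group
    have hloc : LocConstOn μ (A ∩ B) := by
      intro s hs
      obtain ⟨a, ha⟩ := hcov s hs
      have e1 := α2 a s ⟨hs.1, ha⟩
      have e2 := β2 a s ⟨hs.2, ha⟩
      rw [eventually_nhdsWithin_iff] at e1 e2 ⊢
      filter_upwards [e1, e2, (hU a).mem_nhds ha] with t h1 h2 h3 ht
      rw [hμ t a ht h3, hμ s a hs ha, h1 ⟨ht.1, h3⟩, h2 ⟨ht.2, h3⟩]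
    refine ⟨μ x₀, fun a s hs ha => ?_⟩
    rw [hloc.eq_of_isPreconnected hAB subset_rfl hx₀ hs, hμ s a hs ha]
    group
  refine ⟨fun a s => if s ∈ A then α a s else g * β a s, ?_, ?_⟩
  · intro a b s hs ha hb
    by_cases h : s ∈ A
    · simp only [if_pos h]; exact α1 a b s h ha hb
    · simp only [if_neg h]; rw [β1 a b s (hs.resolve_left h) ha hb, mul_assoc]
  · rintro a s ⟨hs, ha⟩
    by_cases h : s ∈ A
    · have e1 := α2 a s ⟨h, ha⟩
      rw [eventually_nhdsWithin_iff] at e1 ⊢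
      filter_upwards [e1, hA.mem_nhds h] with t h1 h2 ht
      rw [if_pos h, if_pos h2]
      exact h1 ⟨h2, ht.2⟩
    · have hsB := hs.resolve_left h
      have e1 := β2 a s ⟨hsB, ha⟩
      rw [eventually_nhdsWithin_iff] at e1 ⊢
      filter_upwards [e1, hB.mem_nhds hsB] with t h1 h2 ht
      rw [if_neg h]
      by_cases h3 : t ∈ A
      · rw [if_pos h3, hg a t ⟨h3, h2⟩ ht.2, h1 ⟨h2, ht.2⟩]
      · rw [if_neg h3, h1 ⟨h2, ht.2⟩]

theorem cocycleTriv_empty {T : Type} [TopologicalSpace T] : CocycleTriv (∅ : Set T) :=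
  fun _ _ _ _ _ _ _ _ => ⟨fun _ _ => 1, fun _ _ _ h => h.elim, fun _ _ h => h.1.elim⟩

section Convex

variable {W : Type} [NormedAddCommGroup W] [NormedSpace ℝ W]

theorem Convex.cocycleTriv {S : Set W} (hS : Convex ℝ S) (ho : IsOpen S) : CocycleTriv S := by
  rcases S.eq_empty_or_nonempty with rfl | hne
  · exact cocycleTriv_empty
  have := hS.contractibleSpace hne
  have := ho.locallyPathConnectedSpace
  exact .of_simplyConnected

theorem cocycleTriv_biUnion {ι : Type} (s : Finset ι) (H : ι → Set W) (hc : ∀ i, Convex ℝ (H i))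
    (ho : ∀ i, IsOpen (H i)) (x : W) (hx : ∀ i, x ∈ H i) : CocycleTriv (⋃ i ∈ s, H i) := by
  classical
  induction s using Finset.induction_on with
  | empty => simpa using cocycleTriv_empty
  | insert i s _ ih =>
    rw [Finset.set_biUnion_insert]
    refine ((hc i).cocycleTriv (ho i)).union (ho i) (isOpen_biUnion fun j _ => ho j) ih ?_
    have : (H i ∩ ⋃ j ∈ s, H j) = ⋃₀ ((fun j => H i ∩ H j) '' (s : Set ι)) := by
      simp [sUnion_image, inter_iUnion₂]
    rw [this]
    refine isPreconnected_sUnion x _ ?_ ?_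
    · rintro _ ⟨j, -, rfl⟩; exact ⟨hx i, hx j⟩
    · rintro _ ⟨j, -, rfl⟩; exact ((hc i).inter (hc j)).isPreconnected

end Convex

section Cube

variable {n : ℕ}

theorem convex_gt (R : ℝ) (i : Fin n) : Convex ℝ {x : Fin n → ℝ | R < x i} :=
  (convex_Ioi R).is_linear_preimage (LinearMap.proj (R := ℝ) (φ := fun _ : Fin n => ℝ) i).isLinear

theorem convex_lt (R : ℝ) (i : Fin n) : Convex ℝ {x : Fin n → ℝ | x i < -R} :=
  (convex_Iio (-R)).is_linear_preimage
    (LinearMap.proj (R := ℝ) (φ := fun _ : Fin n => ℝ) i).isLinear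

theorem isOpen_gt_coord (R : ℝ) (i : Fin n) : IsOpen {x : Fin n → ℝ | R < x i} :=
  isOpen_lt continuous_const (continuous_apply i)

theorem isOpen_lt_coord (R : ℝ) (i : Fin n) : IsOpen {x : Fin n → ℝ | x i < -R} :=
  isOpen_lt (continuous_apply i) continuous_const

theorem compl_closedBall_eq {R : ℝ} (hR : 0 ≤ R) :
    (Metric.closedBall (0 : Fin n → ℝ) R)ᶜ =
      (⋃ i, {x : Fin n → ℝ | R < x i}) ∪ ⋃ i, {x : Fin n → ℝ | x i < -R} := by
  ext x
  simp only [mem_compl_iff, Metric.mem_closedBall, dist_zero_right, pi_norm_le_iff_of_nonneg hR,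
    Real.norm_eq_abs, abs_le, not_forall, mem_union, mem_iUnion, mem_ofPred_eq, not_and_or, not_le]
  rw [← exists_or]
  exact exists_congr fun i => or_comm

theorem isPreconnected_iUnion_gt (R : ℝ) :
    IsPreconnected (⋃ i, {x : Fin n → ℝ | R < x i}) :=
  isPreconnected_iUnion ⟨fun _ => R + 1, by simp⟩ fun i => (convex_gt R i).isPreconnected

theorem isPreconnected_iUnion_lt (R : ℝ) :
    IsPreconnected (⋃ i, {x : Fin n → ℝ | x i < -R}) :=
  isPreconnected_iUnion ⟨fun _ => -R - 1, by simp⟩ fun i => (convex_lt R i).isPreconnected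

theorem isPreconnected_inter_halfspaces (hn : 3 ≤ n) {R : ℝ} (hR : 0 ≤ R) :
    IsPreconnected ((⋃ i, {x : Fin n → ℝ | R < x i}) ∩ ⋃ i, {x : Fin n → ℝ | x i < -R}) := by
  let P : {p : Fin n × Fin n // p.1 ≠ p.2} → Set (Fin n → ℝ) := fun p =>
    {x | R < x p.1.1} ∩ {x | x p.1.2 < -R}
  have hP : ((⋃ i, {x : Fin n → ℝ | R < x i}) ∩ ⋃ i, {x : Fin n → ℝ | x i < -R}) = ⋃ p, P p := by
    ext x
    simp only [mem_inter_iff, mem_iUnion, mem_ofPred_eq, P]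
    constructor
    · rintro ⟨⟨i, hi⟩, j, hj⟩
      exact ⟨⟨(i, j), fun (e : i = j) => by subst e; linarith⟩, hi, hj⟩
    · rintro ⟨p, h1, h2⟩
      exact ⟨⟨_, h1⟩, _, h2⟩
  rw [hP]
  have hmeet : ∀ p q : {p : Fin n × Fin n // p.1 ≠ p.2}, p.1.1 ≠ q.1.2 → q.1.1 ≠ p.1.2 →
      (P p ∩ P q).Nonempty := by
    rintro ⟨⟨i, j⟩, hij⟩ ⟨⟨k, l⟩, hkl⟩ h1 h2
    simp only at hij hkl h1 h2
    refine ⟨fun m => if m = i ∨ m = k then R + 1 else -R - 1, ⟨?_, ?_⟩, ?_, ?_⟩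
    · simp
    · simp [hij.symm, h2.symm]
    · simp
    · simp [h1.symm, hkl.symm]
  refine IsPreconnected.iUnion_of_reflTransGen
    (fun p => ((convex_gt R _).inter (convex_lt R _)).isPreconnected) ?_
  have step : ∀ i j l (h1 : i ≠ j) (h2 : i ≠ l),
      (P ⟨(i, j), h1⟩ ∩ P ⟨(i, l), h2⟩).Nonempty := fun i j l h1 h2 => hmeet _ _ h2 h1
  have step' : ∀ i j k (h1 : i ≠ j) (h2 : k ≠ j),
      (P ⟨(i, j), h1⟩ ∩ P ⟨(k, j), h2⟩).Nonempty := fun i j k h1 h2 => hmeet _ _ h1 h2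
  have two : ∀ i j k l (h1 : i ≠ j) (h2 : k ≠ l), i ≠ l →
      Relation.ReflTransGen (fun p q => (P p ∩ P q).Nonempty) ⟨(i, j), h1⟩ ⟨(k, l), h2⟩ :=
    fun i j k l h1 h2 h3 => (Relation.ReflTransGen.single (step i j l h1 h3)).tail
      (step' i l k h3 h2)
  rintro ⟨⟨i, j⟩, hij⟩ ⟨⟨k, l⟩, hkl⟩
  by_cases h : i = l
  · obtain ⟨m, hm⟩ : ∃ m : Fin n, m ∉ ({i, k} : Finset (Fin n)) := by
      by_contra! hall
      have h1 : (Finset.univ : Finset (Fin n)) ⊆ {i, k} := fun x _ => hall x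
      have h2 := Finset.card_le_card h1
      have h3 : ({i, k} : Finset (Fin n)).card ≤ 2 := Finset.card_le_two
      rw [Finset.card_fin] at h2
      omega
    simp only [Finset.mem_insert, Finset.mem_singleton, not_or] at hm
    exact (two i j k m hij (fun e => hm.2 e.symm) (fun e => hm.1 e.symm)).tail
      (step k m l _ hkl)
  · exact two i j k l hij hkl h

/-- The complement of a cube is simply connected in the sense of cocycles. -/
theorem cocycleTriv_compl_closedBall (hn : 3 ≤ n) {R : ℝ} (hR : 0 ≤ R) :
    CocycleTriv (Metric.closedBall (0 : Fin n → ℝ) R)ᶜ := by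
  rw [compl_closedBall_eq hR]
  refine CocycleTriv.union (isOpen_iUnion (isOpen_gt_coord R)) (isOpen_iUnion (isOpen_lt_coord R))
    ?_ ?_ (isPreconnected_inter_halfspaces hn hR)
  · simpa using cocycleTriv_biUnion Finset.univ (fun i : Fin n => {x : Fin n → ℝ | R < x i})
      (convex_gt R) (isOpen_gt_coord R) (fun _ => R + 1) (by simp)
  · simpa using cocycleTriv_biUnion Finset.univ (fun i : Fin n => {x : Fin n → ℝ | x i < -R})
      (convex_lt R) (isOpen_lt_coord R) (fun _ => -R - 1) (by simp)

theorem isPreconnected_compl_closedBall (hn : 2 ≤ n) {R : ℝ} (hR : 0 ≤ R) :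
    IsPreconnected (Metric.closedBall (0 : Fin n → ℝ) R)ᶜ := by
  rw [compl_closedBall_eq hR]
  refine IsPreconnected.union' ?_ (isPreconnected_iUnion_gt R) (isPreconnected_iUnion_lt R)
  refine ⟨fun i => if i = ⟨0, by omega⟩ then R + 1 else -R - 1, mem_iUnion.2 ⟨⟨0, by omega⟩, ?_⟩,
    mem_iUnion.2 ⟨⟨1, by omega⟩, ?_⟩⟩
  · simp
  · simp

end Cube

end CocycleTriv

namespace SComplex

open Set Topology

variable {V : Type}

/-- The closed geometric simplex spanned by a finite set of vertices. -/
def geomSimplex (σ : Finset V) : Set (V → ℝ) :=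
  {f | (∀ v, 0 ≤ f v) ∧ (∀ v, v ∉ σ → f v = 0) ∧ ∑ v ∈ σ, f v = 1}

theorem mem_realization_iff {X : SComplex V} {f : V → ℝ} :
    f ∈ X.realization ↔ ∃ σ ∈ X.faces, f ∈ geomSimplex σ :=
  ⟨fun ⟨h, σ, hσ, h1, h2⟩ => ⟨σ, hσ, h, h1, h2⟩, fun ⟨σ, hσ, h, h1, h2⟩ => ⟨h, σ, hσ, h1, h2⟩⟩

theorem convex_geomSimplex (σ : Finset V) : Convex ℝ (geomSimplex σ) := by
  rintro f ⟨f1, f2, f3⟩ g ⟨g1, g2, g3⟩ s t hs ht hst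
  refine ⟨fun v => ?_, fun v hv => ?_, ?_⟩
  · have := f1 v; have := g1 v
    simp only [Pi.add_apply, Pi.smul_apply, smul_eq_mul]; positivity
  · simp [f2 v hv, g2 v hv]
  · simp [Finset.sum_add_distrib, ← Finset.mul_sum, f3, g3, hst]

theorem exists_pos {σ : Finset V} {f : V → ℝ} (hf : f ∈ geomSimplex σ) : ∃ v, 0 < f v := by
  by_contra! h
  have := Finset.sum_nonpos (s := σ) fun v _ => h v
  rw [hf.2.2] at this
  linarith

theorem isOpen_star (v : V) : IsOpen {f : V → ℝ | 0 < f v} :=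
  isOpen_lt continuous_const (continuous_apply v)

variable [DecidableEq V]

theorem mem_geomSimplex_of_support {σ τ : Finset V} {f : V → ℝ} (hf : f ∈ geomSimplex τ)
    (h : ∀ v, 0 < f v → v ∈ σ) : f ∈ geomSimplex σ := by
  have h0 : ∀ v, v ∉ σ → f v = 0 := fun v hv =>
    le_antisymm (not_lt.1 fun h' => hv (h v h')) (hf.1 v)
  refine ⟨hf.1, h0, ?_⟩
  rw [← hf.2.2, Finset.sum_subset (Finset.subset_union_left (s₂ := τ)) fun v _ hv => h0 v hv]
  exact (Finset.sum_subset (Finset.subset_union_right) fun v _ hv => hf.2.1 v hv).symm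

theorem single_mem_geomSimplex (v : V) : Pi.single v (1 : ℝ) ∈ geomSimplex {v} := by
  refine ⟨fun w => ?_, fun w hw => ?_, by simp⟩
  · by_cases h : w = v
    · subst h; simp
    · simp [h]
  · simp at hw; simp [hw]

theorem pos_mem {σ : Finset V} {f : V → ℝ} (hf : f ∈ geomSimplex σ) {v : V} (hv : 0 < f v) :
    v ∈ σ := by
  by_contra h
  rw [hf.2.1 v h] at hv
  exact lt_irrefl _ hv

theorem single_mem_realization {X : SComplex V} {v : V} (hv : ({v} : Finset V) ∈ X.faces) :
    Pi.single v (1 : ℝ) ∈ X.realization :=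
  mem_realization_iff.2 ⟨_, hv, single_mem_geomSimplex v⟩

theorem locallyPathConnectedSpace_realization (X : SComplex V) :
    LocallyPathConnectedSpace X.realization := by
  refine ⟨fun f => Filter.hasBasis_self.2 fun t ht => ?_⟩
  obtain ⟨σ, hσ, hf⟩ := mem_realization_iff.1 f.2
  rw [nhds_subtype, Filter.mem_comap] at ht
  obtain ⟨u, hu, hut⟩ := ht
  have hpos : {g : V → ℝ | ∀ v ∈ σ, 0 < f.1 v → 0 < g v} ∈ 𝓝 f.1 := by
    refine (Filter.eventually_all_finset σ).2 fun v _ => ?_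
    by_cases h : 0 < f.1 v
    · filter_upwards [(continuous_apply v).continuousAt.eventually (lt_mem_nhds h)] with g hg _
      exact hg
    · exact Filter.Eventually.of_forall fun g h' => absurd h' h
  obtain ⟨B, ⟨hB, hBc⟩, hBu⟩ :=
    ((LocallyConvexSpace.convex_basis (𝕜 := ℝ) f.1).mem_iff).1 (Filter.inter_mem hu hpos)
  refine ⟨(↑) ⁻¹' B, preimage_coe_mem_nhds_subtype.2 (mem_nhdsWithin_of_mem_nhds hB), ?_, fun g hg => hut (hBu hg).1⟩
  rw [IsInducing.subtypeVal.isPathConnected_iff, Subtype.image_preimage_coe]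
  refine StarConvex.isPathConnected (a := f.1) ?_ ⟨f.2, mem_of_mem_nhds hB⟩
  rintro g ⟨hgX, hgB⟩ a b ha hb hab
  refine ⟨?_, hBc (mem_of_mem_nhds hB) hgB ha hb hab⟩
  obtain ⟨τ, hτ, hg⟩ := mem_realization_iff.1 hgX
  refine mem_realization_iff.2 ⟨τ, hτ, convex_geomSimplex τ ?_ hg ha hb hab⟩
  exact mem_geomSimplex_of_support hf fun v hv => pos_mem hg ((hBu hgB).2 v (pos_mem hf hv) hv)

theorem isPreconnected_star (X : SComplex V) (v : V) :
    IsPreconnected (X.realization ∩ {f | 0 < f v}) := by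
  rcases (X.realization ∩ {f | 0 < f v}).eq_empty_or_nonempty with h | ⟨f, hf⟩
  · rw [h]; exact isPreconnected_empty
  obtain ⟨σ, hσ, hfσ⟩ := mem_realization_iff.1 hf.1
  suffices h : StarConvex ℝ (Pi.single v (1 : ℝ)) (X.realization ∩ {f | 0 < f v}) from
    (h.isPathConnected ⟨single_mem_realization (singleton_mem hσ (pos_mem hfσ hf.2)),
      by simp⟩).isConnected.isPreconnected
  rintro g ⟨hgX, hg⟩ a b ha hb hab
  obtain ⟨τ, hτ, hgτ⟩ := mem_realization_iff.1 hgX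
  have hv := pos_mem hgτ hg
  refine ⟨mem_realization_iff.2 ⟨τ, hτ, convex_geomSimplex τ ?_ hgτ ha hb hab⟩, ?_⟩
  · refine mem_geomSimplex_of_support (single_mem_geomSimplex v) fun w hw => ?_
    rwa [Finset.mem_singleton.1 (pos_mem (single_mem_geomSimplex v) hw)]
  · have hg' : 0 < g v := hg
    simp only [mem_ofPred_eq, Pi.add_apply, Pi.smul_apply, smul_eq_mul, Pi.single_eq_same, mul_one]
    rcases ha.eq_or_lt with rfl | ha
    · rw [zero_add] at hab; rw [hab]; linarith
    · positivity

/-- A complex with simply connected realization has trivial nonabelian cocycles. -/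
theorem trivOn_self (X : SComplex V) [SimplyConnectedSpace X.realization] : TrivOn X X := by
  intro G _ c hc
  have := X.locallyPathConnectedSpace_realization
  obtain ⟨σ, h1, h2⟩ := CocycleTriv.of_simplyConnected (S := X.realization) G V
    (fun v => {f | 0 < f v}) isOpen_star (fun f hf => by
      obtain ⟨σ, -, hσ⟩ := mem_realization_iff.1 hf
      exact mem_iUnion.2 (exists_pos hσ)) c (by
      intro a b d f hf ha hb hd
      obtain ⟨σ, hσ, hfσ⟩ := mem_realization_iff.1 hf
      refine hc a b d (X.down_closed σ hσ _ ?_ (by simp))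
      simp [Finset.insert_subset_iff, pos_mem hfσ ha, pos_mem hfσ hb, pos_mem hfσ hd])
  refine ⟨fun v => σ v (Pi.single v 1), fun a b hab => ?_⟩
  let m : V → ℝ := (1 / 2 : ℝ) • Pi.single a (1 : ℝ) + (1 / 2 : ℝ) • Pi.single b (1 : ℝ)
  have hm : m ∈ geomSimplex {a, b} := by
    refine convex_geomSimplex _ ?_ ?_ (by norm_num) (by norm_num) (by norm_num)
    · exact mem_geomSimplex_of_support (single_mem_geomSimplex a) fun w hw => by
        simp [Finset.mem_singleton.1 (pos_mem (single_mem_geomSimplex a) hw)]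
    · exact mem_geomSimplex_of_support (single_mem_geomSimplex b) fun w hw => by
        simp [Finset.mem_singleton.1 (pos_mem (single_mem_geomSimplex b) hw)]
  have hmX : m ∈ X.realization := mem_realization_iff.2 ⟨_, hab, hm⟩
  have hs : ∀ x y : V, (0 : ℝ) ≤ (Pi.single x 1 : V → ℝ) y := fun x y =>
    (single_mem_geomSimplex x).1 y
  have hma : 0 < m a := by
    have := hs b a
    simp only [m, Pi.add_apply, Pi.smul_apply, smul_eq_mul, Pi.single_eq_same]; positivity
  have hmb : 0 < m b := by
    have := hs a b
    simp only [m, Pi.add_apply, Pi.smul_apply, smul_eq_mul, Pi.single_eq_same]; positivity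
  have ea := (h2 a).eq_of_isPreconnected (X.isPreconnected_star a) subset_rfl
    ⟨single_mem_realization (Adj.left hab), by simp⟩ ⟨hmX, hma⟩
  have eb := (h2 b).eq_of_isPreconnected (X.isPreconnected_star b) subset_rfl
    ⟨single_mem_realization (Adj.left hab.symm), by simp⟩ ⟨hmX, hmb⟩
  have := h1 a b m hmX hma hmb
  simp only [ea, eb, this]
  group

/-- Vertices of a complex with connected realization are joined by edge paths. -/
theorem joined_of_connected {X : SComplex V} [ConnectedSpace X.realization] {a b : V}
    (ha : ({a} : Finset V) ∈ X.faces) (hb : ({b} : Finset V) ∈ X.faces) : X.Joined a b := by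
  have hpre : IsPreconnected X.realization := isPreconnected_iff_preconnectedSpace.2 inferInstance
  have key : ∀ f ∈ X.realization, ∀ v, 0 < f v →
      ((∃ w, 0 < f w ∧ X.Joined a w) ↔ X.Joined a v) := by
    intro f hf v hv
    refine ⟨fun ⟨w, hw, h⟩ => ?_, fun h => ⟨v, hv, h⟩⟩
    obtain ⟨σ, hσ, hfσ⟩ := mem_realization_iff.1 hf
    exact h.tail (adj_of_mem hσ (pos_mem hfσ hw) (pos_mem hfσ hv))
  have hloc : LocConstOn (fun f : V → ℝ => ∃ w, 0 < f w ∧ X.Joined a w) X.realization := by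
    intro f hf
    obtain ⟨σ, -, hσ⟩ := mem_realization_iff.1 hf
    obtain ⟨v, hv⟩ := exists_pos hσ
    rw [eventually_nhdsWithin_iff]
    filter_upwards [(isOpen_star v).mem_nhds hv] with g hg hgX
    exact propext ((key g hgX v hg).trans (key f hf v hv).symm)
  have h := hloc.eq_of_isPreconnected hpre subset_rfl (single_mem_realization ha)
    (single_mem_realization hb)
  have h1 := (key _ (single_mem_realization ha) a (by simp)).2 .refl
  exact (key _ (single_mem_realization hb) b (by simp)).1 (h ▸ h1)

end SComplex

namespace SComplex

open Set Topology

variable {V : Type} [DecidableEq V]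

theorem singleton_mem_of_mem_ball {X : SComplex V} {a b : V} (ha : ({a} : Finset V) ∈ X.faces)
    {n : ℕ} (h : b ∈ X.Ball a n) : ({b} : Finset V) ∈ X.faces := by
  cases n with
  | zero => rw [mem_singleton_iff.1 h]; exact ha
  | succ n => obtain ⟨c, -, h⟩ := h; exact h.symm.left

theorem ball_mono {X : SComplex V} {a : V} (ha : ({a} : Finset V) ∈ X.faces) :
    Monotone (X.Ball a) :=
  monotone_nat_of_le_succ fun _ b hb => ⟨b, hb, adj_self.2 (singleton_mem_of_mem_ball ha hb)⟩

theorem ball_trans {X : SComplex V} {a b d : V} {m n : ℕ} (h : b ∈ X.Ball a m)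
    (h' : d ∈ X.Ball b n) : d ∈ X.Ball a (m + n) := by
  induction n generalizing d with
  | zero => rwa [mem_singleton_iff.1 h']
  | succ n ih => obtain ⟨c, hc, hd⟩ := h'; exact ⟨c, ih hc, hd⟩

theorem self_mem_ball {X : SComplex V} {a : V} (ha : ({a} : Finset V) ∈ X.faces) (n : ℕ) :
    a ∈ X.Ball a n := ball_mono ha (Nat.zero_le n) rfl

theorem Adj.mem_ball {X : SComplex V} {a b : V} (h : X.Adj a b) : b ∈ X.Ball a 1 := ⟨a, rfl, h⟩

theorem mem_ball_symm {X : SComplex V} {a b : V} {n : ℕ} (h : b ∈ X.Ball a n) :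
    a ∈ X.Ball b n := by
  induction n generalizing b with
  | zero => exact (mem_singleton_iff.1 h).symm
  | succ n ih =>
    obtain ⟨c, hc, hb⟩ := h
    rw [add_comm]
    exact ball_trans hb.symm.mem_ball (ih hc)

theorem restrict_adj {X : SComplex V} {W : Set V} {a b : V} :
    (X.restrict W).Adj a b ↔ X.Adj a b ∧ a ∈ W ∧ b ∈ W := by
  simp only [Adj, restrict, mem_ofPred_eq, Finset.mem_insert, Finset.mem_singleton, forall_eq_or_imp,
    forall_eq]

theorem joined_restrict_of_ball {X : SComplex V} {W : Set V} {a b : V}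
    (ha : ({a} : Finset V) ∈ X.faces) {n : ℕ} (hW : X.Ball a n ⊆ W) (h : b ∈ X.Ball a n) :
    (X.restrict W).Joined a b := by
  induction n generalizing b with
  | zero => rw [mem_singleton_iff.1 h]; exact .refl
  | succ n ih =>
    obtain ⟨c, hc, hcb⟩ := h
    have hm := ball_mono ha (Nat.le_succ n)
    exact (ih (hm.trans hW) hc).tail (restrict_adj.2 ⟨hcb, hW (hm hc), hW ⟨c, hc, hcb⟩⟩)

theorem potential_unique {X : SComplex V} {G : Type} [Group G] {c : V → V → G} {h h' : V → G}
    {a b : V} (ha : ({a} : Finset V) ∈ X.faces) {n : ℕ}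
    (e : ∀ x ∈ X.Ball a n, ∀ y ∈ X.Ball a n, X.Adj x y → c x y = (h x)⁻¹ * h y)
    (e' : ∀ x ∈ X.Ball a n, ∀ y ∈ X.Ball a n, X.Adj x y → c x y = (h' x)⁻¹ * h' y)
    (hb : b ∈ X.Ball a n) : (h a)⁻¹ * h b = (h' a)⁻¹ * h' b := by
  induction n generalizing b with
  | zero => rw [mem_singleton_iff.1 hb, inv_mul_cancel, inv_mul_cancel]
  | succ n ih =>
    obtain ⟨x, hx, hxb⟩ := hb
    have hm := ball_mono ha (Nat.le_succ n)
    have h1 := ih (fun x hx y hy => e x (hm hx) y (hm hy)) (fun x hx y hy => e' x (hm hx) y (hm hy))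
      hx
    have h2 := e x (hm hx) b ⟨x, hx, hxb⟩ hxb
    have h3 := e' x (hm hx) b ⟨x, hx, hxb⟩ hxb
    calc (h a)⁻¹ * h b = ((h a)⁻¹ * h x) * ((h x)⁻¹ * h b) := by group
      _ = ((h' a)⁻¹ * h' x) * ((h' x)⁻¹ * h' b) := by rw [h1, ← h2, h3]
      _ = _ := by group

/-- A family of open sets indexed by the vertices of a complex, whose nerve is coarsely the
complex. -/
structure CoarseNerve (X : SComplex V) {T : Type} [PseudoMetricSpace T] (U : V → Set T) (L : ℕ) :
    Prop where
  isOpen : ∀ a, IsOpen (U a)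
  isPreconnected : ∀ a, IsPreconnected (U a)
  nonempty : ∀ a, (U a).Nonempty
  isBounded : ∀ a, Bornology.IsBounded (U a)
  cover : ∀ x, ∃ a, ({a} : Finset V) ∈ X.faces ∧ x ∈ U a
  meet : ∀ a b, X.Adj a b → (U a ∩ U b).Nonempty
  near : ∀ a b, ({a} : Finset V) ∈ X.faces → ({b} : Finset V) ∈ X.faces →
    (U a ∩ U b).Nonempty → b ∈ X.Ball a L
  finite : ∀ B : Set T, Bornology.IsBounded B →
    {a | ({a} : Finset V) ∈ X.faces ∧ (U a ∩ B).Nonempty}.Finite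

/-- Connectedness and triviality of cocycles at infinity pass from a space to a complex with
`6`-large links which is its coarse nerve. -/
theorem CoarseNerve.exists_trivOn_compl {X : SComplex V} {T : Type} [PseudoMetricSpace T]
    {U : V → Set T} {L : ℕ} (hU : X.CoarseNerve U L) (hX : X.VertexLarge) (ht : TrivOn X X)
    (hconn : ∀ a b, ({a} : Finset V) ∈ X.faces → ({b} : Finset V) ∈ X.faces → X.Joined a b)
    (hfin : ∀ a n, (X.Ball a n).Finite)
    (hT : ∀ B : Set T, Bornology.IsBounded B → ∃ C, Bornology.IsBounded C ∧ B ⊆ C ∧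
      IsPreconnected Cᶜ ∧ CocycleTriv Cᶜ) (F : Finset V) :
    ∃ F' : Finset V, F ⊆ F' ∧ (∀ a b, ({a} : Finset V) ∈ X.faces → ({b} : Finset V) ∈ X.faces →
      a ∉ F' → b ∉ F' → (X.restrict (F : Set V)ᶜ).Joined a b) ∧
      TrivOn (X.restrict (F : Set V)ᶜ) (X.restrict (F' : Set V)ᶜ) := by
  classical
  let R := L + L + 1
  let bad : Set V := ⋃ f ∈ F, X.Ball f R
  have hbad : bad.Finite := F.finite_toSet.biUnion fun f _ => hfin f R
  obtain ⟨C, hCb, hC, hCc, hCt⟩ := hT (⋃ a ∈ bad, U a)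
    ((Bornology.isBounded_biUnion hbad).2 fun a _ => hU.isBounded a)
  have hF' := hU.finite C hCb
  let F' : Finset V := F ∪ hF'.toFinset
  have hout : ∀ a, ({a} : Finset V) ∈ X.faces → a ∉ F' → U a ⊆ Cᶜ := by
    intro a ha haF x hx hxC
    refine haF (Finset.mem_union_right _ (hF'.mem_toFinset.2 ⟨ha, x, hx, hxC⟩))
  have hgood : ∀ a x, ({a} : Finset V) ∈ X.faces → x ∈ U a → x ∈ Cᶜ →
      X.Ball a R ⊆ (F : Set V)ᶜ := by
    intro a x ha hxa hxC b hb hbF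
    exact hxC (hC (mem_biUnion (mem_biUnion (show b ∈ (F : Set V) from hbF) (mem_ball_symm hb)) hxa))
  have hLR : ∀ a, ({a} : Finset V) ∈ X.faces → X.Ball a L ⊆ X.Ball a R := fun a ha =>
    ball_mono ha (by omega)
  refine ⟨F', Finset.subset_union_left, ?_, ?_⟩
  · intro a b ha hb haF hbF
    have key : ∀ x ∈ Cᶜ, ∀ v, ({v} : Finset V) ∈ X.faces → x ∈ U v →
        ((∃ w, ({w} : Finset V) ∈ X.faces ∧ x ∈ U w ∧ (X.restrict (F : Set V)ᶜ).Joined a w) ↔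
          (X.restrict (F : Set V)ᶜ).Joined a v) := by
      intro x hx v hv hxv
      refine ⟨fun ⟨w, hw, hxw, h⟩ => h.trans ?_, fun h => ⟨v, hv, hxv, h⟩⟩
      exact joined_restrict_of_ball hw ((hLR w hw).trans (hgood w x hw hxw hx))
        (hU.near w v hw hv ⟨x, hxw, hxv⟩)
    have hloc : LocConstOn (fun x => ∃ w, ({w} : Finset V) ∈ X.faces ∧ x ∈ U w ∧
        (X.restrict (F : Set V)ᶜ).Joined a w) Cᶜ := by
      intro x hx
      obtain ⟨v, hv, hxv⟩ := hU.cover x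
      rw [eventually_nhdsWithin_iff]
      filter_upwards [(hU.isOpen v).mem_nhds hxv] with y hy hyC
      exact propext ((key y hyC v hv hy).trans (key x hx v hv hxv).symm)
    obtain ⟨x, hx⟩ := hU.nonempty a
    obtain ⟨y, hy⟩ := hU.nonempty b
    have hxC := hout a ha haF hx
    have hyC := hout b hb hbF hy
    have h := hloc.eq_of_isPreconnected hCc subset_rfl hxC hyC
    exact (key y hyC b hb hy).1 (h ▸ (key x hxC a ha hx).2 .refl)
  · intro G _ c hc
    have hpot : ∀ a, ∃ h : V → G, X.Ball a R ⊆ (F : Set V)ᶜ → ({a} : Finset V) ∈ X.faces →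
        ∀ x ∈ X.Ball a R, ∀ y ∈ X.Ball a R, X.Adj x y → c x y = (h x)⁻¹ * h y := by
      intro a
      by_cases hg : X.Ball a R ⊆ (F : Set V)ᶜ ∧ ({a} : Finset V) ∈ X.faces
      · obtain ⟨h, hh⟩ := trivOn_ball hX ht (fun b hb => hconn a b hg.2 hb) R G c
          (fun x y z hf => hc x y z ⟨hf.1, fun v hv => hg.1 (hf.2 v hv)⟩)
        exact ⟨h, fun _ _ x hx y hy hxy => hh x y (restrict_adj.2 ⟨hxy, hx, hy⟩)⟩
      · exact ⟨fun _ => 1, fun h1 h2 => absurd ⟨h1, h2⟩ hg⟩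
    choose h hh using hpot
    obtain ⟨σ, h1, h2⟩ := hCt G V (fun a => if ({a} : Finset V) ∈ X.faces then U a else ∅)
      (fun a => by
        split_ifs
        · exact hU.isOpen a
        · exact isOpen_empty)
      (fun x _ => by
        obtain ⟨a, ha, hx⟩ := hU.cover x
        exact mem_iUnion.2 ⟨a, by rwa [if_pos ha]⟩)
      (fun a b => (h a a)⁻¹ * h a b) (by
        intro a b d x hx ha hb hd
        have va : ({a} : Finset V) ∈ X.faces := by by_contra hn; simp [hn] at ha
        have vb : ({b} : Finset V) ∈ X.faces := by by_contra hn; simp [hn] at hb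
        have vd : ({d} : Finset V) ∈ X.faces := by by_contra hn; simp [hn] at hd
        rw [if_pos va] at ha
        rw [if_pos vb] at hb
        rw [if_pos vd] at hd
        have sub : X.Ball b L ⊆ X.Ball a R := fun y hy =>
          ball_mono va (by omega) (ball_trans (hU.near a b va vb ⟨x, ha, hb⟩) hy)
        have := potential_unique (c := c) (h := h a) (h' := h b) vb (n := L) (b := d)
          (fun y hy z hz => hh a (hgood a x va ha hx) va y (sub hy) z (sub hz))
          (fun y hy z hz => hh b (hgood b x vb hb hx) vb y (hLR b vb hy) z (hLR b vb hz))
          (hU.near b d vb vd ⟨x, hb, hd⟩)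
        rw [← this]
        group)
    choose x hx using hU.nonempty
    refine ⟨fun a => σ a (x a), fun a b hab => ?_⟩
    obtain ⟨hab, haF, hbF⟩ := restrict_adj.1 hab
    have va := hab.left
    have vb := hab.symm.left
    have aC := hout a va haF
    have bC := hout b vb hbF
    obtain ⟨m, hma, hmb⟩ := hU.meet a b hab
    have ea := (h2 a).eq_of_isPreconnected (hU.isPreconnected a)
      (by rw [if_pos va]; exact subset_inter aC subset_rfl) (hx a) hma
    have eb := (h2 b).eq_of_isPreconnected (hU.isPreconnected b)
      (by rw [if_pos vb]; exact subset_inter bC subset_rfl) (hx b) hmb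
    have e := h1 a b m (aC hma) (by rwa [if_pos va]) (by rwa [if_pos vb])
    have hc' := hh a (hgood a (x a) va (hx a) (aC (hx a))) va a (self_mem_ball va R) b
      (ball_mono va (by omega) hab.mem_ball) hab
    beta_reduce
    rw [ea, eb, e, hc']
    group

end SComplex

namespace SComplex

open Set Chain Finsupp

variable {V : Type}

/-- The cochain vanishes on all (possibly empty) simplices disjoint from `W`. -/
def VanishOff (X : SComplex V) (α : Finset V → ZMod 2) (W : Set V) : Prop :=
  ∀ σ ∈ X.aug, (∀ v ∈ σ, v ∉ W) → α σ = 0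

theorem VanishOff.mono {X : SComplex V} {α : Finset V → ZMod 2} {W W' : Set V}
    (h : X.VanishOff α W) (hW : W ⊆ W') : X.VanishOff α W' :=
  fun σ hσ hv => h σ hσ fun v hvσ hvW => hv v hvσ (hW hvW)

theorem VanishOff.empty {X : SComplex V} {α : Finset V → ZMod 2} {W : Set V}
    (h : X.VanishOff α W) : α ∅ = 0 :=
  h ∅ (Or.inr rfl) (by simp)

theorem restrict_compl_aug {X : SComplex V} {W : Set V} {σ : Finset V} :
    σ ∈ (X.restrict Wᶜ).aug ↔ σ ∈ X.aug ∧ ∀ v ∈ σ, v ∉ W := by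
  constructor
  · rintro (h | rfl)
    · exact ⟨Or.inl h.1, h.2⟩
    · exact ⟨Or.inr rfl, by simp⟩
  · rintro ⟨h | rfl, h'⟩
    · exact Or.inl ⟨h, h'⟩
    · exact Or.inr rfl

variable [DecidableEq V]

theorem exists_dual_of_cycles (C : Set (Finset V)) (A : Chain V →ₗ[ZMod 2] ZMod 2)
    (h : ∀ z ∈ on C, bd z = 0 → A z = 0) :
    ∃ B : Chain V →ₗ[ZMod 2] ZMod 2, ∀ z ∈ on C, B (bd z) = A z := by
  let f : on C →ₗ[ZMod 2] Chain V := bd ∘ₗ (on C).subtype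
  have hA : (A ∘ₗ (on C).subtype : Module.Dual (ZMod 2) (on C)) ∈ LinearMap.range f.dualMap := by
    rw [LinearMap.range_dualMap_eq_dualAnnihilator_ker, Submodule.mem_dualAnnihilator]
    intro z hz
    exact h z z.2 hz
  obtain ⟨B, hB⟩ := hA
  exact ⟨B, fun z hz => LinearMap.congr_fun hB ⟨z, hz⟩⟩

/-- The cochain satisfies the cocycle condition on all simplices. -/
def IsClosedCochain (X : SComplex V) (α : Finset V → ZMod 2) : Prop :=
  ∀ σ ∈ X.faces, ∑ v ∈ σ, α (σ.erase v) = 0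

/-- Cohomology with finite supports vanishes. -/
theorem exists_primitive {X : SComplex V} (hX : X.VertexLarge) (ht : TrivOn X X)
    (hconn : ∀ a b, ({a} : Finset V) ∈ X.faces → ({b} : Finset V) ∈ X.faces → X.Joined a b)
    {F F' : Finset V} (hFF : F ⊆ F') {u : V} (hu : ({u} : Finset V) ∈ X.faces) (huF : u ∉ F')
    (hj : ∀ a b, ({a} : Finset V) ∈ X.faces → ({b} : Finset V) ∈ X.faces →
      a ∉ F' → b ∉ F' → (X.restrict (F : Set V)ᶜ).Joined a b)
    (htF : TrivOn (X.restrict (F : Set V)ᶜ) (X.restrict (F' : Set V)ᶜ))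
    {α : Finset V → ZMod 2} (hα : X.IsClosedCochain α) (hαF : X.VanishOff α F) :
    ∃ β : Finset V → ZMod 2, X.VanishOff β F' ∧
      ∀ σ ∈ X.faces, ∑ v ∈ σ, β (σ.erase v) = α σ := by
  let A : Chain V →ₗ[ZMod 2] ZMod 2 := linearCombination (ZMod 2) α
  have hA : ∀ σ, A (single σ 1) = α σ := fun σ => by simp [A, linearCombination_single]
  have hAbd : ∀ w ∈ on X.aug, A (bd w) = 0 := by
    intro w hw
    have : (A ∘ₗ bd) w ∈ (⊥ : Submodule (ZMod 2) (ZMod 2)) := by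
      refine map_mem_of_single _ ?_ hw
      rintro σ (hσ | rfl)
      · simp only [LinearMap.comp_apply, bd_single, map_sum, hA, Submodule.mem_bot]
        exact hα σ hσ
      · simp [bd_single]
    simpa using this
  obtain ⟨B, hB⟩ := exists_dual_of_cycles X.aug A (by
    intro z hz hbz
    obtain ⟨w, hw, rfl⟩ := exists_bd_of_trivOn hX hu ht subset_rfl
      (fun a ha => hconn u a hu ha) hz hbz
    exact hAbd w hw)
  have hBK : ∀ w ∈ on (X.restrict (F : Set V)ᶜ).aug, B (bd w) = 0 := by
    intro w hw
    rw [hB w (supported_mono (fun σ hσ => (restrict_compl_aug.1 hσ).1) hw)]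
    have : A w ∈ (⊥ : Submodule (ZMod 2) (ZMod 2)) := by
      refine map_mem_of_single _ (fun σ hσ => ?_) hw
      rw [hA, Submodule.mem_bot]
      exact hαF σ (restrict_compl_aug.1 hσ).1 (restrict_compl_aug.1 hσ).2
    simpa using this
  obtain ⟨C, hC⟩ := exists_dual_of_cycles (X.restrict (F' : Set V)ᶜ).aug B (by
    intro z hz hbz
    obtain ⟨w, hw, rfl⟩ := exists_bd_of_trivOn (hX.restrict _) (u := u)
      ⟨hu, fun v hv => by
        rw [Finset.mem_singleton.1 hv]; exact fun h => huF (hFF h)⟩ htF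
      (fun σ hσ => ⟨hσ.1, fun v hv h => hσ.2 v hv (hFF h)⟩)
      (fun a ha => hj u a hu ha.1 huF (ha.2 a (by simp))) hz hbz
    exact hBK w hw)
  refine ⟨fun σ => B (single σ 1) - C (bd (single σ 1)), ?_, ?_⟩
  · intro σ hσ hv
    beta_reduce
    rw [hC _ (single_mem_on (restrict_compl_aug.2 ⟨hσ, hv⟩)), sub_self]
  · intro σ hσ
    rw [← hA, ← hB _ (single_mem_on (Or.inl hσ)), Finset.sum_sub_distrib, ← map_sum, ← map_sum,
      ← map_sum, ← bd_single, bd_bd, map_zero, sub_zero]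

theorem image_smul_erase {G : Type} [Group G] [MulAction G V] (g : G) (σ : Finset V) (v : V) :
    (σ.erase v).image (fun w => g • w) = (σ.image fun w => g • w).erase (g • v) :=
  Finset.image_erase (MulAction.injective g) σ v

theorem smul_mem_ball {G : Type} [Group G] [MulAction G V] {X : SComplex V}
    (hG : X.IsSimplicialAction G) (g : G) {a b : V} {n : ℕ} (h : b ∈ X.Ball a n) :
    g • b ∈ X.Ball (g • a) n := by
  induction n generalizing b with
  | zero => rw [mem_singleton_iff.1 h]; rfl
  | succ n ih =>
    obtain ⟨c, hc, hb⟩ := h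
    refine ⟨g • c, ih hc, ?_⟩
    have := hG g _ hb
    rwa [Finset.image_insert, Finset.image_singleton] at this

theorem smul_mem_ball_iff {G : Type} [Group G] [MulAction G V] {X : SComplex V}
    (hG : X.IsSimplicialAction G) (g : G) {a b : V} {n : ℕ} :
    g • b ∈ X.Ball (g • a) n ↔ b ∈ X.Ball a n :=
  ⟨fun h => by simpa using smul_mem_ball hG g⁻¹ h, smul_mem_ball hG g⟩

theorem exists_mem_ball {X : SComplex V} {a b : V} (h : X.Joined a b) : ∃ n, b ∈ X.Ball a n := by
  induction h with
  | refl => exact ⟨0, rfl⟩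
  | tail _ h ih => obtain ⟨n, hn⟩ := ih; exact ⟨n + 1, _, hn, h⟩

/-- Primitives of finitely supported cocycles can be chosen with uniformly controlled support. -/
theorem exists_primitive_uniform {G : Type} [Group G] [MulAction G V] {X : SComplex V}
    (hG : X.IsSimplicialAction G) {V₀ : Set V} (hV₀ : V₀.Finite)
    (hV₀' : ∀ v, ({v} : Finset V) ∈ X.faces → ∃ g : G, ∃ w ∈ V₀, v = g • w)
    (hX : X.VertexLarge) (ht : TrivOn X X)
    (hconn : ∀ a b, ({a} : Finset V) ∈ X.faces → ({b} : Finset V) ∈ X.faces → X.Joined a b)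
    (hfin : ∀ a n, (X.Ball a n).Finite) (hinf : X.vertexSet.Infinite)
    (hend : ∀ F : Finset V, ∃ F' : Finset V, F ⊆ F' ∧ (∀ a b, ({a} : Finset V) ∈ X.faces →
      ({b} : Finset V) ∈ X.faces → a ∉ F' → b ∉ F' → (X.restrict (F : Set V)ᶜ).Joined a b) ∧
      TrivOn (X.restrict (F : Set V)ᶜ) (X.restrict (F' : Set V)ᶜ)) (r : ℕ) :
    ∃ r', ∀ v, ({v} : Finset V) ∈ X.faces → ∀ α : Finset V → ZMod 2, X.IsClosedCochain α →
      X.VanishOff α (X.Ball v r) → ∃ β : Finset V → ZMod 2, X.VanishOff β (X.Ball v r') ∧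
        ∀ σ ∈ X.faces, ∑ v ∈ σ, β (σ.erase v) = α σ := by
  have one : ∀ w, ∃ r', ({w} : Finset V) ∈ X.faces → ∀ α : Finset V → ZMod 2,
      X.IsClosedCochain α → X.VanishOff α (X.Ball w r) →
      ∃ β : Finset V → ZMod 2, X.VanishOff β (X.Ball w r') ∧
        ∀ σ ∈ X.faces, ∑ v ∈ σ, β (σ.erase v) = α σ := by
    intro w
    by_cases hw : ({w} : Finset V) ∈ X.faces
    swap
    · exact ⟨0, fun h => absurd h hw⟩
    obtain ⟨F', hFF, hj, htF⟩ := hend (hfin w r).toFinset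
    obtain ⟨u, hu, huF⟩ := hinf.exists_notMem_finset F'
    have hr : ∀ v, ∃ n, ({v} : Finset V) ∈ X.faces → v ∈ X.Ball w n := by
      intro v
      by_cases hv : ({v} : Finset V) ∈ X.faces
      · obtain ⟨n, hn⟩ := exists_mem_ball (hconn w v hw hv)
        exact ⟨n, fun _ => hn⟩
      · exact ⟨0, fun h => absurd h hv⟩
    choose n hn using hr
    refine ⟨F'.sup n, fun _ α hα hαF => ?_⟩
    obtain ⟨β, hβ, hβα⟩ := exists_primitive hX ht hconn hFF hu huF hj htF hα
      (by rwa [Set.Finite.coe_toFinset])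
    refine ⟨β, fun σ hσ hv => hβ σ hσ fun v hvσ hvF => ?_, hβα⟩
    rcases hσ with hσ | rfl
    · exact hv v hvσ (ball_mono hw (Finset.le_sup hvF) (hn v (singleton_mem hσ hvσ)))
    · simp at hvσ
  choose n hn using one
  refine ⟨hV₀.toFinset.sup n, fun v hv₁ α hα hαv => ?_⟩
  obtain ⟨g, w, hw, rfl⟩ := hV₀' v hv₁
  have hwX : ({w} : Finset V) ∈ X.faces := by
    have := hG g⁻¹ _ hv₁
    simpa using this
  have haug : ∀ (g : G) σ, σ ∈ X.aug → σ.image (fun w => g • w) ∈ X.aug := by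
    rintro g σ (hσ | rfl)
    · exact Or.inl (hG g σ hσ)
    · exact Or.inr (by simp)
  have hsum : ∀ (g : G) (f : Finset V → ZMod 2) (σ : Finset V),
      ∑ v ∈ σ, f ((σ.erase v).image fun w => g • w) =
        ∑ v ∈ σ.image (fun w => g • w), f ((σ.image fun w => g • w).erase v) := by
    intro g f σ
    rw [Finset.sum_image (MulAction.injective g).injOn]
    exact Finset.sum_congr rfl fun v _ => by rw [image_smul_erase]
  obtain ⟨β, hβ, hβα⟩ := hn w hwX (fun σ => α (σ.image fun w => g • w))
    (fun σ hσ => by rw [hsum g α σ]; exact hα _ (hG g σ hσ))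
    (fun σ hσ hv => by
      refine hαv _ (haug g σ hσ) fun x hx => ?_
      obtain ⟨y, hy, rfl⟩ := Finset.mem_image.1 hx
      rw [smul_mem_ball_iff hG]
      exact hv y hy)
  refine ⟨fun σ => β (σ.image fun w => g⁻¹ • w), ?_, ?_⟩
  · intro σ hσ hv
    refine hβ _ (haug _ _ hσ) fun x hx hxw => ?_
    obtain ⟨y, hy, rfl⟩ := Finset.mem_image.1 hx
    refine hv y hy ?_
    have := smul_mem_ball hG g hxw
    rw [smul_inv_smul] at this
    exact ball_mono hv₁ (Finset.le_sup (hV₀.mem_toFinset.2 hw)) this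
  · intro σ hσ
    rw [hsum g⁻¹ β σ, hβα _ (hG g⁻¹ σ hσ), Finset.image_image]
    congr 1
    conv_rhs => rw [← Finset.image_id (s := σ)]
    exact Finset.image_congr fun a _ => smul_inv_smul g a

end SComplex

namespace SComplex

open Set

theorem sum_sum_eq_zero_of_symm {V : Type} {s : Finset V} {t : V → Finset V} {f : V → V → ZMod 2}
    (hf : ∀ a b, f a b = f b a) (h : ∀ a ∈ s, ∀ b ∈ t a, b ∈ s ∧ a ∈ t b)
    (ht : ∀ a ∈ s, a ∉ t a) : ∑ a ∈ s, ∑ b ∈ t a, f a b = 0 := by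
  rw [Finset.sum_sigma']
  refine Finset.sum_involution (fun x _ => ⟨x.2, x.1⟩) ?_ ?_ ?_ ?_
  · rintro ⟨a, b⟩ -
    rw [hf a b, CharTwo.add_self_eq_zero]
  · rintro ⟨a, b⟩ hx - heq
    have hba : b = a := congrArg Sigma.fst heq
    subst hba
    rw [Finset.mem_sigma] at hx
    exact ht _ hx.1 hx.2
  · rintro ⟨a, b⟩ hx
    rw [Finset.mem_sigma] at hx ⊢
    exact h a hx.1 b hx.2
  · rintro ⟨a, b⟩ -
    rfl

variable {V : Type} [DecidableEq V]

/-- A family of cochains `s σ`, supported near `σ`, contracting the cochain complex in degrees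
above `k`. -/
def HasContraction (X : SComplex V) (cof : Finset V → Finset V) (k : ℕ) : Prop :=
  ∃ (r : ℕ) (s : Finset V → Finset V → ZMod 2), ∀ σ ∈ X.faces, k ≤ σ.card →
    (∀ v ∈ σ, X.VanishOff (s σ) (X.Ball v r)) ∧ ∀ τ ∈ X.faces,
      ∑ w ∈ τ, s σ (τ.erase w) + ∑ v ∈ cof σ, s (insert v σ) τ = if τ = σ then 1 else 0

theorem HasContraction.pred {X : SComplex V} {cof : Finset V → Finset V}
    (hcof : ∀ σ ∈ X.faces, ∀ v, v ∈ cof σ ↔ v ∉ σ ∧ insert v σ ∈ X.faces)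
    (hprim : ∀ r, ∃ r', ∀ v, ({v} : Finset V) ∈ X.faces → ∀ α : Finset V → ZMod 2,
      X.IsClosedCochain α → X.VanishOff α (X.Ball v r) →
      ∃ β : Finset V → ZMod 2, X.VanishOff β (X.Ball v r') ∧
        ∀ σ ∈ X.faces, ∑ v ∈ σ, β (σ.erase v) = α σ)
    {k : ℕ} (h : X.HasContraction cof (k + 1)) : X.HasContraction cof k := by
  obtain ⟨r, s, hs⟩ := h
  obtain ⟨r', hr'⟩ := hprim r
  have key : ∀ σ, ∃ β : Finset V → ZMod 2, σ ∈ X.faces → σ.card = k →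
      (∀ v ∈ σ, X.VanishOff β (X.Ball v (max r (r' + 1)))) ∧ ∀ τ ∈ X.faces,
        ∑ w ∈ τ, β (τ.erase w) + ∑ v ∈ cof σ, s (insert v σ) τ = if τ = σ then 1 else 0 := by
    intro σ
    by_cases hσ : σ ∈ X.faces ∧ σ.card = k
    swap
    · exact ⟨0, fun h₁ h₂ => absurd ⟨h₁, h₂⟩ hσ⟩
    obtain ⟨hσ, hk⟩ := hσ
    obtain ⟨v₀, hv₀⟩ := X.nonempty_of_mem σ hσ
    have hins : ∀ v ∈ cof σ, insert v σ ∈ X.faces ∧ k + 1 ≤ (insert v σ).card := by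
      intro v hv
      obtain ⟨h₁, h₂⟩ := (hcof σ hσ v).1 hv
      exact ⟨h₂, by rw [Finset.card_insert_of_notMem h₁, hk]⟩
    let α : Finset V → ZMod 2 := fun τ =>
      (if τ = σ then 1 else 0) + ∑ v ∈ cof σ, s (insert v σ) τ
    have hα : X.IsClosedCochain α := by
      intro τ hτ
      have h₁ : ∑ w ∈ τ, (if τ.erase w = σ then (1 : ZMod 2) else 0) =
          ∑ v ∈ cof σ, if τ = insert v σ then 1 else 0 := by
        rw [Finset.sum_boole, Finset.sum_boole]
        congr 2
        ext w
        simp only [Finset.mem_filter, hcof σ hσ]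
        constructor
        · rintro ⟨hw, rfl⟩
          rw [Finset.insert_erase hw]
          exact ⟨⟨Finset.notMem_erase w τ, hτ⟩, rfl⟩
        · rintro ⟨⟨hw, -⟩, rfl⟩
          exact ⟨Finset.mem_insert_self w σ, Finset.erase_insert hw⟩
      have h₂ : ∑ v ∈ cof σ, ∑ u ∈ cof (insert v σ), s (insert u (insert v σ)) τ = 0 := by
        refine sum_sum_eq_zero_of_symm (f := fun v u => s (insert u (insert v σ)) τ)
          (fun a b => by rw [Finset.insert_comm]) ?_ ?_
        · intro a ha b hb
          obtain ⟨ha₁, ha₂⟩ := (hcof σ hσ a).1 ha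
          obtain ⟨hb₁, hb₂⟩ := (hcof _ ha₂ b).1 hb
          rw [Finset.mem_insert, not_or] at hb₁
          rw [Finset.insert_comm] at hb₂
          have hb₃ : insert b σ ∈ X.faces :=
            X.down_closed _ hb₂ _ (Finset.subset_insert a _) (Finset.insert_nonempty _ _)
          refine ⟨(hcof σ hσ b).2 ⟨hb₁.2, hb₃⟩, (hcof _ hb₃ a).2 ⟨?_, ?_⟩⟩
          · rw [Finset.mem_insert, not_or]
            exact ⟨Ne.symm hb₁.1, ha₁⟩
          · exact hb₂
        · intro a ha haa
          obtain ⟨-, ha₂⟩ := (hcof σ hσ a).1 ha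
          exact ((hcof _ ha₂ a).1 haa).1 (Finset.mem_insert_self a σ)
      simp only [α, Finset.sum_add_distrib]
      rw [h₁, Finset.sum_comm, ← Finset.sum_add_distrib]
      refine Eq.trans ?_ h₂
      refine Finset.sum_congr rfl fun v hv => ?_
      rw [← (hs _ (hins v hv).1 (hins v hv).2).2 τ hτ, add_right_comm,
        CharTwo.add_self_eq_zero, zero_add]
    have hv₀X := singleton_mem hσ hv₀
    have hαv : X.VanishOff α (X.Ball v₀ r) := by
      intro ρ hρ hv
      have : ρ ≠ σ := by
        rintro rfl
        exact hv v₀ hv₀ (self_mem_ball hv₀X r)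
      simp only [α, if_neg this, zero_add]
      exact Finset.sum_eq_zero fun v hvc => (hs _ (hins v hvc).1 (hins v hvc).2).1 v₀
        (Finset.mem_insert_of_mem hv₀) ρ hρ hv
    obtain ⟨β, hβ, hβα⟩ := hr' v₀ hv₀X α hα hαv
    refine ⟨β, fun _ _ => ⟨fun v hv => hβ.mono fun u hu => ?_, fun τ hτ => ?_⟩⟩
    · have hadj : X.Adj v v₀ := X.down_closed _ hσ _
        (Finset.insert_subset hv (Finset.singleton_subset_iff.2 hv₀)) (Finset.insert_nonempty _ _)
      refine ball_mono (singleton_mem hσ hv) (le_max_right _ _) ?_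
      rw [add_comm]
      exact ball_trans hadj.mem_ball hu
    · rw [hβα τ hτ]
      simp only [α]
      rw [add_assoc, CharTwo.add_self_eq_zero, add_zero]
  choose β hβ using key
  refine ⟨max r (r' + 1), fun σ => if σ.card = k then β σ else s σ, fun σ hσ hk => ?_⟩
  have hne : ∀ v ∈ cof σ, (insert v σ).card ≠ k := by
    intro v hv
    rw [Finset.card_insert_of_notMem ((hcof σ hσ v).1 hv).1]
    omega
  have hsum : ∀ τ, ∑ v ∈ cof σ, (if (insert v σ).card = k then β (insert v σ)
      else s (insert v σ)) τ = ∑ v ∈ cof σ, s (insert v σ) τ := fun τ =>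
    Finset.sum_congr rfl fun v hv => by rw [if_neg (hne v hv)]
  simp only [hsum]
  by_cases hk' : σ.card = k
  · simp only [hk', if_true]
    exact hβ σ hσ hk'
  · simp only [hk', if_false]
    obtain ⟨h₁, h₂⟩ := hs σ hσ (by omega)
    exact ⟨fun v hv => (h₁ v hv).mono (ball_mono (singleton_mem hσ hv) (le_max_left _ _)), h₂⟩

theorem not_hasContraction_one {X : SComplex V} {cof : Finset V → Finset V}
    (hcof : ∀ σ ∈ X.faces, ∀ v, v ∈ cof σ ↔ v ∉ σ ∧ insert v σ ∈ X.faces)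
    (hfin : ∀ a n, (X.Ball a n).Finite) {v₀ : V} (hv₀ : ({v₀} : Finset V) ∈ X.faces) :
    ¬ X.HasContraction cof 1 := by
  rintro ⟨r, s, hs⟩
  let B := (hfin v₀ r).toFinset
  have hB : ∀ v, v ∈ B ↔ v ∈ X.Ball v₀ r := fun v => (hfin v₀ r).mem_toFinset
  have hBX : ∀ v ∈ B, ({v} : Finset V) ∈ X.faces :=
    fun v hv => singleton_mem_of_mem_ball hv₀ ((hB v).1 hv)
  have hone : ∀ v ∈ B, ∑ u ∈ (cof {v}).filter (· ∈ B), s (insert u {v}) {v₀} =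
      if v₀ = v then 1 else 0 := by
    intro v hv
    obtain ⟨h₁, h₂⟩ := hs {v} (hBX v hv) (by simp)
    have h₃ := h₂ {v₀} hv₀
    have h₀ : s {v} ∅ = 0 := (h₁ v (Finset.mem_singleton_self v)).empty
    simp only [Finset.sum_singleton, Finset.erase_singleton, h₀, zero_add,
      Finset.singleton_inj] at h₃
    rw [← h₃]
    refine Finset.sum_filter_of_ne fun u hu hne => (hB u).2 (mem_ball_symm ?_)
    obtain ⟨hu₁, hu₂⟩ := (hcof _ (hBX v hv) u).1 hu
    by_contra hcon
    refine hne ((hs _ hu₂ (Finset.card_pos.2 (Finset.insert_nonempty _ _))).1 u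
      (Finset.mem_insert_self _ _) _ (Or.inl hv₀) fun x hx => ?_)
    rwa [Finset.mem_singleton.1 hx]
  have htot := Finset.sum_congr rfl hone
  rw [Finset.sum_ite_eq, if_pos ((hB v₀).2 (self_mem_ball hv₀ r))] at htot
  refine zero_ne_one (α := ZMod 2) (htot ▸ (sum_sum_eq_zero_of_symm
    (f := fun v u => s (insert u {v}) {v₀}) (fun a b => by rw [Finset.pair_comm]) ?_ ?_).symm)
  · intro a ha b hb
    obtain ⟨hb, hbB⟩ := Finset.mem_filter.1 hb
    obtain ⟨h₁, h₂⟩ := (hcof _ (hBX a ha) b).1 hb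
    refine ⟨hbB, Finset.mem_filter.2 ⟨(hcof _ (hBX b hbB) a).2 ⟨?_, ?_⟩, ha⟩⟩
    · rw [Finset.mem_singleton] at h₁ ⊢
      exact Ne.symm h₁
    · rw [Finset.pair_comm]
      exact h₂
  · intro a ha haa
    exact ((hcof _ (hBX a ha) a).1 (Finset.mem_filter.1 haa).1).1 (Finset.mem_singleton_self a)

/-- Uniform vanishing of compactly supported cohomology is impossible in a finite-dimensional
locally finite complex. -/
theorem false_of_exists_primitive {X : SComplex V} (hfin : ∀ a n, (X.Ball a n).Finite) {N : ℕ}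
    (hN : ∀ σ ∈ X.faces, σ.card ≤ N) {v₀ : V} (hv₀ : ({v₀} : Finset V) ∈ X.faces)
    (hprim : ∀ r, ∃ r', ∀ v, ({v} : Finset V) ∈ X.faces → ∀ α : Finset V → ZMod 2,
      X.IsClosedCochain α → X.VanishOff α (X.Ball v r) →
      ∃ β : Finset V → ZMod 2, X.VanishOff β (X.Ball v r') ∧
        ∀ σ ∈ X.faces, ∑ v ∈ σ, β (σ.erase v) = α σ) : False := by
  have hcof : ∀ σ : Finset V, ∃ c : Finset V, σ ∈ X.faces →
      ∀ v, v ∈ c ↔ v ∉ σ ∧ insert v σ ∈ X.faces := by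
    intro σ
    by_cases hσ : σ ∈ X.faces
    swap
    · exact ⟨∅, fun h => absurd h hσ⟩
    obtain ⟨a, ha⟩ := X.nonempty_of_mem σ hσ
    have : {v | v ∉ σ ∧ insert v σ ∈ X.faces}.Finite := by
      refine (hfin a 1).subset fun v hv => Adj.mem_ball ?_
      refine X.down_closed _ hv.2 _ ?_ (Finset.insert_nonempty _ _)
      rw [Finset.pair_comm]
      exact Finset.insert_subset_insert _ (Finset.singleton_subset_iff.2 ha)
    exact ⟨this.toFinset, fun _ v => by rw [this.mem_toFinset]; rfl⟩
  choose cof hcof using hcof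
  have hk : ∀ j, X.HasContraction cof (N + 1 - j) := by
    intro j
    induction j with
    | zero =>
      refine ⟨0, fun _ _ => 0, fun σ hσ h => ?_⟩
      have := hN σ hσ
      omega
    | succ j ih =>
      by_cases h : j < N + 1
      · refine HasContraction.pred hcof hprim ?_
        rwa [show N + 1 - (j + 1) + 1 = N + 1 - j by omega]
      · rwa [show N + 1 - (j + 1) = N + 1 - j by omega]
  have := hk N
  rw [Nat.add_sub_cancel_left] at this
  exact not_hasContraction_one hcof hfin hv₀ this

end SComplex

namespace SComplex

open Set Metric Bornology

variable {V : Type} [DecidableEq V] {G : Type} [Group G] [MulAction G V] {X : SComplex V}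

theorem IsSimplicialAction.smul_singleton_mem (hG : X.IsSimplicialAction G) (g : G) {v : V}
    (hv : ({v} : Finset V) ∈ X.faces) : ({g • v} : Finset V) ∈ X.faces := by
  simpa using hG g _ hv

theorem HasFiniteStabilizers.finite_smul_eq (hst : X.HasFiniteStabilizers G) {v : V}
    (hv : ({v} : Finset V) ∈ X.faces) (w : V) : {g : G | g • v = w}.Finite := by
  rcases eq_empty_or_nonempty {g : G | g • v = w} with h | ⟨g₀, hg₀⟩
  · rw [h]
    exact finite_empty
  · refine ((hst _ hv).image (g₀ * ·)).subset fun g hg => ⟨g₀⁻¹ * g, ?_, mul_inv_cancel_left _ _⟩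
    have h₁ : g₀ • v = w := hg₀
    have h₂ : g • v = w := hg
    simp only [mem_ofPred_eq, Finset.image_singleton, Finset.singleton_inj, mul_smul]
    rw [h₂, ← h₁, inv_smul_smul]

theorem IsCocompactSAction.exists_vertices (hG : X.IsSimplicialAction G)
    (h : X.IsCocompactSAction G) :
    ∃ V₀ : Set V, V₀.Finite ∧ (∀ v ∈ V₀, ({v} : Finset V) ∈ X.faces) ∧
      ∀ σ ∈ X.faces, ∃ g : G, ∀ v ∈ σ, ∃ w ∈ V₀, v = g • w := by
  obtain ⟨S, hS, h⟩ := h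
  refine ⟨(⋃ σ ∈ S, (σ : Set V)) ∩ X.vertexSet,
    (hS.biUnion fun σ _ => σ.finite_toSet).inter_of_left _, fun v hv => hv.2, fun σ hσ => ?_⟩
  obtain ⟨τ, hτ, g, rfl⟩ := h σ hσ
  refine ⟨g, fun v hv => ?_⟩
  obtain ⟨w, hw, rfl⟩ := Finset.mem_image.1 hv
  refine ⟨w, ⟨mem_biUnion hτ hw, ?_⟩, rfl⟩
  have := hG.smul_singleton_mem g⁻¹ (singleton_mem hσ hv)
  rwa [inv_smul_smul] at this

theorem IsCocompactSAction.exists_card_le (h : X.IsCocompactSAction G) :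
    ∃ N, ∀ σ ∈ X.faces, σ.card ≤ N := by
  obtain ⟨S, hS, h⟩ := h
  refine ⟨hS.toFinset.sup Finset.card, fun σ hσ => ?_⟩
  obtain ⟨τ, hτ, g, rfl⟩ := h σ hσ
  exact Finset.card_image_le.trans (Finset.le_sup (f := Finset.card) (hS.mem_toFinset.2 hτ))

theorem finite_adj (hst : X.HasFiniteStabilizers G) {V₀ : Set V} (hV₀ : V₀.Finite)
    (hV₀X : ∀ v ∈ V₀, ({v} : Finset V) ∈ X.faces)
    (h : ∀ σ ∈ X.faces, ∃ g : G, ∀ v ∈ σ, ∃ w ∈ V₀, v = g • w) (a : V) :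
    {b | X.Adj a b}.Finite := by
  refine (hV₀.biUnion fun w hw => (hst.finite_smul_eq (hV₀X w hw) a).biUnion
    fun g _ => hV₀.image (g • ·)).subset fun b hb => ?_
  obtain ⟨g, hg⟩ := h _ hb
  obtain ⟨w, hw, hwa⟩ := hg a (by simp)
  obtain ⟨u, hu, rfl⟩ := hg b (by simp)
  simp only [mem_iUnion]
  exact ⟨w, hw, g, hwa.symm, u, hu, rfl⟩

theorem finite_ball (h : ∀ a, {b | X.Adj a b}.Finite) (a : V) (n : ℕ) : (X.Ball a n).Finite := by
  induction n with
  | zero => exact finite_singleton a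
  | succ n ih =>
    refine (ih.biUnion fun c _ => h c).subset fun b hb => ?_
    obtain ⟨c, hc, hb⟩ := hb
    exact mem_biUnion hc hb

/-- Milnor–Švarc: a proper cocompact action on a Euclidean space of a group that acts geometrically
on a complex exhibits the complex as a coarse nerve of the space. -/
theorem exists_coarseNerve {n : ℕ} [MulAction G (Fin n → ℝ)]
    (hcont : ∀ g : G, Continuous fun x : Fin n → ℝ => g • x)
    (hprop : ∀ r, {g : G | ∃ x ∈ closedBall (0 : Fin n → ℝ) r, g • x ∈ closedBall 0 r}.Finite)
    (hcc : ∃ r, ∀ x : Fin n → ℝ, ∃ g : G, g • x ∈ closedBall 0 r)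
    (hG : X.IsSimplicialAction G) (hst : X.HasFiniteStabilizers G)
    {V₀ : Set V} (hV₀ : V₀.Finite) (hV₀X : ∀ v ∈ V₀, ({v} : Finset V) ∈ X.faces)
    (hV₀' : ∀ v, ({v} : Finset V) ∈ X.faces → ∃ g : G, ∃ w ∈ V₀, v = g • w)
    (hconn : ∀ a b, ({a} : Finset V) ∈ X.faces → ({b} : Finset V) ∈ X.faces → X.Joined a b)
    (hfin : ∀ a n, (X.Ball a n).Finite) (hne : V₀.Nonempty) :
    ∃ (U : V → Set (Fin n → ℝ)) (L : ℕ), X.CoarseNerve U L := by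
  obtain ⟨r₀, hr₀⟩ := hcc
  have hγ : ∀ a, ∃ g : G, ({a} : Finset V) ∈ X.faces → ∃ w ∈ V₀, a = g • w := by
    intro a
    by_cases ha : ({a} : Finset V) ∈ X.faces
    · obtain ⟨g, h⟩ := hV₀' a ha
      exact ⟨g, fun _ => h⟩
    · exact ⟨1, fun h => absurd h ha⟩
  choose γ hγ using hγ
  let D : Set G := ⋃ v ∈ V₀, ⋃ w ∈ V₀, {g | g • w ∈ X.Ball v 1}
  have hD : D.Finite := hV₀.biUnion fun v _ => hV₀.biUnion fun w hw =>
    ((hfin v 1).biUnion fun u _ => hst.finite_smul_eq (hV₀X w hw) u).subset fun g hg =>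
      mem_biUnion (x := g • w) hg rfl
  have hmemD : ∀ g v w, v ∈ V₀ → w ∈ V₀ → g • w ∈ X.Ball v 1 → g ∈ D := by
    intro g v w hv hw h
    simp only [D, mem_iUnion]
    exact ⟨v, hv, w, hw, h⟩
  have himg : ∀ (g : G) r, IsBounded ((fun x : Fin n → ℝ => g • x) '' closedBall 0 r) :=
    fun g r => ((isCompact_closedBall 0 r).image (hcont g)).isBounded
  obtain ⟨r, hr, hrB⟩ : ∃ r, 0 < r ∧ ((⋃ g ∈ D, (fun x : Fin n → ℝ => g • x) '' closedBall 0 0) ∪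
      ⋃ g ∈ D, (fun x : Fin n → ℝ => g⁻¹ • x) '' closedBall 0 r₀) ⊆ Metric.ball 0 r := by
    have hb := ((isBounded_biUnion hD).2 fun g _ => himg g 0).union
      ((isBounded_biUnion hD).2 fun g _ => himg g⁻¹ r₀)
    obtain ⟨r, hr, h⟩ := hb.subset_ball_lt 0 0
    exact ⟨r, hr, h⟩
  have hE := hprop r
  have hn : ∀ v b, ∃ m, ({v} : Finset V) ∈ X.faces → ({b} : Finset V) ∈ X.faces →
      b ∈ X.Ball v m := by
    intro v b
    by_cases h : ({v} : Finset V) ∈ X.faces ∧ ({b} : Finset V) ∈ X.faces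
    · obtain ⟨m, hm⟩ := exists_mem_ball (hconn v b h.1 h.2)
      exact ⟨m, fun _ _ => hm⟩
    · exact ⟨0, fun h₁ h₂ => absurd ⟨h₁, h₂⟩ h⟩
  choose m hm using hn
  let L := hE.toFinset.sup fun g => hV₀.toFinset.sup fun v => hV₀.toFinset.sup fun w => m v (g • w)
  have hL : ∀ (g : G) v w, v ∈ V₀ → w ∈ V₀ → (∃ x ∈ Metric.ball (0 : Fin n → ℝ) r, g • x ∈ Metric.ball 0 r) →
      g • w ∈ X.Ball v L := by
    rintro g v w hv hw ⟨x, hx, hgx⟩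
    refine ball_mono (hV₀X v hv) ?_ (hm v (g • w) (hV₀X v hv)
      (hG.smul_singleton_mem g (hV₀X w hw)))
    refine le_trans ?_ (Finset.le_sup (hE.mem_toFinset.2
      ⟨x, ball_subset_closedBall hx, ball_subset_closedBall hgx⟩))
    refine le_trans ?_ (Finset.le_sup (hV₀.mem_toFinset.2 hv))
    exact Finset.le_sup (f := fun w => m v (g • w)) (hV₀.mem_toFinset.2 hw)
  have hmemU : ∀ a x, x ∈ (fun x : Fin n → ℝ => γ a • x) '' Metric.ball 0 r ↔
      (γ a)⁻¹ • x ∈ Metric.ball (0 : Fin n → ℝ) r := by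
    intro a x
    constructor
    · rintro ⟨y, hy, rfl⟩
      simpa only [inv_smul_smul] using hy
    · exact fun h => ⟨_, h, smul_inv_smul _ _⟩
  refine ⟨fun a => (fun x : Fin n → ℝ => γ a • x) '' Metric.ball 0 r, L, ?_, ?_, ?_, ?_, ?_, ?_, ?_, ?_⟩
  · intro a
    rw [show (fun x : Fin n → ℝ => γ a • x) '' Metric.ball 0 r =
      (fun x : Fin n → ℝ => (γ a)⁻¹ • x) ⁻¹' Metric.ball 0 r from ext (hmemU a)]
    exact isOpen_ball.preimage (hcont _)
  · exact fun a => ((convex_ball _ _).isPreconnected).image _ (hcont _).continuousOn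
  · exact fun a => (nonempty_ball.2 hr).image _
  · exact fun a => (himg (γ a) r).subset (image_mono ball_subset_closedBall)
  · intro x
    obtain ⟨g, hg⟩ := hr₀ x
    obtain ⟨v, hv⟩ := hne
    have hvX := hV₀X v hv
    have haX := hG.smul_singleton_mem g⁻¹ hvX
    refine ⟨g⁻¹ • v, haX, (hmemU _ x).2 ?_⟩
    obtain ⟨w, hw, hvw⟩ := hγ _ haX
    have hgD : g * γ (g⁻¹ • v) ∈ D := by
      refine hmemD _ v w hv hw ?_
      rw [mul_smul, ← hvw, smul_inv_smul]
      exact self_mem_ball hvX 1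
    refine hrB (Or.inr (mem_biUnion hgD ⟨_, hg, ?_⟩))
    simp only [mul_inv_rev, mul_smul, inv_smul_smul]
  · intro a b hab
    refine ⟨γ b • 0, (hmemU a _).2 ?_, ⟨0, mem_ball_self hr, rfl⟩⟩
    obtain ⟨v, hv, hav⟩ := hγ a hab.left
    obtain ⟨w, hw, hbw⟩ := hγ b hab.symm.left
    have hgD : (γ a)⁻¹ * γ b ∈ D := by
      refine hmemD _ v w hv hw ?_
      rw [mul_smul, ← hbw, ← smul_mem_ball_iff hG (γ a), ← hav, smul_inv_smul]
      exact hab.mem_ball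
    refine hrB (Or.inl (mem_biUnion hgD ⟨0, mem_closedBall_self le_rfl, ?_⟩))
    simp only [mul_smul]
  · rintro a b ha hb ⟨x, hxa, hxb⟩
    obtain ⟨v, hv, hav⟩ := hγ a ha
    obtain ⟨w, hw, hbw⟩ := hγ b hb
    rw [hmemU] at hxa
    obtain ⟨y, hy, rfl⟩ := hxb
    have := hL ((γ a)⁻¹ * γ b) v w hv hw ⟨y, hy, by rwa [mul_smul]⟩
    rwa [mul_smul, ← hbw, ← smul_mem_ball_iff hG (γ a), ← hav, smul_inv_smul] at this
  · intro B hB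
    obtain ⟨R, hR⟩ := hB.subset_closedBall 0
    refine ((hprop (max r R)).biUnion fun g _ => hV₀.image (g • ·)).subset ?_
    rintro a ⟨ha, x, ⟨y, hy, rfl⟩, hxB⟩
    obtain ⟨w, hw, haw⟩ := hγ a ha
    refine mem_biUnion (x := γ a) ⟨y, closedBall_subset_closedBall (le_max_left _ _)
      (ball_subset_closedBall hy), closedBall_subset_closedBall (le_max_right _ _) (hR hxB)⟩
      ⟨w, hw, haw.symm⟩

end SComplex

open Metric Bornology in
/-- A group acting properly and cocompactly on a Euclidean space of dimension at least three is not
systolic. -/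
theorem not_isSystolicGroup_of_action {G : Type} [Group G] {n : ℕ} (hn : 3 ≤ n)
    [MulAction G (Fin n → ℝ)] (hcont : ∀ g : G, Continuous fun x : Fin n → ℝ => g • x)
    (hprop : ∀ r, {g : G | ∃ x ∈ closedBall (0 : Fin n → ℝ) r, g • x ∈ closedBall 0 r}.Finite)
    (hcc : ∃ r, ∀ x : Fin n → ℝ, ∃ g : G, g • x ∈ closedBall 0 r) : ¬ IsSystolicGroup G := by
  rintro ⟨V, _, X, _, hX, hG, hst, hco⟩
  obtain ⟨V₀, hV₀, hV₀X, hrep⟩ := hco.exists_vertices hG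
  obtain ⟨N, hN⟩ := hco.exists_card_le
  have := hX.2.1
  have := hX.2.2
  have hconn : ∀ a b, ({a} : Finset V) ∈ X.faces → ({b} : Finset V) ∈ X.faces → X.Joined a b :=
    fun a b => SComplex.joined_of_connected
  have hfin := SComplex.finite_ball (SComplex.finite_adj hst hV₀ hV₀X hrep)
  obtain ⟨⟨f, -, σ, hσ, -⟩⟩ := hX.2.1.toNonempty
  obtain ⟨v₀, hv₀⟩ := X.nonempty_of_mem σ hσ
  have hv₀X := SComplex.singleton_mem hσ hv₀
  have hV₀' : ∀ v, ({v} : Finset V) ∈ X.faces → ∃ g : G, ∃ w ∈ V₀, v = g • w := by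
    intro v hv
    obtain ⟨g, hg⟩ := hrep _ hv
    exact ⟨g, hg v (by simp)⟩
  obtain ⟨-, w, hw, -⟩ := hV₀' v₀ hv₀X
  obtain ⟨U, L, hU⟩ := SComplex.exists_coarseNerve hcont hprop hcc hG hst hV₀ hV₀X hV₀' hconn hfin
    ⟨w, hw⟩
  have hinf : X.vertexSet.Infinite := by
    intro hf
    have hb : IsBounded (⋃ a ∈ X.vertexSet, U a) :=
      (isBounded_biUnion hf).2 fun a _ => hU.isBounded a
    have : Nonempty (Fin n) := ⟨⟨0, by omega⟩⟩
    refine NoncompactSpace.noncompact_univ (X := Fin n → ℝ)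
      (isCompact_of_isClosed_isBounded isClosed_univ (hb.subset fun x _ => ?_))
    obtain ⟨a, ha, hx⟩ := hU.cover x
    exact Set.mem_biUnion ha hx
  have hend := hU.exists_trivOn_compl hX.vertexLarge X.trivOn_self hconn hfin (by
    intro B hB
    obtain ⟨R, hR, hBR⟩ := hB.subset_closedBall_lt 0 0
    exact ⟨_, isBounded_closedBall, hBR, isPreconnected_compl_closedBall (by omega) hR.le,
      cocycleTriv_compl_closedBall hn hR.le⟩)
  exact SComplex.false_of_exists_primitive hfin hN hv₀X
    (SComplex.exists_primitive_uniform hG hV₀ hV₀' hX.vertexLarge X.trivOn_self hconn hfin hinf hend)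

section DeckGroup

open Set Topology Metric

variable {T M : Type} [TopologicalSpace T]

/-- The group of deck transformations of a map. -/
def deckGroup (q : T → M) : Subgroup (T ≃ₜ T) where
  carrier := {g | ∀ e, q (g e) = q e}
  mul_mem' := fun {a b} ha hb e => (ha (b e)).trans (hb e)
  one_mem' := fun _ => rfl
  inv_mem' := fun {a} ha e => by
    have := ha (a⁻¹ e)
    rwa [show a (a⁻¹ e) = e from a.apply_symm_apply e, eq_comm] at this

instance (q : T → M) : MulAction (deckGroup q) T where
  smul g e := g.1 e
  one_smul _ := rfl
  mul_smul _ _ _ := rfl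

theorem deckGroup_map_smul {q : T → M} (g : deckGroup q) (e : T) : q (g • e) = q e := g.2 e

theorem deckGroup_continuous_smul {q : T → M} (g : deckGroup q) : Continuous fun e : T => g • e :=
  g.1.continuous

variable [TopologicalSpace M]

theorem IsCoveringMap.surjective [Nonempty T] [PreconnectedSpace M] {q : T → M}
    (hq : IsCoveringMap q) : Function.Surjective q := by
  rw [← range_eq_univ]
  refine IsClopen.eq_univ ⟨⟨?_⟩, hq.isOpenMap.isOpen_range⟩ (range_nonempty q)
  refine isOpen_iff_mem_nhds.2 fun x hx => ?_
  obtain ⟨-, U, hxU, hU, -, H, hH⟩ := hq x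
  refine Filter.mem_of_superset (hU.mem_nhds hxU) ?_
  rintro _ hy ⟨e, rfl⟩
  refine hx ⟨(H.symm (⟨x, hxU⟩, (H ⟨e, hy⟩).2)).1, ?_⟩
  rw [← hH, H.apply_symm_apply]

theorem exists_deckGroup_smul_eq [SimplyConnectedSpace T] [LocallyPathConnectedSpace T]
    {q : T → M} (hq : IsCoveringMap q) {x y : T} (h : q x = q y) : ∃ g : deckGroup q, g • x = y := by
  have lift : ∀ x y, q x = q y → ∃ F : C(T, T), F x = y ∧ q ∘ F = q := fun x y h =>
    (hq.existsUnique_continuousMap_lifts ⟨q, hq.continuous⟩ x y h.symm).exists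
  obtain ⟨F, hF, hqF⟩ := lift x y h
  obtain ⟨F', hF', hqF'⟩ := lift y x h.symm
  have h₁ : F' ∘ F = id := hq.eq_of_comp_eq (F'.continuous.comp F.continuous) continuous_id
    (by rw [← Function.comp_assoc, hqF', hqF, Function.comp_id]) x
    (by rw [Function.comp_apply, hF, hF', id])
  have h₂ : F ∘ F' = id := hq.eq_of_comp_eq (F.continuous.comp F'.continuous) continuous_id
    (by rw [← Function.comp_assoc, hqF, hqF', Function.comp_id]) y
    (by rw [Function.comp_apply, hF', hF, id])
  exact ⟨⟨{ toFun := F, invFun := F', left_inv := congrFun h₁, right_inv := congrFun h₂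
            continuous_toFun := F.continuous, continuous_invFun := F'.continuous },
          congrFun hqF⟩, hF⟩

theorem IsCoveringMap.isQuotientCoveringMap_deckGroup [SimplyConnectedSpace T]
    [LocallyPathConnectedSpace T] [PreconnectedSpace M] {q : T → M} (hq : IsCoveringMap q) :
    IsQuotientCoveringMap q (deckGroup q) := by
  refine (isQuotientCoveringMap_iff_isCoveringMap_and _ _).2
    ⟨hq, hq.surjective, ⟨deckGroup_continuous_smul⟩, ⟨fun g h e hgh => ?_⟩,
      fun {x y} => ⟨fun h => ?_, ?_⟩⟩
  · refine Subtype.ext (Homeomorph.ext (congrFun (hq.eq_of_comp_eq g.1.continuous h.1.continuous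
      (funext fun x => (g.2 x).trans (h.2 x).symm) e hgh)))
  · obtain ⟨g, rfl⟩ := exists_deckGroup_smul_eq hq h.symm
    exact ⟨g, rfl⟩
  · rintro ⟨g, rfl⟩
    exact deckGroup_map_smul g y

theorem IsQuotientCoveringMap.finite_smul_mem {G : Type} [Group G] [MulAction G T] [T2Space M]
    {q : T → M} (hq : IsQuotientCoveringMap q G) {K : Set T} (hK : IsCompact K) :
    {g : G | ∃ x ∈ K, g • x ∈ K}.Finite := by
  have hc := hq.toContinuousConstSMul
  suffices h : {g : G | ∃ x, (x, g • x) ∈ K ×ˢ K}.Finite by simpa only [mem_prod] using h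
  refine (hK.prod hK).induction_on (p := fun s => {g : G | ∃ x, (x, g • x) ∈ s}.Finite) ?_ ?_ ?_ ?_
  · simp
  · exact fun s t hst ht => ht.subset fun g ⟨x, hx⟩ => ⟨x, hst hx⟩
  · exact fun s t hs ht => (hs.union ht).subset fun g ⟨x, hx⟩ =>
      hx.imp (fun h => ⟨x, h⟩) fun h => ⟨x, h⟩
  · rintro ⟨x, y⟩ -
    by_cases h : q x = q y
    · obtain ⟨g₀, rfl⟩ := hq.apply_eq_iff_mem_orbit.1 h.symm
      obtain ⟨U, hU, hUG⟩ := hq.disjoint x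
      refine ⟨U ×ˢ ((fun z => g₀⁻¹ • z) ⁻¹' U), mem_nhdsWithin_of_mem_nhds (prod_mem_nhds hU
        ((continuous_const_smul g₀⁻¹).continuousAt.preimage_mem_nhds (by simpa using hU))), ?_⟩
      refine (finite_singleton g₀).subset fun g ⟨z, hz⟩ => ?_
      have := hUG (g₀⁻¹ * g) ⟨_, ⟨z, hz.1, rfl⟩, by beta_reduce; rw [mul_smul]; exact hz.2⟩
      exact (inv_mul_eq_one.1 this).symm
    · obtain ⟨A, B, hA, hB, hxA, hyB, hAB⟩ := t2_separation h
      have hqc := hq.toIsQuotientMap.continuous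
      refine ⟨(q ⁻¹' A) ×ˢ (q ⁻¹' B), mem_nhdsWithin_of_mem_nhds (prod_mem_nhds
        ((hA.preimage hqc).mem_nhds hxA) ((hB.preimage hqc).mem_nhds hyB)), ?_⟩
      refine finite_empty.subset fun g ⟨z, hz⟩ => ?_
      have hz₂ : q (g • z) ∈ B := hz.2
      rw [hq.apply_eq_iff_mem_orbit.2 ⟨g, rfl⟩] at hz₂
      exact disjoint_left.1 hAB hz.1 hz₂

theorem exists_image_ball_eq_univ {n : ℕ} [CompactSpace M] {q : (Fin n → ℝ) → M}
    (hq : IsOpenMap q) (hs : Function.Surjective q) : ∃ r, ∀ x, ∃ y ∈ closedBall 0 r, q y = x := by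
  obtain ⟨k, hk⟩ := isCompact_univ.elim_directed_cover (fun k : ℕ => q '' ball 0 k)
    (fun k => hq _ isOpen_ball) (fun x _ => by
      obtain ⟨y, rfl⟩ := hs x
      obtain ⟨k, hk⟩ := exists_nat_gt (dist y 0)
      exact mem_iUnion.2 ⟨k, y, hk, rfl⟩)
    (Monotone.directed_le fun a b hab => image_mono (ball_subset_ball (Nat.cast_le.2 hab)))
  refine ⟨k, fun x => ?_⟩
  obtain ⟨y, hy, rfl⟩ := hk (mem_univ x)
  exact ⟨y, ball_subset_closedBall hy, rfl⟩

theorem IsSystolicGroup.of_mulEquiv {G H : Type} [Group G] [Group H] (e : G ≃* H)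
    (h : IsSystolicGroup G) : IsSystolicGroup H := by
  obtain ⟨V, _, X, _, hX, hG, hst, S, hS, hco⟩ := h
  let _ : MulAction H V := MulAction.compHom V e.symm.toMonoidHom
  refine ⟨V, _, X, ‹_›, hX, fun g => hG (e.symm g), fun σ hσ => ?_, S, hS, fun τ hτ => ?_⟩
  · exact (hst σ hσ).preimage (f := e.symm) e.symm.injective.injOn
  · obtain ⟨σ, hσ, g, rfl⟩ := hco τ hτ
    refine ⟨σ, hσ, e g, ?_⟩
    have : ∀ v : V, e g • v = g • v := fun v => by
      change e.symm (e g) • v = g • v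
      rw [e.symm_apply_apply]
    simp only [this]

end DeckGroup

/-- **Corollary (Osajda, Corollary 3.5).** For `n ≥ 3`, the fundamental group of a
closed manifold whose universal cover is homeomorphic to `ℝⁿ` is not systolic. -/
theorem not_isSystolicGroup_fundamentalGroup_of_univCover_euclidean
    (n : ℕ) (hn : 3 ≤ n) (M : Type) [TopologicalSpace M]
    [ChartedSpace (EuclideanSpace ℝ (Fin n)) M] [T2Space M]
    [CompactSpace M] [ConnectedSpace M]
    (E : Type) [TopologicalSpace E] (p : E → M)
    (hp : IsCoveringMap p) (hsc : SimplyConnectedSpace E)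
    (hE : Nonempty (E ≃ₜ EuclideanSpace ℝ (Fin n)))
    (x : M) :
    ¬ IsSystolicGroup (FundamentalGroup M x) := by
  obtain ⟨f⟩ := hE
  let φ : (Fin n → ℝ) ≃ₜ E := (f.trans (EuclideanSpace.equiv (Fin n) ℝ).toHomeomorph).symm
  have hq : IsCoveringMap (p ∘ φ) := hp.comp_homeomorph φ
  have hQ := hq.isQuotientCoveringMap_deckGroup
  intro hS
  obtain ⟨e, he⟩ := hq.surjective x
  obtain ⟨r, hr⟩ := exists_image_ball_eq_univ hq.isOpenMap hq.surjective
  refine not_isSystolicGroup_of_action hn deckGroup_continuous_smul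
    (fun r => hQ.finite_smul_mem (isCompact_closedBall 0 r)) ⟨r, fun y => ?_⟩
    (hS.of_mulEquiv ((hQ.fundamentalGroupEquiv ⟨e, he⟩).trans (MulEquiv.inv' _).symm))
  obtain ⟨z, hz, hzy⟩ := hr ((p ∘ φ) y)
  obtain ⟨g, rfl⟩ := exists_deckGroup_smul_eq hq hzy.symm
  exact ⟨g, hz⟩
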